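/- For a smooth, spatially Schwartz solution v of the incompressible Navier–Stokes equations on ℝ³ with viscosity ν > 0, there exists a constant C > 0 (independent of v) such that (1/2) d/dt ‖∇v(·,t)‖²_{L²} + ν ‖Δv(·,t)‖²_{L²} ≤ C ‖v(·,t)‖_{L³} ‖Δv(·,t)‖²_{L²}; hence whenever ‖v(·,t)‖_{L³(ℝ³)} ≤ ν/C on an interval, t ↦ ‖∇v(·,t)‖²_{L²} is nonincreasing on that interval. -/

import Mathlib

open MeasureTheory Real

noncomputable def pd (i : Fin 3) (f : EuclideanSpace ℝ (Fin 3) → ℝ)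
    (x : EuclideanSpace ℝ (Fin 3)) : ℝ :=
  fderiv ℝ f x (EuclideanSpace.single i 1)


namespace NSE
open SchwartzMap LineDeriv FourierTransform
open scoped SchwartzMap ENNReal NNReal ContDiff

abbrev E3 := EuclideanSpace ℝ (Fin 3)
abbrev SC := SchwartzMap E3 ℂ

noncomputable def ee (i : Fin 3) : E3 := EuclideanSpace.single i 1
noncomputable def DD (i : Fin 3) (f : SC) : SC := ∂_{ee i} f
noncomputable def mulS (g : E3 → ℂ) (f : SC) : SC := smulLeftCLM ℂ g f
noncomputable def prodS (f g : SC) : SC := pairing (ContinuousLinearMap.mul ℂ ℂ) f g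
noncomputable def ft (f : SC) : SC := 𝓕 f
noncomputable def fi (f : SC) : SC := 𝓕⁻ f

@[simp] lemma prodS_apply (f g : SC) (x : E3) : prodS f g x = f x * g x := rfl

lemma mulS_apply {g : E3 → ℂ} (hg : g.HasTemperateGrowth) (f : SC) (x : E3) :
    mulS g f x = g x * f x := by
  simp [mulS, smulLeftCLM_apply_apply hg]

lemma DD_apply (i : Fin 3) (f : SC) (x : E3) : DD i f x = fderiv ℝ f x (ee i) :=
  lineDerivOp_apply_eq_fderiv _ _ _

lemma inner_ee (i : Fin 3) (x : E3) : inner ℝ x (ee i) = x i := by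
  simp [ee, EuclideanSpace.inner_single_right]

lemma tg_coord (i : Fin 3) : (fun ξ : E3 => ((ξ i : ℝ) : ℂ)).HasTemperateGrowth := by
  have : (fun ξ : E3 => ((ξ i : ℝ) : ℂ)) = Complex.ofReal ∘ (fun ξ : E3 => inner ℝ ξ (ee i)) := by
    funext ξ; simp [inner_ee]
  rw [this]
  exact Function.Complex.hasTemperateGrowth_ofReal.comp (Function.hasTemperateGrowth_inner_left _)

lemma tg_ofReal {w : E3 → ℝ} (hw : w.HasTemperateGrowth) :
    (fun ξ : E3 => ((w ξ : ℝ) : ℂ)).HasTemperateGrowth :=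
  Function.Complex.hasTemperateGrowth_ofReal.comp hw

lemma ft_DD (i : Fin 3) (f : SC) (ξ : E3) :
    ft (DD i f) ξ = (2 * π * Complex.I) * (ξ i : ℝ) * ft f ξ := by
  have : (fun x : E3 => inner ℝ x (ee i)).HasTemperateGrowth :=
    Function.hasTemperateGrowth_inner_left _
  simp only [ft, DD, fourier_lineDerivOp_eq]
  rw [smul_apply, smulLeftCLM_apply_apply this, inner_ee]
  simp [mul_assoc]

lemma DD_ft (i : Fin 3) (f : SC) :
    DD i (ft f) = ft (mulS (fun ξ => -(2 * π * Complex.I) * (ξ i : ℝ)) f) := by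
  have : (fun x : E3 => inner ℝ x (ee i)).HasTemperateGrowth :=
    Function.hasTemperateGrowth_inner_left _
  simp only [ft, DD, lineDerivOp_fourier_eq]
  congr 1
  ext x
  rw [mulS_apply (g := fun ξ => -(2 * π * Complex.I) * (ξ i : ℝ))
      ((Function.HasTemperateGrowth.const _).mul (tg_coord i)),
    smul_apply, smulLeftCLM_apply_apply this, inner_ee]
  simp [mul_assoc]

lemma int_ft_mul (f g : SC) : ∫ ξ, ft f ξ * g ξ = ∫ x, f x * ft g x :=
  integral_fourier_mul_eq f g

lemma parseval (f : SC) : ∫ ξ, ‖ft f ξ‖ ^ 2 = ∫ x, ‖f x‖ ^ 2 := integral_norm_sq_fourier f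

@[simp] lemma ft_fi (f : SC) : ft (fi f) = f := by simp [ft, fi]
@[simp] lemma fi_ft (f : SC) : fi (ft f) = f := by simp [ft, fi]

lemma ft_apply (f : SC) (ξ : E3) :
    ft f ξ = ∫ x, 𝐞 (-inner ℝ x ξ) • f x := by
  simp only [ft, fourier_coe]
  exact Real.fourier_eq (f : E3 → ℂ) ξ

lemma fi_apply (f : SC) (ξ : E3) :
    fi f ξ = ∫ x, 𝐞 (inner ℝ x ξ) • f x := by
  simp only [fi, fourierInv_coe]
  exact Real.fourierInv_eq (f : E3 → ℂ) ξ

lemma fi_neg (f : SC) (ξ : E3) : fi f (-ξ) = ft f ξ := by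
  simp [ft_apply, fi_apply]

lemma ft_neg (f : SC) (ξ : E3) : ft f (-ξ) = fi f ξ := by
  simp [ft_apply, fi_apply]

/-- real-valued -/
def IsR (f : SC) : Prop := ∀ x, (starRingEnd ℂ) (f x) = f x

lemma conj_ft {f : SC} (hf : IsR f) (ξ : E3) : (starRingEnd ℂ) (ft f ξ) = fi f ξ := by
  rw [ft_apply, fi_apply, ← integral_conj]
  congr 1; funext x
  rw [Circle.smul_def, Circle.smul_def, smul_eq_mul, smul_eq_mul, map_mul, hf x]
  congr 1
  rw [← Circle.coe_inv_eq_conj]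
  congr 1
  simp [AddChar.map_neg_eq_inv]
  rfl

lemma norm_fi {f : SC} (hf : IsR f) (ξ : E3) : ‖fi f ξ‖ = ‖ft f ξ‖ := by
  rw [← conj_ft hf]; simp

lemma fi_mul_ft {f : SC} (hf : IsR f) (ξ : E3) : fi f ξ * ft f ξ = ((‖ft f ξ‖ ^ 2 : ℝ) : ℂ) := by
  rw [← conj_ft hf, mul_comm, Complex.mul_conj, Complex.normSq_eq_norm_sq]

lemma norm_le_int_ft (f : SC) (x : E3) : ‖f x‖ ≤ ∫ ξ, ‖ft f ξ‖ := by
  have : f x = fi (ft f) x := by simp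
  rw [this, fi_apply]
  refine (norm_integral_le_integral_norm _).trans (le_of_eq ?_)
  congr 1; funext ξ; simp

lemma norm_ft_le (f : SC) (x : E3) : ‖ft f x‖ ≤ ∫ ξ, ‖f ξ‖ := by
  rw [ft_apply]
  refine (norm_integral_le_integral_norm _).trans (le_of_eq ?_)
  congr 1; funext ξ; simp

lemma norm_ft_prodS (f g : SC) (ξ : E3) :
    ‖ft (prodS f g) ξ‖ₑ ≤ ∫⁻ η, ‖ft f η‖ₑ * ‖ft g (ξ - η)‖ₑ := by
  have h1 : fi (prodS f g) = convolution (ContinuousLinearMap.mul ℂ ℂ) (fi f) (fi g) := by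
    have := fourier_convolution (ContinuousLinearMap.mul ℂ ℂ) (fi f) (fi g)
    have h2 : prodS f g = ft (convolution (ContinuousLinearMap.mul ℂ ℂ) (fi f) (fi g)) := by
      rw [ft, this]
      change _ = prodS (ft (fi f)) (ft (fi g))
      simp
    rw [h2, fi_ft]
  rw [← fi_neg, h1, SchwartzMap.convolution_apply]
  rw [MeasureTheory.convolution_def]
  refine (enorm_integral_le_lintegral_enorm _).trans (le_of_eq ?_)
  rw [← lintegral_sub_left_eq_self _ (0:E3)]
  congr 1; funext η
  simp only [ContinuousLinearMap.mul_apply', enorm_mul, zero_sub]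
  rw [show (-ξ - -η : E3) = -(ξ - η) by abel, fi_neg, fi_neg]

lemma ibp (f g : SC) (i : Fin 3) : ∫ x, f x * DD i g x = - ∫ x, DD i f x * g x :=
  integral_mul_lineDerivOp_right_eq_neg_left f g (ee i)

lemma tg_gauss {c : ℝ} (hc : 0 ≤ c) : (fun ξ : E3 => Real.exp (-c * ‖ξ‖ ^ 2)).HasTemperateGrowth := by
  have : (fun ξ : E3 => Real.exp (-c * ‖ξ‖ ^ 2)) = Real.exp ∘ (fun ξ : E3 => -c * ‖ξ‖ ^ 2) := rfl
  rw [this]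
  have h1 : (fun ξ : E3 => -c * ‖ξ‖ ^ 2).HasTemperateGrowth := by fun_prop
  refine h1.comp' (t := Set.Iio (1:ℝ)) ?_ (isOpen_Iio.uniqueDiffOn) Real.contDiff_exp.contDiffOn ?_
  · rintro _ ⟨ξ, rfl⟩
    have : 0 ≤ c * ‖ξ‖ ^ 2 := by positivity
    simp only [Set.mem_Iio]; linarith
  · intro N
    refine ⟨0, Real.exp 1, (Real.exp_pos 1).le, fun n _ x hx => ?_⟩
    rw [norm_iteratedFDerivWithin_eq_norm_iteratedDerivWithin,
      iteratedDerivWithin_of_isOpen isOpen_Iio hx, iteratedDeriv_eq_iterate]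
    simp only [Real.iter_deriv_exp, Real.norm_eq_abs, Real.abs_exp, pow_zero, mul_one]
    exact Real.exp_le_exp.2 (le_of_lt hx)

lemma tg_bessel (r : ℝ) : (fun ξ : E3 => (1 + ‖ξ‖ ^ 2) ^ r).HasTemperateGrowth :=
  Function.hasTemperateGrowth_one_add_norm_sq_rpow E3 r

lemma tg_resolvent (R : ℝ) : (fun ξ : E3 => (1 + R ^ 2 * ‖ξ‖ ^ 2)⁻¹).HasTemperateGrowth := by
  have h := (tg_bessel (-1)).comp ((R • ContinuousLinearMap.id ℝ E3).hasTemperateGrowth)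
  convert h using 1
  funext ξ
  simp [norm_smul, mul_pow, Real.rpow_neg_one]

lemma int_sq (f : SC) (w : E3 → ℝ) (hw : w.HasTemperateGrowth) :
    Integrable (fun ξ => w ξ * ‖f ξ‖ ^ 2) := by
  have h1 : Integrable (fun ξ => ‖prodS (mulS (fun ξ => (w ξ : ℂ)) f) f ξ‖) :=
    (prodS (mulS (fun ξ => (w ξ : ℂ)) f) f).integrable.norm
  refine h1.mono' ?_ (Filter.Eventually.of_forall fun ξ => ?_)
  · exact ((hw.1.continuous).mul (f.continuous.norm.pow 2)).aestronglyMeasurable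
  · rw [prodS_apply, mulS_apply (tg_ofReal hw)]
    simp only [norm_mul, Complex.norm_real, Real.norm_eq_abs, abs_pow, abs_norm]
    rw [pow_two, mul_assoc]

lemma int_norm (f : SC) (w : E3 → ℝ) (hw : w.HasTemperateGrowth) :
    Integrable (fun ξ => w ξ * ‖f ξ‖) := by
  have h1 := (mulS (fun ξ => (w ξ : ℂ)) f).integrable.norm (μ := volume)
  refine h1.mono' ?_ (Filter.Eventually.of_forall fun ξ => ?_)
  · exact ((hw.1.continuous).mul (f.continuous.norm)).aestronglyMeasurable
  · rw [mulS_apply (tg_ofReal hw)]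
    simp

end NSE


namespace NSE
open SchwartzMap LineDeriv FourierTransform
open scoped SchwartzMap ENNReal NNReal ContDiff

lemma sob_compact : ∃ K : ℝ≥0, ∀ u : E3 → ℂ, ContDiff ℝ 1 u → HasCompactSupport u →
    eLpNorm u 6 volume ≤ K * eLpNorm (fderiv ℝ u) 2 volume := by
  refine ⟨SNormLESNormFDerivOfEqConst ℂ (volume : Measure E3) 2, fun u hu h2 => ?_⟩
  have := eLpNorm_le_eLpNorm_fderiv_of_eq (volume : Measure E3) hu h2 (p := 2) (p' := 6) (by norm_num)
    (by simp) (by simp; norm_num)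
  simpa using this

lemma exists_bump : ∃ χ : E3 → ℝ, ContDiff ℝ ∞ χ ∧ HasCompactSupport χ ∧ (∀ x, 0 ≤ χ x ∧ χ x ≤ 1) ∧
    (∀ x, ‖x‖ ≤ 1 → χ x = 1) := by
  let b : ContDiffBump (0 : E3) := ⟨1, 2, by norm_num, by norm_num⟩
  exact ⟨b, b.contDiff, b.hasCompactSupport, fun x => ⟨b.nonneg, b.le_one⟩,
    fun x hx => b.one_of_mem_closedBall (by simpa [b] using hx)⟩

lemma bump_fderiv (χ : E3 → ℝ) (hχd : ContDiff ℝ 1 χ) (f : SC) (c : ℝ) :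
    fderiv ℝ (fun x => (χ (c • x)) • f x) = (fun x => χ (c • x) • fderiv ℝ f x) +
        (fun x => (c • fderiv ℝ χ (c • x)).smulRight (f x)) := by
  funext x
  have h2 : HasFDerivAt χ (fderiv ℝ χ (c • x)) (c • x) :=
    (hχd.differentiable (by simp) _).hasFDerivAt
  have h3 : HasFDerivAt (fun x : E3 => c • x) (c • ContinuousLinearMap.id ℝ E3) x :=
    (hasFDerivAt_id x).const_smul c
  have h4 := h2.comp x h3
  have e : (fderiv ℝ χ (c • x)).comp (c • ContinuousLinearMap.id ℝ E3) = c • fderiv ℝ χ (c • x) := by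
    ext y; simp
  rw [e] at h4
  have h5 := (h4.smul (f.hasFDerivAt x)).fderiv
  exact h5

lemma bump_bound (χ : E3 → ℝ) (hχd : ContDiff ℝ 1 χ) (hχ3 : ∀ x, 0 ≤ χ x ∧ χ x ≤ 1) (f : SC) (c : ℝ)
    (hc : 0 ≤ c) (B : ℝ) (hB : ∀ x, ‖fderiv ℝ χ x‖ ≤ B) :
    eLpNorm (fderiv ℝ (fun x => (χ (c • x)) • f x)) 2 volume ≤
      eLpNorm (fderiv ℝ f) 2 volume + ENNReal.ofReal (c * B) * eLpNorm f 2 volume := by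
  have hd : Continuous (fderiv ℝ χ) := hχd.continuous_fderiv (by simp)
  have hcf : Continuous (fderiv ℝ f) := (f.smooth 1).continuous_fderiv (by simp)
  have hcc : Continuous (fun x : E3 => c • x) := continuous_const_smul c
  rw [bump_fderiv χ hχd f c]
  have m1 : AEStronglyMeasurable (fun x => χ (c • x) • fderiv ℝ f x) volume :=
    ((hχd.continuous.comp hcc).smul hcf).aestronglyMeasurable
  have m2 : AEStronglyMeasurable (fun x => (c • fderiv ℝ χ (c • x)).smulRight (f x)) volume := by
    apply Continuous.aestronglyMeasurable
    have h : Continuous (fun x => c • fderiv ℝ χ (c • x)) := (hd.comp hcc).const_smul c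
    have h' : Continuous (fun p : (E3 →L[ℝ] ℝ) × ℂ => p.1.smulRight p.2) :=
      (ContinuousLinearMap.smulRightL ℝ E3 ℂ).continuous₂
    exact h'.comp (h.prodMk f.continuous)
  have h12 : (1 : ℝ≥0∞) ≤ 2 := one_le_two
  refine (eLpNorm_add_le m1 m2 h12).trans ?_
  apply add_le_add
  · apply eLpNorm_mono
    intro x
    rw [norm_smul]
    have := hχ3 (c • x)
    rw [Real.norm_eq_abs, abs_of_nonneg this.1]
    exact mul_le_of_le_one_left (norm_nonneg _) this.2
  · refine (eLpNorm_le_mul_eLpNorm_of_ae_le_mul (g := f) (c := c * B) ?_ 2)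
    refine Filter.Eventually.of_forall fun x => ?_
    rw [ContinuousLinearMap.norm_smulRight_apply, norm_smul, Real.norm_eq_abs, abs_of_nonneg hc]
    have := hB (c • x)
    gcongr

lemma liminf_aux (L : ℕ → ℝ≥0∞) (K : ℝ≥0) (X Y : ℝ≥0∞) (B : ℝ) (hY : Y ≠ ⊤) (c : ℕ → ℝ)
    (hcl : Filter.Tendsto c Filter.atTop (nhds 0))
    (h : ∀ n, L n ≤ K * (X + ENNReal.ofReal (c n * B) * Y)) :
    Filter.liminf L Filter.atTop ≤ K * X := by
  refine (Filter.liminf_le_liminf (Filter.Eventually.of_forall h)).trans ?_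
  apply le_of_eq
  apply Filter.Tendsto.liminf_eq
  have h3 : Filter.Tendsto (fun n => ENNReal.ofReal (c n * B) * Y) Filter.atTop (nhds 0) := by
    have h5 : Filter.Tendsto (fun n => ENNReal.ofReal (c n * B)) Filter.atTop (nhds 0) := by
      have := ENNReal.tendsto_ofReal (hcl.mul_const B)
      simpa using this
    have := ENNReal.Tendsto.mul_const (b := Y) h5 (Or.inr hY)
    simpa using this
  have h4 := h3.const_add X
  rw [add_zero] at h4
  exact ENNReal.Tendsto.const_mul h4 (Or.inr (by simp))

lemma exists_seq : ∃ c : ℕ → ℝ, (∀ n, 0 < c n) ∧ (∀ (n : ℕ) (y : ℝ), y ≤ n → c n * y ≤ 1) ∧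
    Filter.Tendsto c Filter.atTop (nhds 0) := by
  refine ⟨fun n => 1 / ((n : ℝ) + 1), fun n => by positivity, fun n y hy => ?_,
    tendsto_one_div_add_atTop_nhds_zero_nat (𝕜 := ℝ)⟩
  beta_reduce; rw [one_div, inv_mul_le_iff₀ (by positivity)]
  linarith

lemma bump_cs (χ : E3 → ℝ) (h : HasCompactSupport χ) (f : SC) (c : ℝ) (hc : c ≠ 0) :
    HasCompactSupport (fun x => (χ (c • x)) • f x) := by
  have h1 : HasCompactSupport (fun x : E3 => χ (c • x)) :=
    h.comp_homeomorph (Homeomorph.smulOfNeZero c hc)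
  exact HasCompactSupport.smul_right (f := fun x : E3 => χ (c • x)) (f' := (f : E3 → ℂ)) h1

lemma sob_schwartz : ∃ K : ℝ≥0, ∀ f : SC,
    eLpNorm f 6 volume ≤ K * eLpNorm (fderiv ℝ f) 2 volume := by
  obtain ⟨K, hK⟩ := sob_compact
  obtain ⟨χ, hχ1, hχ2, hχ3, hχ4⟩ := exists_bump
  obtain ⟨c, hc0, hc1, hcl⟩ := exists_seq
  refine ⟨K, fun f => ?_⟩
  have hχd : ContDiff ℝ 1 χ := hχ1.of_le (by simp)
  have hd : Continuous (fderiv ℝ χ) := hχd.continuous_fderiv (by simp)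
  obtain ⟨B, hB⟩ := hd.bounded_above_of_compact_support (hχ2.fderiv (𝕜 := ℝ))
  have hFd : ∀ n, ContDiff ℝ 1 (fun x => (χ (c n • x)) • f x) := fun n =>
    (hχd.comp (contDiff_const_smul (c n))).smul (f.smooth 1)
  have hlim : ∀ᵐ x, Filter.Tendsto (fun n => (χ (c n • x)) • f x) Filter.atTop (nhds (f x)) := by
    refine Filter.Eventually.of_forall fun x => ?_
    apply tendsto_const_nhds.congr'
    obtain ⟨N, hN⟩ := exists_nat_ge ‖x‖
    filter_upwards [Filter.eventually_ge_atTop N] with n hn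
    have : χ (c n • x) = 1 := by
      apply hχ4
      rw [norm_smul, Real.norm_eq_abs, abs_of_pos (hc0 n)]
      refine hc1 n _ (hN.trans ?_)
      exact_mod_cast hn
    rw [this, one_smul]
  have hbd : ∀ n, eLpNorm (fun x => (χ (c n • x)) • f x) 6 volume ≤
      K * (eLpNorm (fderiv ℝ f) 2 volume + ENNReal.ofReal (c n * B) * eLpNorm f 2 volume) := by
    intro n
    refine (hK _ (hFd n) (bump_cs χ hχ2 f (c n) (hc0 n).ne')).trans ?_
    have := bump_bound χ hχd (fun x => (hχ3 x)) f (c n) (hc0 n).le B hB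
    exact mul_le_mul_right this _
  have h2 := Lp.eLpNorm_lim_le_liminf_eLpNorm (p := 6) (μ := volume)
    (fun n => (hFd n).continuous.aestronglyMeasurable) f hlim
  have h7 : eLpNorm f 2 volume ≠ ⊤ := (f.memLp 2 volume).2.ne
  have h3 := liminf_aux (fun n => eLpNorm (fun x => (χ (c n • x)) • f x) 6 volume) K
    (eLpNorm (fderiv ℝ f) 2 volume) (eLpNorm f 2 volume) B h7 c hcl hbd
  exact le_trans h2 h3

lemma norm_fderiv_sq_le (f : SC) (x : E3) : ‖fderiv ℝ f x‖ ^ 2 ≤ ∑ i, ‖DD i f x‖ ^ 2 := by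
  have h : ‖fderiv ℝ f x‖ ≤ Real.sqrt (∑ i, ‖DD i f x‖ ^ 2) := by
    apply ContinuousLinearMap.opNorm_le_bound _ (Real.sqrt_nonneg _)
    intro y
    have hy : y = ∑ i, y i • ee i := by
      ext j; simp [ee, Pi.single_apply]
    have h1 : fderiv ℝ f x y = ∑ i, (y i) • DD i f x := by
      conv_lhs => rw [hy]
      simp [map_sum, DD_apply]
    rw [h1]
    refine (norm_sum_le _ _).trans ?_
    simp_rw [norm_smul]
    have h2 := Finset.sum_mul_sq_le_sq_mul_sq Finset.univ (fun i => ‖y i‖) (fun i => ‖DD i f x‖)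
    rw [EuclideanSpace.norm_eq, ← Real.sqrt_mul (by positivity)]
    apply Real.le_sqrt_of_sq_le
    rw [mul_comm]; exact h2
  calc ‖fderiv ℝ f x‖ ^ 2 ≤ (Real.sqrt (∑ i, ‖DD i f x‖ ^ 2)) ^ 2 := by gcongr
    _ = _ := Real.sq_sqrt (by positivity)

lemma int_pow (f : SC) (n : ℕ) (hn : n ≠ 0) : Integrable (fun x => ‖f x‖ ^ n) := by
  have := (f.memLp (n : ℝ≥0∞) volume).integrable_norm_pow hn
  exact this

lemma int_sumsq (g : Fin 3 → SC) : Integrable (fun x => ∑ i, ‖g i x‖ ^ 2) :=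
  integrable_finsetSum _ fun i _ => int_pow (g i) 2 (by simp)

lemma sobolev6 : ∃ C : ℝ, 0 < C ∧ ∀ f : SC,
    ∫ x, ‖f x‖ ^ 6 ≤ C * (∫ x, ∑ i, ‖DD i f x‖ ^ 2) ^ 3 := by
  obtain ⟨K, hK⟩ := sob_schwartz
  refine ⟨(K : ℝ) ^ 6 + 1, by positivity, fun f => ?_⟩
  have h0 : 0 ≤ ∫ x, ∑ i, ‖DD i f x‖ ^ 2 := integral_nonneg fun x => by positivity
  have h6 : (eLpNorm f 6 volume) ^ 6 = ENNReal.ofReal (∫ x, ‖f x‖ ^ 6) := by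
    have := eLpNorm_nnreal_pow_eq_lintegral (μ := volume) (f := f) (p := 6) (by norm_num)
    have h := ofReal_integral_eq_lintegral_ofReal (int_pow f 6 (by simp))
      (Filter.Eventually.of_forall fun x => by positivity)
    rw [h]
    simp only [ENNReal.coe_ofNat, NNReal.coe_ofNat] at this
    have e : ((6:ℝ)) = ((6:ℕ):ℝ) := by norm_num
    rw [e] at this
    simp only [ENNReal.rpow_natCast] at this
    rw [this]
    congr 1; funext x
    rw [ENNReal.ofReal_pow (norm_nonneg _), ofReal_norm]
  have h2 : (eLpNorm (fderiv ℝ f) 2 volume) ^ 2 ≤ ENNReal.ofReal (∫ x, ∑ i, ‖DD i f x‖ ^ 2) := by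
    have := eLpNorm_nnreal_pow_eq_lintegral (μ := volume) (f := fderiv ℝ f) (p := 2) (by norm_num)
    have h := ofReal_integral_eq_lintegral_ofReal (int_sumsq (fun i => DD i f))
      (Filter.Eventually.of_forall fun x => by positivity)
    rw [h]
    simp only [ENNReal.coe_ofNat, NNReal.coe_ofNat] at this
    have e : ((2:ℝ)) = ((2:ℕ):ℝ) := by norm_num
    rw [e] at this
    simp only [ENNReal.rpow_natCast] at this
    rw [this]
    apply lintegral_mono
    intro x
    dsimp only
    rw [← ofReal_norm, ← ENNReal.ofReal_pow (norm_nonneg _)]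
    exact ENNReal.ofReal_le_ofReal (norm_fderiv_sq_le f x)
  have : ENNReal.ofReal (∫ x, ‖f x‖ ^ 6) ≤
      ENNReal.ofReal (((K : ℝ) ^ 6 + 1) * (∫ x, ∑ i, ‖DD i f x‖ ^ 2) ^ 3) := by
    rw [← h6]
    calc _ ≤ (K * eLpNorm (fderiv ℝ f) 2 volume) ^ 6 := by gcongr; exact hK f
      _ = (K:ℝ≥0∞) ^ 6 * ((eLpNorm (fderiv ℝ f) 2 volume) ^ 2) ^ 3 := by ring
      _ ≤ (K:ℝ≥0∞) ^ 6 * (ENNReal.ofReal (∫ x, ∑ i, ‖DD i f x‖ ^ 2)) ^ 3 := by gcongr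
      _ = ENNReal.ofReal ((K:ℝ) ^ 6 * (∫ x, ∑ i, ‖DD i f x‖ ^ 2) ^ 3) := by
        rw [ENNReal.ofReal_mul (by positivity), ENNReal.ofReal_pow h0, ENNReal.ofReal_pow (by positivity)]
        simp
      _ ≤ _ := by
        apply ENNReal.ofReal_le_ofReal
        gcongr; simp
  exact (ENNReal.ofReal_le_ofReal_iff (by positivity)).1 this

end NSE


namespace NSE
open SchwartzMap LineDeriv FourierTransform
open scoped SchwartzMap ENNReal NNReal ContDiff

lemma ft_add (f g : SC) : ft (f+g) = ft f + ft g := by simp [ft, FourierTransform.fourier_add]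
lemma ft_smul (c : ℂ) (f : SC) : ft (c • f) = c • ft f := by simp [ft, FourierTransform.fourier_smul]
lemma ft_sub (f g : SC) : ft (f-g) = ft f - ft g := by
  have := ft_add (f - g) g
  rw [sub_add_cancel] at this; rw [this]; simp
lemma DD_add (i) (f g : SC) : DD i (f+g) = DD i f + DD i g := by simp [DD, LineDeriv.lineDerivOp_add]
lemma DD_smul (i) (c : ℂ) (f : SC) : DD i (c • f) = c • DD i f := by
  simp [DD, LineDeriv.lineDerivOp_smul]
lemma DD_sub (i) (f g : SC) : DD i (f-g) = DD i f - DD i g := by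
  have := DD_add i (f - g) g
  rw [sub_add_cancel] at this; rw [this]; simp
lemma ft_zero : ft 0 = 0 := by have := ft_smul 0 0; simpa using this
lemma DD_zero (i) : DD i 0 = 0 := by have := DD_smul i 0 0; simpa using this
lemma ft_sum {ι : Type*} (s : Finset ι) (f : ι → SC) : ft (∑ i ∈ s, f i) = ∑ i ∈ s, ft (f i) := by
  classical
  induction s using Finset.induction_on with
  | empty => simp [ft_zero]
  | insert a s ha ih => rw [Finset.sum_insert ha, Finset.sum_insert ha, ft_add, ih]
lemma DD_sum {ι : Type*} (k) (s : Finset ι) (f : ι → SC) : DD k (∑ i ∈ s, f i) = ∑ i ∈ s, DD k (f i) := by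
  classical
  induction s using Finset.induction_on with
  | empty => simp [DD_zero]
  | insert a s ha ih => rw [Finset.sum_insert ha, Finset.sum_insert ha, DD_add, ih]

lemma sum_apply' {ι : Type*} (s : Finset ι) (f : ι → SC) (x : E3) : (∑ i ∈ s, f i) x = ∑ i ∈ s, f i x := by
  classical
  induction s using Finset.induction_on with
  | empty => simp
  | insert a s ha ih => rw [Finset.sum_insert ha, Finset.sum_insert ha, add_apply, ih]

lemma DD_prodS (i) (f g : SC) : DD i (prodS f g) = prodS (DD i f) g + prodS f (DD i g) := by
  ext x
  have h : HasFDerivAt (prodS f g) (f x • fderiv ℝ g x + g x • fderiv ℝ f x) x :=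
    (f.hasFDerivAt x).mul (g.hasFDerivAt x)
  rw [DD_apply, h.fderiv]
  simp [DD_apply]
  ring

lemma DD_comm (i j) (f : SC) : DD i (DD j f) = DD j (DD i f) := by
  have h : ft (DD i (DD j f)) = ft (DD j (DD i f)) := by
    ext ξ; simp only [ft_DD]; ring
  rw [← fi_ft (DD i (DD j f)), h, fi_ft]

/-- Cauchy-Schwarz -/
lemma cs {f g : E3 → ℝ} (hf : AEStronglyMeasurable f volume) (hg : AEStronglyMeasurable g volume)
    (hf2 : Integrable (fun x => f x ^ 2)) (hg2 : Integrable (fun x => g x ^ 2)) :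
    Integrable (fun x => f x * g x) ∧
    ∫ x, |f x * g x| ≤ √(∫ x, f x ^ 2) * √(∫ x, g x ^ 2) := by
  have mf : MemLp f 2 volume := (memLp_two_iff_integrable_sq hf).2 hf2
  have mg : MemLp g 2 volume := (memLp_two_iff_integrable_sq hg).2 hg2
  refine ⟨mf.integrable_mul mg, ?_⟩
  have h := integral_mul_le_Lp_mul_Lq_of_nonneg (μ := volume) (f := fun x => |f x|) (g := fun x => |g x|)
    Real.HolderConjugate.two_two (Filter.Eventually.of_forall fun x => abs_nonneg _)
    (Filter.Eventually.of_forall fun x => abs_nonneg _)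
    (by simpa using mf.norm) (by simpa using mg.norm)
  simp only [abs_mul]
  simpa [Real.sqrt_eq_rpow] using h

/-- ENNReal version of weighted CS -/
lemma cs_enn {a b : E3 → ℝ≥0∞} (ha : AEMeasurable a volume) (hb : AEMeasurable b volume) :
    (∫⁻ x, a x * b x) ^ 2 ≤ (∫⁻ x, a x ^ 2 * b x) * ∫⁻ x, b x := by
  have h := ENNReal.lintegral_mul_le_Lp_mul_Lq (volume : Measure E3) Real.HolderConjugate.two_two
    (f := fun x => a x * b x ^ (1/2 : ℝ)) (g := fun x => b x ^ (1/2:ℝ)) (ha.mul (hb.pow_const _)) (hb.pow_const _)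
  have e1 : ∀ x, ((fun x => a x * b x ^ (1/2 : ℝ)) * (fun x => b x ^ (1/2:ℝ))) x = a x * b x := by
    intro x
    simp only [Pi.mul_apply, mul_assoc]
    rw [← ENNReal.rpow_add_of_nonneg _ _ (by norm_num) (by norm_num)]; norm_num
  have e2 : ∀ y : ℝ≥0∞, (y ^ (1/2:ℝ)) ^ (2:ℝ) = y := by
    intro y; rw [← ENNReal.rpow_mul]; norm_num
  have e3 : ∀ x, (a x * b x ^ (1/2 : ℝ)) ^ (2:ℝ) = a x ^ 2 * b x := by
    intro x; rw [ENNReal.mul_rpow_of_nonneg _ _ (by norm_num), e2]; norm_num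
  simp only [e1, e2, e3] at h
  calc _ ≤ ((∫⁻ x, a x ^ 2 * b x) ^ (1/2:ℝ) * (∫⁻ x, b x) ^ (1/2:ℝ)) ^ 2 := by gcongr
    _ = _ := by
      rw [mul_pow, ← ENNReal.rpow_natCast, ← ENNReal.rpow_natCast]
      simp only [Nat.cast_ofNat, e2]

/-- Young -/
lemma young {a b : E3 → ℝ≥0∞} (ha : Measurable a) (hb : Measurable b) :
    ∫⁻ ξ, (∫⁻ η, a η * b (ξ - η)) ^ 2 ≤ (∫⁻ η, a η ^ 2) * (∫⁻ η, b η) ^ 2 := by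
  calc _ ≤ ∫⁻ ξ, (∫⁻ η, a η ^ 2 * b (ξ - η)) * ∫⁻ η, b η := by
        apply lintegral_mono
        intro ξ
        have := cs_enn (a := a) (b := fun η => b (ξ - η)) ha.aemeasurable
          (hb.comp (measurable_const.sub measurable_id)).aemeasurable
        rw [lintegral_sub_left_eq_self b ξ] at this
        exact this
    _ = (∫⁻ ξ, ∫⁻ η, a η ^ 2 * b (ξ - η)) * ∫⁻ η, b η := by
        apply lintegral_mul_const
        apply Measurable.lintegral_prod_right'
          (f := fun p : E3 × E3 => a p.2 ^ 2 * b (p.1 - p.2))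
        fun_prop
    _ = (∫⁻ η, a η ^ 2 * ∫⁻ ξ, b ξ) * ∫⁻ η, b η := by
        congr 1
        rw [lintegral_lintegral_swap (by fun_prop)]
        congr 1; funext η
        rw [lintegral_const_mul _ (by fun_prop)]
        rw [lintegral_sub_right_eq_self]
    _ = _ := by
        rw [lintegral_mul_const _ (by fun_prop)]; ring

structure Wt (W : E3 → ℝ) : Prop where
  tg : W.HasTemperateGrowth
  nn : ∀ ξ, 0 ≤ W ξ

/-- scalar weighted square norm -/
noncomputable def n1 (W : E3 → ℝ) (f : SC) : ℝ := ∫ ξ, W ξ * ‖ft f ξ‖ ^ 2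
/-- L1 norm of fourier transform -/
noncomputable def A1 (f : SC) : ℝ := ∫ ξ, ‖ft f ξ‖

lemma A1_nonneg (f : SC) : 0 ≤ A1 f := integral_nonneg fun _ => norm_nonneg _
lemma n1_nonneg {W} (hW : Wt W) (f : SC) : 0 ≤ n1 W f :=
  integral_nonneg fun ξ => mul_nonneg (hW.nn ξ) (by positivity)

lemma ofReal_n1 {W} (hW : Wt W) (f : SC) :
    ENNReal.ofReal (n1 W f) = ∫⁻ ξ, (ENNReal.ofReal √(W ξ) * ‖ft f ξ‖ₑ) ^ 2 := by
  rw [n1, ofReal_integral_eq_lintegral_ofReal (int_sq _ _ hW.tg)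
    (Filter.Eventually.of_forall fun ξ => mul_nonneg (hW.nn ξ) (by positivity))]
  congr 1; funext ξ
  rw [mul_pow, ← ENNReal.ofReal_pow (Real.sqrt_nonneg _), Real.sq_sqrt (hW.nn ξ),
    ENNReal.ofReal_mul (hW.nn ξ), ENNReal.ofReal_pow (norm_nonneg _), ofReal_norm]

lemma ofReal_A1 (f : SC) : ENNReal.ofReal (A1 f) = ∫⁻ ξ, ‖ft f ξ‖ₑ := by
  rw [A1, ofReal_integral_eq_lintegral_ofReal (ft f).integrable.norm
    (Filter.Eventually.of_forall fun ξ => norm_nonneg _)]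
  congr 1; funext ξ; rw [ofReal_norm]

lemma enn_sq_add (a b : ℝ≥0∞) : (a + b) ^ 2 ≤ ENNReal.ofReal 2 * (a ^ 2 + b ^ 2) := by
  have := ENNReal.rpow_add_le_mul_rpow_add_rpow a b (p := 2) (by norm_num)
  norm_num at this
  simpa using this

lemma prod_est {W} (hW : Wt W) {c : ℝ} (hc : 0 ≤ c) (hs : ∀ ξ η, W ξ ≤ c * (W η + W (ξ - η))) (f g : SC) :
    n1 W (prodS f g) ≤ 2 * c * (n1 W f * A1 g ^ 2 + n1 W g * A1 f ^ 2) := by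
  have mW : Measurable (fun ξ => ENNReal.ofReal √(W ξ)) :=
    (hW.tg.1.continuous.sqrt).measurable.ennreal_ofReal
  have mf : ∀ f : SC, Measurable (fun ξ => ‖ft f ξ‖ₑ) := fun f => (ft f).continuous.measurable.enorm
  have key : ∀ ξ, (ENNReal.ofReal √(W ξ) * ‖ft (prodS f g) ξ‖ₑ) ^ 2 ≤
     ENNReal.ofReal (2 * c) * ((∫⁻ η, (ENNReal.ofReal √(W η) * ‖ft f η‖ₑ) * ‖ft g (ξ - η)‖ₑ) ^ 2 +
      (∫⁻ η, (ENNReal.ofReal √(W η) * ‖ft g η‖ₑ) * ‖ft f (ξ - η)‖ₑ) ^ 2) := by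
    intro ξ
    have h1 : ENNReal.ofReal √(W ξ) * ‖ft (prodS f g) ξ‖ₑ ≤ ENNReal.ofReal √c *
        ((∫⁻ η, (ENNReal.ofReal √(W η) * ‖ft f η‖ₑ) * ‖ft g (ξ - η)‖ₑ) +
      (∫⁻ η, (ENNReal.ofReal √(W η) * ‖ft g η‖ₑ) * ‖ft f (ξ - η)‖ₑ)) := by
      rw [← lintegral_sub_left_eq_self (fun η => (ENNReal.ofReal √(W η) * ‖ft g η‖ₑ) * ‖ft f (ξ - η)‖ₑ) ξ]
      have mg' : Measurable (fun η => ‖ft g (ξ - η)‖ₑ) := (mf g).comp (measurable_const.sub measurable_id)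
      have m3 : Measurable (fun η => (ENNReal.ofReal √(W η) * ‖ft f η‖ₑ) * ‖ft g (ξ - η)‖ₑ) :=
        (mW.mul (mf f)).mul mg'
      rw [← lintegral_add_left m3, ← lintegral_const_mul']
      swap; · simp
      refine (mul_le_mul_right (norm_ft_prodS f g ξ) _).trans ?_
      rw [← lintegral_const_mul' _ _ (by simp)]
      apply lintegral_mono
      intro η
      dsimp only
      rw [sub_sub_cancel]
      have h2 : ENNReal.ofReal √(W ξ) ≤ ENNReal.ofReal √c * (ENNReal.ofReal √(W η) + ENNReal.ofReal √(W (ξ - η))) := by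
        rw [← ENNReal.ofReal_add (by positivity) (by positivity), ← ENNReal.ofReal_mul (by positivity)]
        apply ENNReal.ofReal_le_ofReal
        calc √(W ξ) ≤ √(c * (W η + W (ξ - η))) := Real.sqrt_le_sqrt (hs ξ η)
          _ = √c * √(W η + W (ξ - η)) := Real.sqrt_mul hc _
          _ ≤ _ := by
            gcongr
            rw [Real.sqrt_le_left (by positivity)]
            have e1 := Real.sq_sqrt (hW.nn η)
            have e2 := Real.sq_sqrt (hW.nn (ξ - η))
            nlinarith [Real.sqrt_nonneg (W η), Real.sqrt_nonneg (W (ξ - η)), mul_nonneg (Real.sqrt_nonneg (W η)) (Real.sqrt_nonneg (W (ξ - η)))]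
      calc _ ≤ (ENNReal.ofReal √c * (ENNReal.ofReal √(W η) + ENNReal.ofReal √(W (ξ - η)))) * (‖ft f η‖ₑ * ‖ft g (ξ - η)‖ₑ) := by
            gcongr
        _ = _ := by ring
    calc _ ≤ _ := pow_le_pow_left' h1 2
      _ ≤ _ := by
        rw [mul_pow, ← ENNReal.ofReal_pow (Real.sqrt_nonneg _), Real.sq_sqrt hc,
          mul_comm (2:ℝ), ENNReal.ofReal_mul hc, mul_assoc]
        gcongr
        exact enn_sq_add _ _
  have h3 : ENNReal.ofReal (n1 W (prodS f g)) ≤ ENNReal.ofReal (2 * c * (n1 W f * A1 g ^ 2 + n1 W g * A1 f ^ 2)) := by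
    rw [ofReal_n1 hW]
    refine (lintegral_mono key).trans ?_
    rw [lintegral_const_mul' _ _ ENNReal.ofReal_ne_top, ENNReal.ofReal_mul (by positivity : 0 ≤ 2 * c)]
    refine mul_le_mul_right ?_ _
    rw [ENNReal.ofReal_add (mul_nonneg (n1_nonneg hW _) (by positivity)) (mul_nonneg (n1_nonneg hW _) (by positivity)),
      ENNReal.ofReal_mul (n1_nonneg hW _), ENNReal.ofReal_mul (n1_nonneg hW _), ENNReal.ofReal_pow (A1_nonneg _),
      ENNReal.ofReal_pow (A1_nonneg _), ofReal_n1 hW, ofReal_n1 hW, ofReal_A1, ofReal_A1]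
    rw [lintegral_add_left]
    · exact add_le_add (young (mW.mul (mf f)) (mf g)) (young (mW.mul (mf g)) (mf f))
    · apply Measurable.pow_const
      apply Measurable.lintegral_prod_right'
          (f := fun p : E3 × E3 => (ENNReal.ofReal √(W p.2) * ‖ft f p.2‖ₑ) * ‖ft g (p.1 - p.2)‖ₑ)
      exact ((mW.mul (mf f)).comp measurable_snd).mul ((mf g).comp (measurable_fst.sub measurable_snd))
  have h4 : 0 ≤ 2 * c * (n1 W f * A1 g ^ 2 + n1 W g * A1 f ^ 2) := by
    have := n1_nonneg hW f; have := n1_nonneg hW g; positivity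
  exact (ENNReal.ofReal_le_ofReal_iff h4).1 h3

end NSE


namespace NSE
open SchwartzMap LineDeriv FourierTransform
open scoped SchwartzMap ENNReal NNReal ContDiff

noncomputable def bW (m : ℕ) (ξ : E3) : ℝ := (1 + ‖ξ‖ ^ 2) ^ m
lemma wt_bW (m : ℕ) : Wt (bW m) where
  tg := by unfold bW; fun_prop
  nn ξ := by unfold bW; positivity

lemma int_inv4 : Integrable (fun ξ : E3 => ((1 + ‖ξ‖ ^ 2) ^ 2)⁻¹) := by
  have := integrable_rpow_neg_one_add_norm_sq (E := E3) (μ := volume) (r := 4) (by simp; norm_num)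
  refine this.congr (Filter.Eventually.of_forall fun ξ => ?_)
  have h : (0:ℝ) ≤ 1 + ‖ξ‖ ^ 2 := by positivity
  dsimp only
  rw [show (-4/2 : ℝ) = -(2:ℕ) by norm_num, Real.rpow_neg h, Real.rpow_natCast]

lemma tail_small : Filter.Tendsto (fun n : ℕ => ∫ ξ : E3, (n + (1 + ‖ξ‖ ^ 2) ^ 2)⁻¹) Filter.atTop (nhds 0) := by
  have : (0:ℝ) = ∫ ξ : E3, (0:ℝ) := by simp
  rw [this]
  apply tendsto_integral_of_dominated_convergence _ _ int_inv4
  · intro n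
    refine Filter.Eventually.of_forall fun ξ => ?_
    rw [Real.norm_eq_abs, abs_of_nonneg (by positivity)]
    gcongr; simp
  · refine Filter.Eventually.of_forall fun ξ => ?_
    apply Filter.Tendsto.inv_tendsto_atTop
    exact Filter.tendsto_atTop_add_const_right _ _ tendsto_natCast_atTop_atTop
  · intro n
    apply Continuous.aestronglyMeasurable
    apply Continuous.inv₀ (by fun_prop)
    intro x; positivity

lemma agmon (ε : ℝ) (hε : 0 < ε) : ∃ A : ℝ, 0 ≤ A ∧ ∀ f : SC, A1 f ^ 2 ≤ A * n1 (bW 0) f + ε * n1 (bW 2) f := by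
  obtain ⟨N, hN⟩ := (tail_small.eventually (gt_mem_nhds hε)).exists
  refine ⟨ε * N, by positivity, fun f => ?_⟩
  set k : E3 → ℝ := fun ξ => N + (1 + ‖ξ‖ ^ 2) ^ 2 with hk
  have k0 : ∀ ξ, 0 < k ξ := fun ξ => by simp only [hk]; positivity
  have kc : Continuous k := by simp only [hk]; fun_prop
  have ktg : k.HasTemperateGrowth := by simp only [hk]; fun_prop
  have e1 : ∀ ξ, (√(k ξ)⁻¹) ^ 2 = (N + (1 + ‖ξ‖ ^ 2) ^ 2)⁻¹ := fun ξ => Real.sq_sqrt (inv_nonneg.2 (k0 ξ).le)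
  have e2 : ∀ ξ, (√(k ξ) * ‖ft f ξ‖) ^ 2 = k ξ * ‖ft f ξ‖ ^ 2 := fun ξ => by
    rw [mul_pow, Real.sq_sqrt (k0 ξ).le]
  have h := (cs (f := fun ξ => √(k ξ)⁻¹) (g := fun ξ => √(k ξ) * ‖ft f ξ‖)
    ((kc.inv₀ fun ξ => (k0 ξ).ne').sqrt.aestronglyMeasurable)
    ((kc.sqrt.mul (ft f).continuous.norm).aestronglyMeasurable) (by
      simp only [e1]
      refine int_inv4.mono' ?_ (Filter.Eventually.of_forall fun ξ => ?_)
      · exact ((kc.inv₀ fun ξ => (k0 ξ).ne')).aestronglyMeasurable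
      · rw [Real.norm_eq_abs, abs_of_nonneg (by positivity)]
        gcongr; simp) (by simp only [e2]; exact int_sq _ _ ktg)).2
  simp only [e1, e2] at h
  have e3 : ∀ ξ, |√(k ξ)⁻¹ * (√(k ξ) * ‖ft f ξ‖)| = ‖ft f ξ‖ := fun ξ => by
    rw [← mul_assoc, Real.sqrt_inv, inv_mul_cancel₀ (Real.sqrt_pos.2 (k0 ξ)).ne', one_mul, abs_norm]
  simp only [e3] at h
  have h0 : 0 ≤ ∫ ξ, k ξ * ‖ft f ξ‖ ^ 2 := integral_nonneg fun ξ => mul_nonneg (k0 ξ).le (by positivity)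
  have h00 : 0 ≤ ∫ ξ : E3, (N + (1 + ‖ξ‖ ^ 2) ^ 2)⁻¹ := integral_nonneg fun ξ => by positivity
  have h5 : ∫ ξ, k ξ * ‖ft f ξ‖ ^ 2 = N * n1 (bW 0) f + n1 (bW 2) f := by
    rw [n1, n1, ← integral_const_mul, ← integral_add]
    · congr 1; funext ξ; simp only [hk, bW]; ring
    · exact (int_sq _ _ (wt_bW 0).tg).const_mul _
    · exact (int_sq _ _ (wt_bW 2).tg)
  calc A1 f ^ 2 ≤ (√(∫ ξ : E3, (N + (1 + ‖ξ‖ ^ 2) ^ 2)⁻¹) * √(∫ ξ, k ξ * ‖ft f ξ‖ ^ 2)) ^ 2 := by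
        apply pow_le_pow_left₀ (A1_nonneg f) h
    _ = (∫ ξ : E3, (N + (1 + ‖ξ‖ ^ 2) ^ 2)⁻¹) * ∫ ξ, k ξ * ‖ft f ξ‖ ^ 2 := by
        rw [mul_pow, Real.sq_sqrt h00, Real.sq_sqrt h0]
    _ ≤ ε * ∫ ξ, k ξ * ‖ft f ξ‖ ^ 2 := by gcongr
    _ = _ := by rw [h5]; ring

lemma n1_mono {W W' : E3 → ℝ} (hW : Wt W) (hW' : Wt W') {c : ℝ} (h : ∀ ξ, W ξ ≤ c * W' ξ) (f : SC) :
    n1 W f ≤ c * n1 W' f := by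
  rw [n1, n1, ← integral_const_mul]
  apply integral_mono (int_sq _ _ hW.tg) ((int_sq _ _ hW'.tg).const_mul _)
  intro ξ
  dsimp only
  rw [← mul_assoc]
  gcongr
  exact h ξ

lemma bW_mono {m k : ℕ} (h : m ≤ k) (ξ : E3) : bW m ξ ≤ bW k ξ := by
  unfold bW; exact pow_le_pow_right₀ (by nlinarith [sq_nonneg ‖ξ‖]) h

lemma q_mono {m k : ℕ} (h : m ≤ k) (f : SC) : n1 (bW m) f ≤ n1 (bW k) f := by
  have := n1_mono (wt_bW m) (wt_bW k) (c := 1) (fun ξ => by rw [one_mul]; exact bW_mono h ξ) f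
  simpa using this

lemma sup_bound : ∃ C : ℝ, 0 ≤ C ∧ ∀ f : SC, A1 f ^ 2 ≤ C * n1 (bW 2) f := by
  obtain ⟨A, hA, h⟩ := agmon 1 one_pos
  refine ⟨A + 1, by positivity, fun f => (h f).trans ?_⟩
  have := q_mono (show 0 ≤ 2 by norm_num) f
  nlinarith

lemma norm_le_A1 (f : SC) (x : E3) : ‖f x‖ ≤ A1 f := norm_le_int_ft f x

lemma coord_sq_le (ξ : E3) (i : Fin 3) : (ξ i) ^ 2 ≤ ‖ξ‖ ^ 2 := by
  rw [EuclideanSpace.norm_sq_eq]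
  have := Finset.single_le_sum (f := fun i => ‖ξ i‖ ^ 2) (fun i _ => by positivity) (Finset.mem_univ i)
  simpa using this

lemma norm_ft_DD_sq (i : Fin 3) (f : SC) (ξ : E3) : ‖ft (DD i f) ξ‖ ^ 2 = 4 * π ^ 2 * (ξ i) ^ 2 * ‖ft f ξ‖ ^ 2 := by
  rw [ft_DD]
  simp only [norm_mul, Complex.norm_real, Complex.norm_I, mul_pow, Real.norm_eq_abs, sq_abs]
  norm_num

lemma sum_DD_sq (f : SC) (ξ : E3) : ∑ i, ‖ft (DD i f) ξ‖ ^ 2 = 4 * π ^ 2 * ‖ξ‖ ^ 2 * ‖ft f ξ‖ ^ 2 := by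
  simp only [norm_ft_DD_sq]
  rw [← Finset.sum_mul, ← Finset.mul_sum, EuclideanSpace.norm_sq_eq]
  simp

lemma wt_mul {W W' : E3 → ℝ} (hW : Wt W) (hW' : Wt W') : Wt (fun ξ => W ξ * W' ξ) :=
  ⟨hW.tg.mul hW'.tg, fun ξ => mul_nonneg (hW.nn ξ) (hW'.nn ξ)⟩
lemma wt_nsq : Wt (fun ξ : E3 => ‖ξ‖ ^ 2) := ⟨by fun_prop, fun ξ => by positivity⟩
lemma wt_one : Wt (fun _ : E3 => (1:ℝ)) := ⟨by fun_prop, fun ξ => by positivity⟩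

lemma n1_DD_le {W : E3 → ℝ} (hW : Wt W) (i : Fin 3) (f : SC) :
    n1 W (DD i f) ≤ 4 * π ^ 2 * n1 (fun ξ => W ξ * ‖ξ‖ ^ 2) f := by
  rw [n1, n1, ← integral_const_mul]
  apply integral_mono (int_sq _ _ hW.tg) ((int_sq _ _ (wt_mul hW wt_nsq).tg).const_mul _)
  intro ξ
  dsimp only
  rw [norm_ft_DD_sq]
  have := coord_sq_le ξ i
  calc _ = W ξ * (4 * π ^ 2 * ‖ft f ξ‖ ^ 2) * (ξ i) ^ 2 := by ring
    _ ≤ W ξ * (4 * π ^ 2 * ‖ft f ξ‖ ^ 2) * ‖ξ‖ ^ 2 := by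
      have := hW.nn ξ
      gcongr
    _ = _ := by ring

lemma q_DD (m : ℕ) (i : Fin 3) (f : SC) : n1 (bW m) (DD i f) ≤ 4 * π ^ 2 * n1 (bW (m+1)) f := by
  refine (n1_DD_le (wt_bW m) i f).trans ?_
  gcongr
  have := n1_mono (wt_mul (wt_bW m) wt_nsq) (wt_bW (m+1)) (c := 1) (fun ξ => by
    have := (wt_bW m).nn ξ
    simp only [bW] at this ⊢
    rw [one_mul, pow_succ (1 + ‖ξ‖ ^ 2) m]; exact mul_le_mul_of_nonneg_left (by linarith) this) f
  simpa using this

lemma n1_add_le {W : E3 → ℝ} (hW : Wt W) (f g : SC) : n1 W (f + g) ≤ 2 * n1 W f + 2 * n1 W g := by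
  rw [n1, n1, n1, ← integral_const_mul, ← integral_const_mul, ← integral_add]
  · apply integral_mono (int_sq _ _ hW.tg) (((int_sq _ _ hW.tg).const_mul _).add ((int_sq _ _ hW.tg).const_mul _))
    intro ξ
    simp only [Pi.add_apply]
    rw [ft_add, add_apply]
    have h1 := norm_add_le (ft f ξ) (ft g ξ)
    have h2 : ‖ft f ξ + ft g ξ‖ ^ 2 ≤ 2 * ‖ft f ξ‖ ^ 2 + 2 * ‖ft g ξ‖ ^ 2 := by
      nlinarith [sq_nonneg (‖ft f ξ‖ - ‖ft g ξ‖), norm_nonneg (ft f ξ + ft g ξ)]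
    have := hW.nn ξ
    nlinarith
  · exact (int_sq _ _ hW.tg).const_mul _
  · exact (int_sq _ _ hW.tg).const_mul _

lemma n1_smul (W : E3 → ℝ) (c : ℂ) (f : SC) : n1 W (c • f) = ‖c‖ ^ 2 * n1 W f := by
  rw [n1, n1, ← integral_const_mul]
  congr 1; funext ξ
  rw [ft_smul, smul_apply, norm_smul]; ring

lemma n1_sub_le {W : E3 → ℝ} (hW : Wt W) (f g : SC) : n1 W (f - g) ≤ 2 * n1 W f + 2 * n1 W g := by
  have := n1_add_le hW f ((-1:ℂ) • g)
  rw [n1_smul] at this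
  simpa [sub_eq_add_neg] using this

/-- clamp -/
noncomputable def cl (L : ℝ) (y : ℂ) : ℂ := (L / max L ‖y‖) • y

lemma cl_cont {L : ℝ} (hL : 0 < L) : Continuous (cl L) := by
  unfold cl
  refine Continuous.smul (f := fun y : ℂ => L / max L ‖y‖) (g := fun y : ℂ => y) ?_ continuous_id
  apply Continuous.div continuous_const (by fun_prop)
  intro x; have := le_max_left L ‖x‖; linarith

lemma cl_norm {L : ℝ} (hL : 0 < L) (y : ℂ) : ‖cl L y‖ ≤ L := by
  have h1 := le_max_left L ‖y‖
  have h2 := le_max_right L ‖y‖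
  have h3 : 0 < max L ‖y‖ := by linarith
  rw [cl, norm_smul, Real.norm_eq_abs, abs_of_nonneg (by positivity), div_mul_eq_mul_div, div_le_iff₀ h3]
  gcongr

lemma cl_sub {L : ℝ} (hL : 0 < L) (y : ℂ) : ‖y - cl L y‖ ≤ ‖y‖ ^ 2 / L := by
  by_cases h : ‖y‖ ≤ L
  · have : cl L y = y := by rw [cl, max_eq_left h, div_self hL.ne', one_smul]
    rw [this, sub_self, norm_zero]; positivity
  · push Not at h
    have hy : 0 < ‖y‖ := hL.trans h
    have : y - cl L y = (1 - L / ‖y‖) • y := by rw [cl, max_eq_right h.le, sub_smul, one_smul]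
    rw [this, norm_smul, Real.norm_eq_abs, abs_of_nonneg (by rw [sub_nonneg, div_le_one hy]; exact h.le), le_div_iff₀ hL]
    have : (1 - L / ‖y‖) * ‖y‖ = ‖y‖ - L := by field_simp
    rw [this]; nlinarith

lemma cl_int {L : ℝ} (hL : 0 < L) (z f : SC) : Integrable (fun x => z x * cl L (f x)) := by
  refine (z.integrable.norm.mul_const L).mono'
    ((z.continuous.mul ((cl_cont hL).comp f.continuous)).aestronglyMeasurable)
    (Filter.Eventually.of_forall fun x => ?_)
  rw [norm_mul]; gcongr; exact cl_norm hL _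

lemma int_mul (z f : SC) : Integrable (fun x => z x * f x) := (prodS z f).integrable

lemma cl_err {L : ℝ} (hL : 0 < L) (z f : SC) {p : ℕ} (hp : 2 ≤ p) {B : ℝ} (hB : ∫ x, ‖f x‖ ^ p ≤ B) :
    ‖(∫ x, z x * f x) - ∫ x, z x * cl L (f x)‖ ≤ ((∫ x, ‖z x‖) + A1 z * B) / L := by
  rw [← integral_sub (int_mul z f) (cl_int hL z f)]
  have hi : Integrable (fun x => (‖z x‖ + A1 z * ‖f x‖ ^ p) / L) :=
    (z.integrable.norm.add ((int_pow f p (by omega)).const_mul _)).div_const _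
  calc _ ≤ ∫ x, (‖z x‖ + A1 z * ‖f x‖ ^ p) / L := by
        apply norm_integral_le_of_norm_le hi
        refine Filter.Eventually.of_forall fun x => ?_
        rw [← mul_sub, norm_mul]
        have h1 := cl_sub hL (f x)
        have h2 : ‖f x‖ ^ 2 ≤ 1 + ‖f x‖ ^ p := by
          by_cases h : ‖f x‖ ≤ 1
          · have : ‖f x‖ ^ 2 ≤ 1 := pow_le_one₀ (norm_nonneg _) h
            have : 0 ≤ ‖f x‖ ^ p := by positivity
            linarith
          · have := pow_le_pow_right₀ (le_of_not_ge h) hp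
            linarith
        calc _ ≤ ‖z x‖ * (‖f x‖ ^ 2 / L) := by gcongr
          _ = (‖z x‖ * ‖f x‖ ^ 2) / L := by ring
          _ ≤ (‖z x‖ * (1 + ‖f x‖ ^ p)) / L := by gcongr
          _ = (‖z x‖ + ‖z x‖ * ‖f x‖ ^ p) / L := by ring
          _ ≤ _ := by gcongr; exact norm_le_A1 z x
    _ = ((∫ x, ‖z x‖) + A1 z * ∫ x, ‖f x‖ ^ p) / L := by
        rw [integral_div, integral_add z.integrable.norm ((int_pow f p (by omega)).const_mul _), integral_const_mul]
    _ ≤ _ := by gcongr; exact A1_nonneg z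

/-- weak convergence -/
lemma weakW (z : SC) {l : Filter ℝ} [l.IsCountablyGenerated] (F : ℝ → SC) (F0 : SC) {p : ℕ} (hp : 2 ≤ p)
    (hF : ∀ x, Filter.Tendsto (fun s => F s x) l (nhds (F0 x))) {B : ℝ}
    (hB : ∀ᶠ s in l, ∫ x, ‖F s x‖ ^ p ≤ B) :
    Filter.Tendsto (fun s => ∫ x, z x * F s x) l (nhds (∫ x, z x * F0 x)) := by
  set B' := max B (∫ x, ‖F0 x‖ ^ p)
  set K := (∫ x, ‖z x‖) + A1 z * B'
  have hK : 0 ≤ K := by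
    have : 0 ≤ B' := le_max_of_le_right (integral_nonneg fun _ => by positivity)
    have h1 := A1_nonneg z
    have : 0 ≤ ∫ x, ‖z x‖ := integral_nonneg fun _ => norm_nonneg _
    positivity
  rw [Metric.tendsto_nhds]
  intro ε hε
  set L := 4 * (K + 1) / ε
  have hL : 0 < L := by positivity
  have hKL : K / L < ε / 3 := by
    rw [div_lt_iff₀ hL]; simp only [L]; field_simp; nlinarith
  have hlim : Filter.Tendsto (fun s => ∫ x, z x * cl L (F s x)) l (nhds (∫ x, z x * cl L (F0 x))) := by
    apply tendsto_integral_filter_of_dominated_convergence (fun x => ‖z x‖ * L)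
    · exact Filter.Eventually.of_forall fun s => (cl_int hL z (F s)).aestronglyMeasurable
    · refine Filter.Eventually.of_forall fun s => Filter.Eventually.of_forall fun x => ?_
      rw [norm_mul]; gcongr; exact cl_norm hL _
    · exact z.integrable.norm.mul_const L
    · refine Filter.Eventually.of_forall fun x => ?_
      exact (((cl_cont hL).tendsto _).comp (hF x)).const_mul _
  filter_upwards [hB, (Metric.tendsto_nhds.1 hlim) (ε/3) (by positivity)] with s h1 h2
  have a1 := cl_err hL z (F s) hp (h1.trans (le_max_left B (∫ x, ‖F0 x‖ ^ p)))
  have a2 := cl_err hL z F0 hp (le_max_right B (∫ x, ‖F0 x‖ ^ p))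
  rw [dist_eq_norm] at h2 ⊢
  have e : (∫ x, z x * F s x) - ∫ x, z x * F0 x = ((∫ x, z x * F s x) - ∫ x, z x * cl L (F s x)) +
     ((∫ x, z x * cl L (F s x)) - ∫ x, z x * cl L (F0 x)) - ((∫ x, z x * F0 x) - ∫ x, z x * cl L (F0 x)) := by ring
  rw [e]
  refine (norm_sub_le _ _).trans_lt ?_
  have := norm_add_le ((∫ x, z x * F s x) - ∫ x, z x * cl L (F s x)) ((∫ x, z x * cl L (F s x)) - ∫ x, z x * cl L (F0 x))
  have b1 := a1.trans_lt hKL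
  have b2 := a2.trans_lt hKL
  linarith

end NSE


namespace NSE
open SchwartzMap LineDeriv FourierTransform
open scoped SchwartzMap ENNReal NNReal ContDiff

structure Good (J : Set ℝ) (n : ℕ) (H : ℝ → SC) : Prop where
  ct : ∀ x, ContinuousOn (fun s => H s x) J
  bd : ∃ M, ∀ s ∈ J, n1 (bW n) (H s) ≤ M

lemma hasDerivAt_line (f : SC) (i : Fin 3) (x : E3) (h : ℝ) :
    HasDerivAt (fun h : ℝ => f (x + h • ee i)) (DD i f (x + h • ee i)) h := by
  rw [DD_apply]
  have h1 : HasDerivAt (fun h : ℝ => x + h • ee i) (ee i) h := by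
    simpa using ((hasDerivAt_id h).smul_const (ee i)).const_add x
  exact (f.hasFDerivAt (x + h • ee i)).comp_hasDerivAt h h1

lemma landau (f : SC) (i : Fin 3) {M : ℝ} (hM : ∀ x, ‖DD i (DD i f) x‖ ≤ M) (x : E3) {h : ℝ} (hh : 0 ≤ h) :
    ‖f (x + h • ee i) - f x - (h : ℂ) * DD i f x‖ ≤ M * h * h := by
  have hM0 : 0 ≤ M := (norm_nonneg _).trans (hM 0)
  have lip : ∀ (g : SC) (M : ℝ) (r : ℝ), (∀ x, ‖DD i g x‖ ≤ M) → 0 ≤ r →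
      ‖g (x + r • ee i) - g x‖ ≤ M * r := by
    intro g M r hg hr
    have := norm_image_sub_le_of_norm_deriv_le_segment' (f := fun h : ℝ => g (x + h • ee i)) (a := 0) (b := r)
      (C := M) (fun t _ => (hasDerivAt_line g i x t).hasDerivWithinAt) (fun t _ => hg _) r ⟨hr, le_rfl⟩
    simpa using this
  have := norm_image_sub_le_of_norm_deriv_le_segment' (f := fun r : ℝ => f (x + r • ee i) - (r:ℂ) * DD i f x) (a := 0) (b := h)
      (f' := fun r => DD i f (x + r • ee i) - 1 * DD i f x)
      (C := M * h) (fun t _ => ((hasDerivAt_line f i x t).sub ((Complex.ofRealCLM.hasDerivAt (x := t)).mul_const _)).hasDerivWithinAt)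
      (fun t ht => by
        rw [one_mul]
        refine (lip _ M t hM ht.1).trans ?_
        have := ht.2.le
        gcongr) h ⟨hh, le_rfl⟩
  have e : f (x + h • ee i) - f x - (h : ℂ) * DD i f x = f (x + h • ee i) - (h : ℂ) * DD i f x - f x := by ring
  rw [e]
  simpa using this

namespace Good
variable {J : Set ℝ} {n : ℕ} {H G : ℝ → SC}

lemma mono {m : ℕ} (h : Good J n H) (hm : m ≤ n) : Good J m H :=
  ⟨h.ct, by obtain ⟨M, hM⟩ := h.bd; exact ⟨M, fun s hs => (q_mono hm _).trans (hM s hs)⟩⟩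

lemma subset {J' : Set ℝ} (h : Good J n H) (hm : J' ⊆ J) : Good J' n H :=
  ⟨fun x => (h.ct x).mono hm, by obtain ⟨M, hM⟩ := h.bd; exact ⟨M, fun s hs => hM s (hm hs)⟩⟩

lemma bd' (h : Good J n H) : ∃ M, 0 ≤ M ∧ ∀ s ∈ J, n1 (bW n) (H s) ≤ M := by
  obtain ⟨M, hM⟩ := h.bd
  exact ⟨max M 0, le_max_right _ _, fun s hs => (hM s hs).trans (le_max_left _ _)⟩

lemma sup (h : Good J n H) (hn : 2 ≤ n) : ∃ M, 0 ≤ M ∧ ∀ s ∈ J, A1 (H s) ≤ M := by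
  obtain ⟨C, hC, hs⟩ := sup_bound
  obtain ⟨M, hM0, hM⟩ := (h.mono hn).bd'
  refine ⟨√(C * M), Real.sqrt_nonneg _, fun s hs' => Real.le_sqrt_of_sq_le ((hs _).trans ?_)⟩
  gcongr; exact hM s hs'

lemma norm (h : Good J n H) (hn : 2 ≤ n) : ∃ M, 0 ≤ M ∧ ∀ s ∈ J, ∀ x, ‖H s x‖ ≤ M := by
  obtain ⟨M, h0, h⟩ := h.sup hn
  exact ⟨M, h0, fun s hs x => (norm_le_A1 _ _).trans (h s hs)⟩

lemma add (hH : Good J n H) (hG : Good J n G) : Good J n (fun s => H s + G s) where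
  ct x := by
    have := (hH.ct x).add (hG.ct x)
    exact this
  bd := by
    obtain ⟨M, hM⟩ := hH.bd; obtain ⟨M', hM'⟩ := hG.bd
    refine ⟨2 * M + 2 * M', fun s hs => (n1_add_le (wt_bW n) _ _).trans ?_⟩
    have := hM s hs; have := hM' s hs; linarith

lemma smul (c : ℂ) (hH : Good J n H) : Good J n (fun s => c • H s) where
  ct x := by
    have := (hH.ct x).const_smul c
    exact this
  bd := by
    obtain ⟨M, hM⟩ := hH.bd
    refine ⟨‖c‖ ^ 2 * M, fun s hs => ?_⟩
    rw [n1_smul]; gcongr; exact hM s hs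

lemma sub (hH : Good J n H) (hG : Good J n G) : Good J n (fun s => H s - G s) := by
  have := hH.add (hG.smul (-1))
  simpa [sub_eq_add_neg] using this

lemma sum {ι : Type*} (s : Finset ι) {H : ι → ℝ → SC} (hH : ∀ i, Good J n (H i)) :
    Good J n (fun t => ∑ i ∈ s, H i t) := by
  classical
  induction s using Finset.induction_on with
  | empty =>
    simp only [Finset.sum_empty]
    exact ⟨fun x => continuousOn_const, ⟨n1 (bW n) 0, fun _ _ => le_rfl⟩⟩
  | insert i s hi ih =>
    simp only [Finset.sum_insert hi]
    exact (hH i).add ih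

lemma DD (h : Good J (n+1) H) (hn : 3 ≤ n) (i : Fin 3) : Good J n (fun s => DD i (H s)) where
  bd := by
    obtain ⟨M, hM⟩ := h.bd
    refine ⟨4 * π ^ 2 * M, fun s hs => (q_DD n i _).trans ?_⟩
    gcongr; exact hM s hs
  ct x := by
    obtain ⟨C, hC, hsup⟩ := sup_bound
    obtain ⟨M, hM0, hM⟩ := (h.mono (m := 4) (by omega)).bd'
    obtain ⟨L, hL0, hL⟩ : ∃ L, 0 ≤ L ∧ ∀ s ∈ J, ∀ x, ‖NSE.DD i (NSE.DD i (H s)) x‖ ≤ L := by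
      refine ⟨√(C * (4 * π ^ 2 * (4 * π ^ 2 * M))), Real.sqrt_nonneg _, fun s hs x => (norm_le_A1 _ _).trans ?_⟩
      refine Real.le_sqrt_of_sq_le ((hsup _).trans ?_)
      gcongr
      refine (q_DD 2 i _).trans ?_
      gcongr
      refine (q_DD 3 i _).trans ?_
      gcongr
      exact hM s hs
    intro s hs
    rw [ContinuousWithinAt, Metric.tendsto_nhds]
    intro ε hε
    set r : ℝ := ε / (4 * (L + 1)) with hr
    have hr0 : 0 < r := by positivity
    have h1 := Metric.tendsto_nhds.1 (h.ct x s hs) (ε * r / 8) (by positivity)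
    have h2 := Metric.tendsto_nhds.1 (h.ct (x + r • ee i) s hs) (ε * r / 8) (by positivity)
    filter_upwards [h1, h2, self_mem_nhdsWithin] with t h1 h2 ht
    have a1 := landau (H s) i (hL s hs) x hr0.le
    have a2 := landau (H t) i (hL t ht) x hr0.le
    rw [dist_eq_norm] at h1 h2 ⊢
    have key : ‖(r:ℂ) * (NSE.DD i (H t) x - NSE.DD i (H s) x)‖ ≤ L * r * r + L * r * r + ε * r / 8 + ε * r / 8 := by
      have e : (r:ℂ) * (NSE.DD i (H t) x - NSE.DD i (H s) x) =
        (H s (x + r • ee i) - H s x - (r : ℂ) * NSE.DD i (H s) x) - (H t (x + r • ee i) - H t x - (r : ℂ) * NSE.DD i (H t) x)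
        + (H t (x + r • ee i) - H s (x + r • ee i)) - (H t x - H s x) := by ring
      rw [e]
      refine (norm_sub_le _ _).trans (add_le_add ((norm_add_le _ _).trans (add_le_add ((norm_sub_le _ _).trans (add_le_add a1 a2)) h2.le)) h1.le)
    rw [norm_mul, Complex.norm_real, Real.norm_eq_abs, abs_of_pos hr0] at key
    have hLr : L * r ≤ ε / 4 := by
      rw [hr, mul_div_assoc', div_le_div_iff₀ (by positivity) (by norm_num)]; nlinarith
    have : r * ‖NSE.DD i (H t) x - NSE.DD i (H s) x‖ ≤ r * (3 * ε / 4) := by nlinarith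
    have := le_of_mul_le_mul_left this hr0
    linarith

lemma _root_.NSE.bW_sub (n : ℕ) (ξ η : E3) : bW n ξ ≤ 4 ^ n * (bW n η + bW n (ξ - η)) := by
  have h1 : 1 + ‖ξ‖ ^ 2 ≤ 4 * max (1 + ‖η‖ ^ 2) (1 + ‖ξ - η‖ ^ 2) := by
    have : ‖ξ‖ ≤ ‖η‖ + ‖ξ - η‖ := by simpa using norm_add_le η (ξ - η)
    have := sq_nonneg (‖η‖ - ‖ξ - η‖)
    have a := le_max_left (1 + ‖η‖ ^ 2) (1 + ‖ξ - η‖ ^ 2)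
    have b := le_max_right (1 + ‖η‖ ^ 2) (1 + ‖ξ - η‖ ^ 2)
    nlinarith [norm_nonneg ξ, norm_nonneg η, norm_nonneg (ξ - η)]
  have p1 := (wt_bW n).nn η
  have p2 := (wt_bW n).nn (ξ - η)
  unfold bW at *
  refine (pow_le_pow_left₀ (by positivity) h1 n).trans ?_
  rw [mul_pow]
  gcongr
  rcases max_cases (1 + ‖η‖ ^ 2) (1 + ‖ξ - η‖ ^ 2) with h | h <;> rw [h.1] <;> linarith

lemma prod (hH : Good J n H) (hG : Good J n G) (hn : 2 ≤ n) : Good J n (fun s => prodS (H s) (G s)) where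
  ct x := (hH.ct x).mul (hG.ct x)
  bd := by
    obtain ⟨M, h0, hM⟩ := hH.bd'; obtain ⟨M', h0', hM'⟩ := hG.bd'
    obtain ⟨A, hA, hAH⟩ := hH.sup hn; obtain ⟨A', hA', hAG⟩ := hG.sup hn
    refine ⟨2 * 4 ^ n * (M * A' ^ 2 + M' * A ^ 2), fun s hs =>
      (prod_est (wt_bW n) (by positivity) (bW_sub n) _ _).trans ?_⟩
    have := A1_nonneg (H s)
    have := A1_nonneg (G s)
    gcongr
    · exact hM s hs
    · exact hAG s hs
    · exact hM' s hs
    · exact hAH s hs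

lemma cont_int (h : Good J n H) (z : SC) : ContinuousOn (fun s => ∫ x, z x * H s x) J := by
  intro s hs
  obtain ⟨M, hM⟩ := (h.mono (Nat.zero_le n)).bd
  refine weakW z H (H s) (p := 2) le_rfl (fun x => h.ct x s hs) (B := M) ?_
  filter_upwards [self_mem_nhdsWithin] with t ht
  rw [← parseval]
  simpa [n1, bW] using hM t ht

end Good

lemma fub_int {s1 s2 : ℝ} (h12 : s1 ≤ s2) (H : ℝ → E3 → ℂ) (ψ : SC) {M : ℝ}
    (hx : ∀ τ ∈ Set.Icc s1 s2, Continuous (H τ)) (ht : ∀ x, ContinuousOn (fun τ => H τ x) (Set.Icc s1 s2))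
    (hb : ∀ τ ∈ Set.Icc s1 s2, ∀ x, ‖ψ x * H τ x‖ ≤ M * ‖ψ x‖) :
    Integrable (Function.uncurry fun τ x => ψ x * H τ x) ((volume.restrict (Set.Ioc s1 s2)).prod volume) := by
  let H' : ℝ → E3 → ℂ := fun τ x => ψ x * H (Set.projIcc s1 s2 h12 τ) x
  have hm : StronglyMeasurable (Function.uncurry H') := by
    apply stronglyMeasurable_uncurry_of_continuous_of_stronglyMeasurable
    · intro x
      apply Continuous.mul continuous_const
      have := (ht x).comp_continuous (f := fun τ => (Set.projIcc s1 s2 h12 τ : ℝ)) (by fun_prop) (fun τ => (Set.projIcc s1 s2 h12 τ).2)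
      exact this
    · intro τ
      exact (ψ.continuous.mul (hx _ (Set.projIcc s1 s2 h12 τ).2)).stronglyMeasurable
  have heq : Function.uncurry (fun τ x => ψ x * H τ x) =ᵐ[(volume.restrict (Set.Ioc s1 s2)).prod volume] Function.uncurry H' := by
    have : ∀ᵐ p : ℝ × E3 ∂((volume.restrict (Set.Ioc s1 s2)).prod volume), p.1 ∈ Set.Ioc s1 s2 :=
      Measure.quasiMeasurePreserving_fst.ae (ae_restrict_mem measurableSet_Ioc)
    filter_upwards [this] with p hp
    simp only [Function.uncurry, H']
    rw [Set.projIcc_of_mem h12 ⟨hp.1.le, hp.2⟩]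
  refine (Integrable.congr ?_ heq.symm)
  have hi : Integrable (fun p : ℝ × E3 => (M : ℝ) * ‖ψ p.2‖) ((volume.restrict (Set.Ioc s1 s2)).prod volume) := by
    have := (integrable_const (μ := volume.restrict (Set.Ioc s1 s2)) M).mul_prod (ψ.integrable.norm (μ := volume))
    exact this
  refine hi.mono' hm.aestronglyMeasurable (Filter.Eventually.of_forall fun p => ?_)
  exact hb _ (Set.projIcc s1 s2 h12 p.1).2 _

lemma fub {s1 s2 : ℝ} (h12 : s1 ≤ s2) (H : ℝ → E3 → ℂ) (ψ : SC) {M : ℝ}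
    (hx : ∀ τ ∈ Set.Icc s1 s2, Continuous (H τ)) (ht : ∀ x, ContinuousOn (fun τ => H τ x) (Set.Icc s1 s2))
    (hb : ∀ τ ∈ Set.Icc s1 s2, ∀ x, ‖ψ x * H τ x‖ ≤ M * ‖ψ x‖) :
    ∫ x, ψ x * ∫ τ in s1..s2, H τ x = ∫ τ in s1..s2, ∫ x, ψ x * H τ x := by
  simp_rw [← intervalIntegral.integral_const_mul]
  symm
  apply intervalIntegral_integral_swap
  rw [Set.uIoc_of_le h12]
  exact fub_int h12 H ψ hx ht hb

lemma fub_ii {s1 s2 : ℝ} (h12 : s1 ≤ s2) (H : ℝ → E3 → ℂ) (ψ : SC) {M : ℝ}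
    (hx : ∀ τ ∈ Set.Icc s1 s2, Continuous (H τ)) (ht : ∀ x, ContinuousOn (fun τ => H τ x) (Set.Icc s1 s2))
    (hb : ∀ τ ∈ Set.Icc s1 s2, ∀ x, ‖ψ x * H τ x‖ ≤ M * ‖ψ x‖) :
    IntervalIntegrable (fun τ => ∫ x, ψ x * H τ x) volume s1 s2 := by
  rw [intervalIntegrable_iff_integrableOn_Ioc_of_le h12]
  exact (fub_int h12 H ψ hx ht hb).integral_prod_left

end NSE


namespace NSE
open SchwartzMap LineDeriv FourierTransform
open scoped SchwartzMap ENNReal NNReal ContDiff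

abbrev VF := Fin 3 → SC

noncomputable def FF (ν : ℝ) (u : VF) (j : Fin 3) : SC :=
  (ν : ℂ) • ∑ k, DD k (DD k (u j)) - ∑ k, DD k (prodS (u k) (u j))

structure Sol (T ν : ℝ) (u : ℝ → VF) : Prop where
  real : ∀ s j, IsR (u s j)
  smooth : ∀ j x, ContDiff ℝ 1 (fun s => u s j x)
  div : ∀ s ∈ Set.Ico 0 T, ∑ j, DD j (u s j) = 0
  nse : ∀ s ∈ Set.Ico 0 T, ∃ p : E3 → ℂ, ContDiff ℝ 1 p ∧
    ∀ j x, deriv (fun s => u s j x) s = FF ν (u s) j x - fderiv ℝ p x (ee j)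

noncomputable def cu (k l : Fin 3) (f : VF) : SC := DD k (f l) - DD l (f k)

/-- boundedness of the top norm on a set of times -/
def QB (u : ℝ → VF) (J : Set ℝ) : Prop := ∃ M, ∀ s ∈ J, ∀ j, n1 (bW 8) (u s j) ≤ M

lemma hcs_DD {ψ : SC} (h : HasCompactSupport ψ) (i : Fin 3) : HasCompactSupport (DD i ψ) := by
  have := h.fderiv_apply ℝ (ee i)
  have e : (DD i ψ : E3 → ℂ) = fun x => fderiv ℝ ψ x (ee i) := by funext x; rw [DD_apply]
  rw [e]; exact this

lemma DD_zero_off {ψ : SC} (i : Fin 3) {x : E3} (h : x ∉ tsupport ψ) : DD i ψ x = 0 := by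
  rw [DD_apply]
  have : x ∉ tsupport (fun y => fderiv ℝ ψ y (ee i)) := fun hh => h (tsupport_fderiv_apply_subset ℝ (ee i) hh)
  exact image_eq_zero_of_notMem_tsupport (f := fun y => fderiv ℝ ψ y (ee i)) this

lemma int_cs {f g : E3 → ℂ} (hf : Continuous f) (hg : Continuous g) (h : HasCompactSupport f) :
    Integrable (fun x => f x * g x) :=
  (hf.mul hg).integrable_of_hasCompactSupport h.mul_right

lemma press1 {ψ : SC} (h : HasCompactSupport ψ) {p : E3 → ℂ} (hp : ContDiff ℝ 1 p) (k l : Fin 3) :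
    ∫ x, DD k ψ x * fderiv ℝ p x (ee l) = - ∫ x, DD l (DD k ψ) x * p x := by
  have hc := hcs_DD h k
  have hc2 := hcs_DD hc l
  have c1 : Continuous (fun x => fderiv ℝ p x (ee l)) := (hp.continuous_fderiv one_ne_zero).clm_apply continuous_const
  have := integral_mul_fderiv_eq_neg_fderiv_mul_of_integrable (𝕜 := ℂ) (μ := (volume : Measure E3)) (f := DD k ψ) (g := p) (v := ee l)
    (by simp_rw [← DD_apply]; exact int_cs (DD l (DD k ψ)).continuous hp.continuous hc2)
    (int_cs (DD k ψ).continuous c1 hc) (int_cs (DD k ψ).continuous hp.continuous hc)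
    (fun x _ => (DD k ψ).differentiableAt) (fun x _ => (hp.differentiable one_ne_zero) x)
  simp_rw [DD_apply l (DD k ψ)]
  exact this

lemma press {ψ : SC} (h : HasCompactSupport ψ) {p : E3 → ℂ} (hp : ContDiff ℝ 1 p) (k l : Fin 3) :
    ∫ x, DD k ψ x * fderiv ℝ p x (ee l) = ∫ x, DD l ψ x * fderiv ℝ p x (ee k) := by
  rw [press1 h hp, press1 h hp, DD_comm]

lemma cp_eq (ψ : SC) (k l : Fin 3) (f : VF) :
    ∫ x, ψ x * cu k l f x = (∫ x, DD l ψ x * f k x) - ∫ x, DD k ψ x * f l x := by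
  have e : (fun x => ψ x * cu k l f x) = fun x => ψ x * DD k (f l) x - ψ x * DD l (f k) x := by
    funext x; rw [cu, sub_apply, mul_sub]
  rw [e, integral_sub (int_mul _ _) (int_mul _ _), ibp, ibp]; ring

section

lemma Sol.good {T ν : ℝ} {u : ℝ → VF} (S : Sol T ν u) {J : Set ℝ} (h : QB u J) (j : Fin 3) : Good J 8 (fun s => u s j) where
  ct x := (S.smooth j x).continuous.continuousOn
  bd := by obtain ⟨M, hM⟩ := h; exact ⟨M, fun s hs => hM s hs j⟩

lemma Sol.goodF {T ν : ℝ} {u : ℝ → VF} (S : Sol T ν u) {J : Set ℝ} (h : QB u J) (j : Fin 3) : Good J 6 (fun s => FF ν (u s) j) := by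
  unfold FF
  refine Good.sub (Good.smul _ (Good.sum _ fun k => ?_)) (Good.sum _ fun k => ?_)
  · exact Good.DD (n := 6) (Good.DD (n := 7) (S.good h j) (by norm_num) k) (by norm_num) k
  · exact (Good.DD (n := 7) ((S.good h k).prod (S.good h j) (by norm_num)) (by norm_num) k).mono (by norm_num)

lemma Sol.goodC {T ν : ℝ} {u : ℝ → VF} (S : Sol T ν u) {J : Set ℝ} (h : QB u J) (k l : Fin 3) : Good J 5 (fun s => cu k l (FF ν (u s))) :=
  Good.sub (Good.DD (n := 5) (S.goodF h l) (by norm_num) k) (Good.DD (n := 5) (S.goodF h k) (by norm_num) l)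

lemma Sol.dcont {T ν : ℝ} {u : ℝ → VF} (S : Sol T ν u) (j x) : Continuous (deriv (fun s => u s j x)) :=
  (S.smooth j x).continuous_deriv le_rfl

lemma Sol.dcontx {T ν : ℝ} {u : ℝ → VF} (S : Sol T ν u) (j) {s} (hs : s ∈ Set.Ico 0 T) : Continuous (fun x => deriv (fun s => u s j x) s) := by
  obtain ⟨p, hp, h⟩ := S.nse s hs
  simp_rw [h]
  exact (FF ν (u s) j).continuous.sub ((hp.continuous_fderiv one_ne_zero).clm_apply continuous_const)

lemma Sol.loc1 {T ν : ℝ} {u : ℝ → VF} (S : Sol T ν u) {s1 s2 : ℝ} (h12 : s1 ≤ s2) (hJ : Set.Icc s1 s2 ⊆ Set.Ico 0 T)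
    (ψ : SC) {N : ℝ}
    (hN : ∀ x ∈ tsupport ψ, ∀ τ ∈ Set.Icc s1 s2, ∀ j, ‖deriv (fun s => u s j x) τ‖ ≤ N) (k l : Fin 3) :
    (∫ x, DD k ψ x * u s2 l x) - (∫ x, DD k ψ x * u s1 l x) =
      ∫ τ in s1..s2, ∫ x, DD k ψ x * deriv (fun s => u s l x) τ ∧
    IntervalIntegrable (fun τ => ∫ x, DD k ψ x * deriv (fun s => u s l x) τ) volume s1 s2 := by
  have h1 : ∀ τ ∈ Set.Icc s1 s2, Continuous (fun x => deriv (fun s => u s l x) τ) := fun τ hτ => S.dcontx l (hJ hτ)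
  have h2 : ∀ x, ContinuousOn (fun τ => deriv (fun s => u s l x) τ) (Set.Icc s1 s2) := fun x => (S.dcont l x).continuousOn
  have h3 : ∀ τ ∈ Set.Icc s1 s2, ∀ x, ‖DD k ψ x * deriv (fun s => u s l x) τ‖ ≤ N * ‖DD k ψ x‖ := by
    intro τ hτ x
    by_cases hx : x ∈ tsupport ψ
    · rw [norm_mul, mul_comm]; gcongr; exact hN x hx τ hτ l
    · rw [DD_zero_off k hx]; simp
  refine ⟨?_, fub_ii h12 (fun τ x => deriv (fun s => u s l x) τ) (DD k ψ) h1 h2 h3⟩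
  rw [← fub h12 (fun τ x => deriv (fun s => u s l x) τ) (DD k ψ) h1 h2 h3, ← integral_sub (int_mul _ _) (int_mul _ _)]
  congr 1; funext x
  rw [intervalIntegral.integral_deriv_eq_sub (fun t _ => ((S.smooth l x).differentiable one_ne_zero) t)
    ((S.dcont l x).intervalIntegrable _ _)]
  ring

lemma Sol.loc {T ν : ℝ} {u : ℝ → VF} (S : Sol T ν u) {s1 s2 : ℝ} (h12 : s1 ≤ s2) (hJ : Set.Icc s1 s2 ⊆ Set.Ico 0 T)
    (ψ : SC) (hψ : HasCompactSupport ψ) {N : ℝ}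
    (hN : ∀ x ∈ tsupport ψ, ∀ τ ∈ Set.Icc s1 s2, ∀ j, ‖deriv (fun s => u s j x) τ‖ ≤ N) (k l : Fin 3) :
    (∫ x, ψ x * cu k l (u s2) x) - (∫ x, ψ x * cu k l (u s1) x) =
      ∫ τ in s1..s2, ∫ x, ψ x * cu k l (FF ν (u τ)) x := by
  obtain ⟨a1, i1⟩ := S.loc1 h12 hJ ψ hN k l
  obtain ⟨a2, i2⟩ := S.loc1 h12 hJ ψ hN l k
  have : (∫ x, ψ x * cu k l (u s2) x) - (∫ x, ψ x * cu k l (u s1) x) =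
     ((∫ x, DD l ψ x * u s2 k x) - (∫ x, DD l ψ x * u s1 k x)) - ((∫ x, DD k ψ x * u s2 l x) - (∫ x, DD k ψ x * u s1 l x)) := by
    rw [cp_eq, cp_eq]; ring
  rw [this, a1, a2, ← intervalIntegral.integral_sub i2 i1]
  apply intervalIntegral.integral_congr
  intro τ hτ
  rw [Set.uIcc_of_le h12] at hτ
  obtain ⟨p, hp, h⟩ := S.nse τ (hJ hτ)
  dsimp only
  simp_rw [h]
  have c1 : ∀ l, Continuous (fun x => fderiv ℝ p x (ee l)) := fun l => (hp.continuous_fderiv one_ne_zero).clm_apply continuous_const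
  have e : ∀ k l, ∫ x, DD k ψ x * (FF ν (u τ) l x - fderiv ℝ p x (ee l)) =
     (∫ x, DD k ψ x * FF ν (u τ) l x) - ∫ x, DD k ψ x * fderiv ℝ p x (ee l) := by
    intro k l
    simp_rw [mul_sub]
    rw [integral_sub (int_mul _ _) (int_cs (DD k ψ).continuous (c1 l) (hcs_DD hψ k))]
  rw [e, e, cp_eq, press hψ hp k l]; ring

lemma Sol.vort {T ν : ℝ} {u : ℝ → VF} (S : Sol T ν u) {s1 s2 : ℝ} (h12 : s1 ≤ s2) (hJ : Set.Icc s1 s2 ⊆ Set.Ico 0 T)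
    (hQ : QB u (Set.Icc s1 s2)) (k l : Fin 3) (x : E3) :
    cu k l (u s2) x - cu k l (u s1) x - ∫ τ in s1..s2, cu k l (FF ν (u τ)) x = 0 := by
  set K : E3 → ℂ := fun x => cu k l (u s2) x - cu k l (u s1) x - ∫ τ in s1..s2, cu k l (FF ν (u τ)) x with hK
  have gC := S.goodC hQ k l
  obtain ⟨M, hM0, hM⟩ := gC.norm (by norm_num)
  have hI : Continuous fun x => ∫ τ in s1..s2, cu k l (FF ν (u τ)) x := by
    apply intervalIntegral.continuous_of_dominated_interval (bound := fun _ => M)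
    · intro x
      rw [Set.uIoc_of_le h12]
      exact ((gC.ct x).mono Set.Ioc_subset_Icc_self).aestronglyMeasurable measurableSet_Ioc
    · intro x
      refine Filter.Eventually.of_forall fun τ hτ => ?_
      rw [Set.uIoc_of_le h12] at hτ
      exact hM τ (Set.Ioc_subset_Icc_self hτ) x
    · exact intervalIntegrable_const
    · exact Filter.Eventually.of_forall fun τ _ => (cu k l (FF ν (u τ))).continuous
  have hKc : Continuous K := ((cu k l (u s2)).continuous.sub (cu k l (u s1)).continuous).sub hI
  -- Baire
  let X : ℕ → Set E3 := fun n => {x | ∀ τ ∈ Set.Icc s1 s2, ∀ j, ‖deriv (fun s => u s j x) τ‖ ≤ n}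
  have hXc : ∀ n, IsClosed (X n) := by
    intro n
    have : X n = ⋂ τ ∈ Set.Icc s1 s2, ⋂ j, {x | ‖deriv (fun s => u s j x) τ‖ ≤ n} := by
      ext x; simp [X]
    rw [this]
    refine isClosed_biInter fun τ hτ => isClosed_iInter fun j => ?_
    exact isClosed_le (S.dcontx j (hJ hτ)).norm continuous_const
  have hXm : Monotone X := by
    intro m n hmn x hx τ hτ j
    exact (hx τ hτ j).trans (by exact_mod_cast hmn)
  have hXu : ⋃ n, X n = Set.univ := by
    rw [Set.eq_univ_iff_forall]
    intro x
    have : ∀ j, ∃ B, ∀ τ ∈ Set.Icc s1 s2, ‖deriv (fun s => u s j x) τ‖ ≤ B := fun j =>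
      isCompact_Icc.exists_bound_of_continuousOn (S.dcont j x).continuousOn
    choose B hB using this
    obtain ⟨n, hn⟩ := exists_nat_ge (∑ j, |B j|)
    refine Set.mem_iUnion.2 ⟨n, fun τ hτ j => (hB j τ hτ).trans ((le_abs_self _).trans (le_trans ?_ hn))⟩
    exact Finset.single_le_sum (f := fun j => |B j|) (fun _ _ => abs_nonneg _) (Finset.mem_univ j)
  have hd := dense_iUnion_interior_of_closed hXc hXu
  set U := ⋃ n, interior (X n)
  have hU : IsOpen U := isOpen_iUnion fun n => isOpen_interior
  have hKU : ∀ᵐ x, x ∈ U → K x = 0 := by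
    apply hU.ae_eq_zero_of_integral_contDiff_smul_eq_zero (hKc.locallyIntegrable.locallyIntegrableOn _)
    intro g hg hgc hgs
    have hgc' : HasCompactSupport (fun x => (g x : ℂ)) := hgc.comp_left (g := fun r : ℝ => (r:ℂ)) (by simp)
    have hg' : ContDiff ℝ ∞ (fun x => (g x : ℂ)) := Complex.ofRealCLM.contDiff.comp hg
    let ψ : SC := hgc'.toSchwartzMap hg'
    have hψ : ∀ x, ψ x = (g x : ℂ) := fun x => rfl
    have hsupp : tsupport ψ ⊆ tsupport g := by
      apply closure_mono
      intro x hx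
      simp only [Function.mem_support, hψ] at hx ⊢
      simpa using hx
    obtain ⟨n, hn⟩ : ∃ n, tsupport g ⊆ interior (X n) := by
      apply hgc.elim_directed_cover _ (fun n => isOpen_interior) hgs
      exact (Monotone.directed_le (fun m n h => interior_mono (hXm h)))
    have hl := S.loc h12 hJ ψ hgc' (N := n) (fun x hx => interior_subset (hn (hsupp hx))) k l
    have hf := fub h12 (fun τ x => cu k l (FF ν (u τ)) x) ψ (M := M) (fun τ _ => (cu k l (FF ν (u τ))).continuous)
      gC.ct (fun τ hτ x => by rw [norm_mul, mul_comm]; gcongr; exact hM τ hτ x)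
    rw [← hf] at hl
    have e : (fun x => g x • K x) = fun x => ψ x * cu k l (u s2) x - ψ x * cu k l (u s1) x - ψ x * ∫ τ in s1..s2, cu k l (FF ν (u τ)) x := by
      funext x; rw [hψ, Complex.real_smul]; simp only [hK]; ring
    have i0 : Integrable (fun x => ψ x * cu k l (u s2) x - ψ x * cu k l (u s1) x) := (int_mul _ _).sub (int_mul _ _)
    rw [e, integral_sub i0 (int_cs ψ.continuous hI hgc'), integral_sub (int_mul _ _) (int_mul _ _), hl, sub_self]
  have hKU' : Set.EqOn K (fun _ => 0) U := by
    apply Measure.eqOn_open_of_ae_eq (μ := volume) _ hU hKc.continuousOn continuousOn_const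
    rw [Filter.EventuallyEq, ae_restrict_iff' hU.measurableSet]
    exact hKU
  have := Continuous.ext_on hd hKc continuous_const hKU'
  exact congrFun this x

lemma Sol.vort_int {T ν : ℝ} {u : ℝ → VF} (S : Sol T ν u) {s1 s2 : ℝ} (h12 : s1 ≤ s2) (hJ : Set.Icc s1 s2 ⊆ Set.Ico 0 T)
    (hQ : QB u (Set.Icc s1 s2)) (k l : Fin 3) (ψ : SC) :
    (∫ x, ψ x * cu k l (u s2) x) - (∫ x, ψ x * cu k l (u s1) x) =
      ∫ τ in s1..s2, ∫ x, ψ x * cu k l (FF ν (u τ)) x := by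
  have gC := S.goodC hQ k l
  obtain ⟨M, hM0, hM⟩ := gC.norm (by norm_num)
  rw [← fub h12 (fun τ x => cu k l (FF ν (u τ)) x) ψ (M := M) (fun τ _ => (cu k l (FF ν (u τ))).continuous)
      gC.ct (fun τ hτ x => by rw [norm_mul, mul_comm]; gcongr; exact hM τ hτ x),
      ← integral_sub (int_mul _ _) (int_mul _ _)]
  congr 1; funext x
  have := S.vort h12 hJ hQ k l x
  rw [← mul_sub]; congr 1; linear_combination this

end
end NSE


namespace NSE
open SchwartzMap LineDeriv FourierTransform
open scoped SchwartzMap ENNReal NNReal ContDiff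

noncomputable def nW (W : E3 → ℝ) (f : VF) : ℝ := ∑ j, n1 W (f j)
noncomputable def br (θ g : VF) : ℂ := ∑ j, ∫ ξ, θ j ξ * ft (g j) ξ
noncomputable def tst (W : E3 → ℝ) (f : VF) : VF := fun j => mulS (fun ξ => (W ξ : ℂ)) (fi (f j))
def DF (θ : VF) : Prop := ∀ ξ : E3, ∑ j, ((ξ j : ℝ) : ℂ) * θ j ξ = 0
def dF (f : VF) : Prop := ∑ j, DD j (f j) = 0

lemma nW_nonneg {W} (hW : Wt W) (f : VF) : 0 ≤ nW W f := Finset.sum_nonneg fun j _ => n1_nonneg hW (f j)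
lemma n1_le_nW {W} (hW : Wt W) (f : VF) (j) : n1 W (f j) ≤ nW W f :=
  Finset.single_le_sum (f := fun j => n1 W (f j)) (fun j _ => n1_nonneg hW (f j)) (Finset.mem_univ j)

lemma tst_apply {W : E3 → ℝ} (hW : Wt W) (f : VF) (j) (ξ) : tst W f j ξ = (W ξ : ℂ) * fi (f j) ξ :=
  mulS_apply (tg_ofReal hW.tg) _ _

lemma br_sub (θ f g : VF) : br θ (f - g) = br θ f - br θ g := by
  unfold br
  rw [← Finset.sum_sub_distrib]
  refine Finset.sum_congr rfl fun j _ => ?_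
  rw [← integral_sub (int_mul _ _) (int_mul _ _)]
  congr 1; funext ξ
  rw [Pi.sub_apply, ft_sub, sub_apply]; ring

lemma tg_creal (i : Fin 3) : (fun ξ : E3 => ξ i).HasTemperateGrowth :=
  (EuclideanSpace.proj i : E3 →L[ℝ] ℝ).hasTemperateGrowth

noncomputable def chi (R : ℝ) (ξ : E3) : ℝ := R ^ 2 * ‖ξ‖ ^ 2 * (1 + R ^ 2 * ‖ξ‖ ^ 2)⁻¹
lemma tg_chi (R : ℝ) : (chi R).HasTemperateGrowth := by
  unfold chi
  have h : (fun ξ : E3 => R ^ 2 * ‖ξ‖ ^ 2).HasTemperateGrowth := by fun_prop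
  exact h.mul (tg_resolvent R)
lemma tg_kap (R : ℝ) (k : Fin 3) : (fun ξ : E3 => R ^ 2 * ξ k * (1 + R ^ 2 * ‖ξ‖ ^ 2)⁻¹).HasTemperateGrowth := by
  have h : (fun ξ : E3 => R ^ 2 * ξ k).HasTemperateGrowth := by
    have := tg_creal k
    fun_prop
  exact h.mul (tg_resolvent R)
lemma chi_nonneg (R ξ) : 0 ≤ chi R ξ := by unfold chi; positivity
lemma chi_le (R ξ) : chi R ξ ≤ 1 := by
  unfold chi; rw [← div_eq_mul_inv, div_le_one (by positivity)]; linarith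

noncomputable def thR (R : ℝ) (θ : VF) : VF := fun j => mulS (fun ξ => (chi R ξ : ℂ)) (θ j)
noncomputable def eta (R : ℝ) (θ : VF) (k l : Fin 3) : SC :=
  ((2 * π * Complex.I : ℂ))⁻¹ • mulS (fun ξ => ((R ^ 2 * ξ k * (1 + R ^ 2 * ‖ξ‖ ^ 2)⁻¹ : ℝ) : ℂ)) (θ l)

lemma br_curl (R : ℝ) {θ : VF} (hθ : DF θ) (f : VF) :
    br (thR R θ) f = ∑ k, ∑ l, ∫ x, ft (eta R θ k l) x * cu k l f x := by
  simp_rw [int_ft_mul]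
  unfold br
  rw [← integral_finsetSum _ (fun j _ => int_mul _ _)]
  have : ∀ k, ∑ l, ∫ ξ, eta R θ k l ξ * ft (cu k l f) ξ = ∫ ξ, ∑ l, eta R θ k l ξ * ft (cu k l f) ξ := fun k =>
    (integral_finsetSum _ (fun j _ => int_mul _ _)).symm
  simp_rw [this]
  rw [← integral_finsetSum _ (fun j _ => integrable_finsetSum _ fun l _ => int_mul _ _)]
  congr 1; funext ξ
  have h0 := hθ ξ
  have hn : ((‖ξ‖ ^ 2 : ℝ) : ℂ) = (ξ 0 : ℂ) ^ 2 + (ξ 1 : ℂ) ^ 2 + (ξ 2 : ℂ) ^ 2 := by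
    rw [EuclideanSpace.norm_sq_eq, Fin.sum_univ_three]; simp
  have hpi : (2 * π * Complex.I : ℂ) ≠ 0 := by simp [Real.pi_ne_zero]
  simp only [thR, eta, smul_apply, smul_eq_mul, mulS_apply (tg_ofReal (tg_chi R)), mulS_apply (tg_ofReal (tg_kap R _)), cu, ft_sub, sub_apply, ft_DD]
  have e : ((chi R ξ : ℝ) : ℂ) = R ^ 2 * ((1 + R ^ 2 * ‖ξ‖ ^ 2)⁻¹ : ℝ) * ((ξ 0 : ℂ) ^ 2 + (ξ 1 : ℂ) ^ 2 + (ξ 2 : ℂ) ^ 2) := by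
    rw [← hn, chi]; push_cast; ring
  rw [e]
  have e2 : ∀ k, ((R ^ 2 * ξ k * (1 + R ^ 2 * ‖ξ‖ ^ 2)⁻¹ : ℝ) : ℂ) = R ^ 2 * ((1 + R ^ 2 * ‖ξ‖ ^ 2)⁻¹ : ℝ) * ξ k := by
    intro k; push_cast; ring
  simp only [e2]
  generalize (R ^ 2 * ((1 + R ^ 2 * ‖ξ‖ ^ 2)⁻¹ : ℝ) : ℂ) = ρ
  have e3 : ∀ k l : Fin 3, (2 * π * Complex.I : ℂ)⁻¹ * (ρ * (ξ k : ℂ) * θ l ξ) * (2 * π * Complex.I * (ξ k : ℝ) * ft (f l) ξ - 2 * π * Complex.I * (ξ l : ℝ) * ft (f k) ξ)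
     = (ρ * (ξ k : ℂ) * θ l ξ) * ((ξ k : ℝ) * ft (f l) ξ - (ξ l : ℝ) * ft (f k) ξ) := by
    intro k l; field_simp
  simp only [e3]
  simp only [Fin.sum_univ_three] at h0 ⊢
  linear_combination ρ * (ξ 0 * ft (f 0) ξ + ξ 1 * ft (f 1) ξ + ξ 2 * ft (f 2) ξ) * h0

lemma br_lim (θ f : VF) : Filter.Tendsto (fun n : ℕ => br (thR n θ) f) Filter.atTop (nhds (br θ f)) := by
  unfold br
  refine tendsto_finsetSum _ fun j _ => ?_
  apply tendsto_integral_of_dominated_convergence (fun ξ => ‖θ j ξ * ft (f j) ξ‖)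
  · intro n; exact (int_mul _ _).aestronglyMeasurable
  · exact (int_mul _ _).norm
  · intro n
    refine Filter.Eventually.of_forall fun ξ => ?_
    rw [thR, mulS_apply (tg_ofReal (tg_chi n)), norm_mul, norm_mul, norm_mul, Complex.norm_real, Real.norm_eq_abs,
      abs_of_nonneg (chi_nonneg _ _)]
    have := chi_le n ξ
    have h1 : chi n ξ * ‖θ j ξ‖ ≤ 1 * ‖θ j ξ‖ := by gcongr
    rw [one_mul] at h1
    gcongr
  · have : ∀ᵐ ξ : E3, ξ ≠ 0 := by simp [ae_iff]
    filter_upwards [this] with ξ hξ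
    simp only [thR, mulS_apply (tg_ofReal (tg_chi _))]
    have hx : 0 < ‖ξ‖ ^ 2 := by positivity
    have hl : Filter.Tendsto (fun n : ℕ => chi n ξ) Filter.atTop (nhds 1) := by
      have h1 : ∀ n : ℕ, chi n ξ = 1 - (1 + (n:ℝ) ^ 2 * ‖ξ‖ ^ 2)⁻¹ := by
        intro n; unfold chi; field_simp; ring
      simp_rw [h1]
      have : Filter.Tendsto (fun n : ℕ => (1 + (n:ℝ) ^ 2 * ‖ξ‖ ^ 2)⁻¹) Filter.atTop (nhds 0) := by
        apply Filter.Tendsto.inv_tendsto_atTop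
        apply Filter.tendsto_atTop_add_const_left
        apply Filter.Tendsto.atTop_mul_const hx
        exact (Filter.tendsto_pow_atTop two_ne_zero).comp tendsto_natCast_atTop_atTop
      simpa using this.const_sub 1
    have hl' : Filter.Tendsto (fun n : ℕ => (chi n ξ : ℂ)) Filter.atTop (nhds 1) := by
      have := (Complex.continuous_ofReal.tendsto 1).comp hl
      simpa [Function.comp_def] using this
    simpa using (hl'.mul_const (θ j ξ)).mul_const (ft (f j) ξ)

lemma n1_zero (f : SC) : n1 (bW 0) f = ∫ ξ, ‖ft f ξ‖ ^ 2 := by simp [n1, bW]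

lemma int_nsq (f : SC) : Integrable (fun ξ => ‖f ξ‖ ^ 2) := int_pow f 2 (by norm_num)

lemma norm_int_le (θ f : SC) : ‖∫ ξ, θ ξ * ft f ξ‖ ≤ √(∫ ξ, ‖θ ξ‖ ^ 2) * √(n1 (bW 0) f) := by
  rw [n1_zero]
  refine (norm_integral_le_integral_norm _).trans ?_
  have := (cs (f := fun ξ => ‖θ ξ‖) (g := fun ξ => ‖ft f ξ‖) θ.continuous.norm.aestronglyMeasurable
    (ft f).continuous.norm.aestronglyMeasurable (int_nsq _) (int_nsq _)).2
  refine le_trans (le_of_eq ?_) this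
  congr 1; funext ξ
  rw [norm_mul, abs_of_nonneg (by positivity)]

lemma nthR (R : ℝ) (θ : VF) (j) : ∫ ξ, ‖thR R θ j ξ‖ ^ 2 ≤ ∫ ξ, ‖θ j ξ‖ ^ 2 := by
  apply integral_mono (int_nsq _) (int_nsq _)
  intro ξ
  dsimp only
  rw [thR, mulS_apply (tg_ofReal (tg_chi R)), norm_mul, Complex.norm_real, Real.norm_eq_abs, abs_of_nonneg (chi_nonneg _ _)]
  have := chi_le R ξ
  have h1 : chi R ξ * ‖θ j ξ‖ ≤ 1 * ‖θ j ξ‖ := by gcongr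
  rw [one_mul] at h1
  have := chi_nonneg R ξ
  gcongr

lemma br_cont {J : Set ℝ} {n : ℕ} {g : ℝ → VF} (hg : ∀ j, Good J n (fun s => g s j)) (θ : VF) :
    ContinuousOn (fun s => br θ (g s)) J := by
  unfold br
  refine continuousOn_finsetSum _ fun j _ => ?_
  simp_rw [← int_ft_mul]
  exact (hg j).cont_int _

section

lemma Sol.ftc {T ν : ℝ} {u : ℝ → VF} (S : Sol T ν u) {s1 s2 : ℝ} (h12 : s1 ≤ s2) (hJ : Set.Icc s1 s2 ⊆ Set.Ico 0 T)
    (hQ : QB u (Set.Icc s1 s2)) {θ : VF} (hθ : DF θ) :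
    br θ (u s2) - br θ (u s1) = ∫ τ in s1..s2, br θ (FF ν (u τ)) := by
  have gF := S.goodF hQ
  have hR : ∀ n : ℕ, br (thR n θ) (u s2) - br (thR n θ) (u s1) = ∫ τ in s1..s2, br (thR n θ) (FF ν (u τ)) := by
    intro n
    simp_rw [br_curl n hθ]
    rw [intervalIntegral.integral_finsetSum]
    · rw [← Finset.sum_sub_distrib]
      refine Finset.sum_congr rfl fun k _ => ?_
      rw [intervalIntegral.integral_finsetSum]
      · rw [← Finset.sum_sub_distrib]
        exact Finset.sum_congr rfl fun l _ => S.vort_int h12 hJ hQ k l _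
      · intro l _
        apply ContinuousOn.intervalIntegrable
        rw [Set.uIcc_of_le h12]
        exact (S.goodC hQ k l).cont_int _
    · intro k _
      apply ContinuousOn.intervalIntegrable
      rw [Set.uIcc_of_le h12]
      exact continuousOn_finsetSum _ fun l _ => (S.goodC hQ k l).cont_int _
  have l1 := (br_lim θ (u s2)).sub (br_lim θ (u s1))
  have hB : ∀ j, ∃ M, 0 ≤ M ∧ ∀ s ∈ Set.Icc s1 s2, n1 (bW 0) (FF ν (u s) j) ≤ M := fun j => ((gF j).mono (Nat.zero_le _)).bd'
  choose M hM0 hM using hB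
  have l2 : Filter.Tendsto (fun n : ℕ => ∫ τ in s1..s2, br (thR n θ) (FF ν (u τ))) Filter.atTop
      (nhds (∫ τ in s1..s2, br θ (FF ν (u τ)))) := by
    apply intervalIntegral.tendsto_integral_filter_of_dominated_convergence
      (fun _ => ∑ j, √(∫ ξ, ‖θ j ξ‖ ^ 2) * √(M j))
    · refine Filter.Eventually.of_forall fun n => ?_
      rw [Set.uIoc_of_le h12]
      exact ((br_cont gF _).mono Set.Ioc_subset_Icc_self).aestronglyMeasurable measurableSet_Ioc
    · refine Filter.Eventually.of_forall fun n => Filter.Eventually.of_forall fun τ hτ => ?_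
      rw [Set.uIoc_of_le h12] at hτ
      refine (norm_sum_le _ _).trans (Finset.sum_le_sum fun j _ => (norm_int_le _ _).trans ?_)
      have := nthR n θ j
      have := hM j τ (Set.Ioc_subset_Icc_self hτ)
      gcongr
    · exact intervalIntegrable_const
    · exact Filter.Eventually.of_forall fun τ _ => br_lim _ _
  simp_rw [hR] at l1
  exact (tendsto_nhds_unique l2 l1).symm

lemma Sol.brderiv {T ν : ℝ} {u : ℝ → VF} (S : Sol T ν u) {α β : ℝ} (hJ : Set.Icc α β ⊆ Set.Ico 0 T)
    (hQ : QB u (Set.Icc α β)) {θ : VF} (hθ : DF θ) {t : ℝ} (ht : t ∈ Set.Icc α β) :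
    HasDerivWithinAt (fun s => br θ (u s)) (br θ (FF ν (u t))) (Set.Icc α β) t := by
  have hc := br_cont (S.goodF hQ) θ
  have sub : ∀ s ∈ Set.Icc α β, Set.Icc α s ⊆ Set.Icc α β := fun s hs => Set.Icc_subset_Icc_right hs.2
  have hf : ∀ s ∈ Set.Icc α β, br θ (u s) = br θ (u α) + ∫ τ in α..s, br θ (FF ν (u τ)) := by
    intro s hs
    rw [← S.ftc hs.1 ((sub s hs).trans hJ) (by obtain ⟨M, hM⟩ := hQ; exact ⟨M, fun r hr => hM r (sub s hs hr)⟩) hθ]; ring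
  have : Fact (t ∈ Set.Icc α β) := ⟨ht⟩
  have h1 : HasDerivWithinAt (fun s => ∫ τ in α..s, br θ (FF ν (u τ))) (br θ (FF ν (u t))) (Set.Icc α β) t := by
    apply intervalIntegral.integral_hasDerivWithinAt_right
    · apply ContinuousOn.intervalIntegrable
      rw [Set.uIcc_of_le ht.1]; exact hc.mono (sub t ht)
    · exact hc.stronglyMeasurableAtFilter_nhdsWithin measurableSet_Icc t
    · exact hc t ht
  exact (h1.const_add (br θ (u α))).congr hf (hf t ht)

end
end NSE


namespace NSE
open SchwartzMap LineDeriv FourierTransform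
open scoped SchwartzMap ENNReal NNReal ContDiff

def RV (f : VF) : Prop := ∀ j, IsR (f j)

lemma IsR.sub {f g : SC} (hf : IsR f) (hg : IsR g) : IsR (f - g) := by
  intro x; rw [sub_apply, map_sub, hf, hg]
lemma RV.sub {f g : VF} (hf : RV f) (hg : RV g) : RV (f - g) := fun j => (hf j).sub (hg j)
lemma dF.sub {f g : VF} (hf : dF f) (hg : dF g) : dF (f - g) := by
  unfold dF at *
  simp only [Pi.sub_apply, DD_sub, Finset.sum_sub_distrib, hf, hg, sub_zero]

lemma DF_tst {W : E3 → ℝ} (hW : Wt W) {f : VF} (hf : dF f) : DF (tst W f) := by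
  intro ξ
  simp only [tst_apply hW]
  have h : ft (∑ j, DD j (f j)) (-ξ) = 0 := by rw [hf, ft_zero]; rfl
  rw [ft_sum, sum_apply'] at h
  simp only [ft_DD] at h
  simp only [ft_neg] at h
  have hpi : (2 * π * Complex.I : ℂ) ≠ 0 := by simp [Real.pi_ne_zero]
  have e : ∑ j, 2 * π * Complex.I * (((-ξ) j : ℝ) : ℂ) * fi (f j) ξ = -(2 * π * Complex.I) * ∑ j, (ξ j : ℂ) * fi (f j) ξ := by
    rw [Finset.mul_sum]; refine Finset.sum_congr rfl fun j _ => ?_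
    simp; ring
  rw [e] at h
  have h2 : ∑ j, (ξ j : ℂ) * fi (f j) ξ = 0 := by
    rcases mul_eq_zero.1 h with h | h
    · exact absurd (neg_eq_zero.1 h) hpi
    · exact h
  calc _ = (W ξ : ℂ) * ∑ j, (ξ j : ℂ) * fi (f j) ξ := by
        rw [Finset.mul_sum]; exact Finset.sum_congr rfl fun j _ => by ring
    _ = 0 := by rw [h2, mul_zero]

lemma pair1 {W W1 W2 : E3 → ℝ} (hW : Wt W) (hW1 : Wt W1) (hW2 : Wt W2) (h : ∀ ξ, W ξ ^ 2 ≤ W1 ξ * W2 ξ)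
    {f : SC} (g : SC) (hf : IsR f) :
    ‖∫ ξ, mulS (fun ξ => (W ξ : ℂ)) (fi f) ξ * ft g ξ‖ ≤ √(n1 W1 f) * √(n1 W2 g) := by
  refine (norm_integral_le_integral_norm _).trans ?_
  have e : ∀ (V : E3 → ℝ), Wt V → ∀ (f : SC), (fun ξ => (√(V ξ) * ‖ft f ξ‖) ^ 2) = fun ξ => V ξ * ‖ft f ξ‖ ^ 2 := by
    intro V hV f; funext ξ; rw [mul_pow, Real.sq_sqrt (hV.nn ξ)]
  obtain ⟨hi, hc⟩ := cs (f := fun ξ => √(W1 ξ) * ‖ft f ξ‖) (g := fun ξ => √(W2 ξ) * ‖ft g ξ‖)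
    ((hW1.tg.1.continuous.sqrt.mul (ft f).continuous.norm).aestronglyMeasurable)
    ((hW2.tg.1.continuous.sqrt.mul (ft g).continuous.norm).aestronglyMeasurable)
    (by rw [e W1 hW1]; exact int_sq _ _ hW1.tg) (by rw [e W2 hW2]; exact int_sq _ _ hW2.tg)
  rw [e W1 hW1, e W2 hW2] at hc
  refine le_trans ?_ hc
  apply integral_mono (int_mul _ _).norm hi.abs
  intro ξ
  dsimp only
  rw [mulS_apply (tg_ofReal hW.tg), norm_mul, norm_mul, norm_fi hf, Complex.norm_real, Real.norm_eq_abs, abs_of_nonneg (hW.nn ξ),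
    abs_of_nonneg (by positivity)]
  have : W ξ ≤ √(W1 ξ) * √(W2 ξ) := by
    rw [← Real.sqrt_mul (hW1.nn ξ)]; exact Real.le_sqrt_of_sq_le (h ξ)
  calc _ ≤ (√(W1 ξ) * √(W2 ξ)) * ‖ft f ξ‖ * ‖ft g ξ‖ := by gcongr
    _ = _ := by ring

lemma pair_le {W W1 W2 : E3 → ℝ} (hW : Wt W) (hW1 : Wt W1) (hW2 : Wt W2) (h : ∀ ξ, W ξ ^ 2 ≤ W1 ξ * W2 ξ)
    {f : VF} (g : VF) (hf : RV f) :
    ‖br (tst W f) g‖ ≤ √(nW W1 f) * √(nW W2 g) := by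
  refine (norm_sum_le _ _).trans ?_
  refine (Finset.sum_le_sum fun j _ => pair1 hW hW1 hW2 h (g j) (hf j)).trans ?_
  exact Real.sum_sqrt_mul_sqrt_le _ (fun j => n1_nonneg hW1 _) (fun j => n1_nonneg hW2 _)

lemma n1_add_eq {W : E3 → ℝ} (hW : Wt W) {f : SC} (g : SC) (hf : IsR f) :
    n1 W (f + g) = n1 W f + n1 W g + 2 * (∫ ξ, mulS (fun ξ => (W ξ : ℂ)) (fi f) ξ * ft g ξ).re := by
  have hre : (∫ ξ, mulS (fun ξ => (W ξ : ℂ)) (fi f) ξ * ft g ξ).re = ∫ ξ, (mulS (fun ξ => (W ξ : ℂ)) (fi f) ξ * ft g ξ).re :=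
    (integral_re (int_mul _ _)).symm
  have ire : Integrable (fun ξ => (mulS (fun ξ => (W ξ : ℂ)) (fi f) ξ * ft g ξ).re) := (int_mul _ _).re
  rw [hre, n1, n1, n1, ← integral_const_mul, ← integral_add (int_sq _ _ hW.tg) (int_sq _ _ hW.tg)]
  have i1 : Integrable (fun ξ => W ξ * ‖ft f ξ‖ ^ 2 + W ξ * ‖ft g ξ‖ ^ 2) := (int_sq _ _ hW.tg).add (int_sq _ _ hW.tg)
  rw [← integral_add i1 (ire.const_mul 2)]
  congr 1; funext ξ
  rw [ft_add, add_apply, mulS_apply (tg_ofReal hW.tg), ← conj_ft hf, mul_assoc, Complex.re_ofReal_mul]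
  simp only [← Complex.normSq_eq_norm_sq, Complex.normSq_apply, Complex.add_re, Complex.add_im, Complex.mul_re, Complex.conj_re, Complex.conj_im]
  ring

lemma nW_add_eq {W : E3 → ℝ} (hW : Wt W) {f : VF} (g : VF) (hf : RV f) :
    nW W (f + g) = nW W f + nW W g + 2 * (br (tst W f) g).re := by
  simp only [nW, br, Complex.re_sum, Finset.mul_sum, ← Finset.sum_add_distrib]
  exact Finset.sum_congr rfl fun j _ => n1_add_eq hW (g j) (hf j)

lemma br_tst_self {W : E3 → ℝ} (hW : Wt W) {f : VF} (hf : RV f) : br (tst W f) f = (nW W f : ℂ) := by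
  simp only [nW, br, Complex.ofReal_sum]
  refine Finset.sum_congr rfl fun j _ => ?_
  rw [n1, ← integral_complex_ofReal]
  congr 1; funext ξ
  rw [tst_apply hW, mul_assoc, fi_mul_ft (hf j)]; push_cast; ring

lemma nW_mono {W W' : E3 → ℝ} (hW : Wt W) (hW' : Wt W') {c : ℝ} (h : ∀ ξ, W ξ ≤ c * W' ξ) (f : VF) :
    nW W f ≤ c * nW W' f := by
  rw [nW, nW, Finset.mul_sum]
  exact Finset.sum_le_sum fun j _ => n1_mono hW hW' h _

lemma nW_sub_le {W : E3 → ℝ} (hW : Wt W) (f g : VF) : nW W (f - g) ≤ 2 * nW W f + 2 * nW W g := by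
  simp only [nW, Finset.mul_sum, ← Finset.sum_add_distrib]
  exact Finset.sum_le_sum fun j _ => n1_sub_le hW _ _

section

lemma Sol.rv {T ν : ℝ} {u : ℝ → VF} (S : Sol T ν u) (s) : RV (u s) := S.real s

lemma Sol.FFbd {T ν : ℝ} {u : ℝ → VF} (S : Sol T ν u) {J : Set ℝ} (hQ : QB u J) {W : E3 → ℝ} (hW : Wt W) {c : ℝ} (hc : 0 ≤ c) (h : ∀ ξ, W ξ ≤ c * bW 6 ξ) :
    ∃ M, 0 ≤ M ∧ ∀ s ∈ J, nW W (FF ν (u s)) ≤ M := by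
  have := fun j => (S.goodF hQ j).bd'
  choose M h0 hM using this
  refine ⟨c * ∑ j, M j, mul_nonneg hc (Finset.sum_nonneg fun j _ => h0 j), fun s hs => (nW_mono hW (wt_bW 6) h _).trans ?_⟩
  gcongr
  exact Finset.sum_le_sum fun j _ => hM j s hs

lemma Sol.quad {T ν : ℝ} {u : ℝ → VF} (S : Sol T ν u) {α β : ℝ} (hab : α ≤ β) (hJ : Set.Icc α β ⊆ Set.Ico 0 T)
    (hQ : QB u (Set.Icc α β)) {W : E3 → ℝ} (hW : Wt W) {M : ℝ} (hM0 : 0 ≤ M)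
    (hM : ∀ s ∈ Set.Icc α β, nW W (FF ν (u s)) ≤ M) :
    nW W (u β - u α) ≤ M * (β - α) ^ 2 := by
  set v := u β - u α with hv
  have hr : RV v := (S.rv β).sub (S.rv α)
  have hd : dF v := dF.sub (S.div β (hJ ⟨hab, le_rfl⟩)) (S.div α (hJ ⟨le_rfl, hab⟩))
  have h := S.ftc hab hJ hQ (DF_tst hW hd)
  rw [← br_sub, ← hv, br_tst_self hW hr] at h
  have hb : ‖∫ τ in α..β, br (tst W v) (FF ν (u τ))‖ ≤ (√(nW W v) * √M) * |β - α| := by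
    apply intervalIntegral.norm_integral_le_of_norm_le_const
    intro τ hτ
    rw [Set.uIoc_of_le hab] at hτ
    refine (pair_le hW hW hW (fun ξ => by rw [sq]) _ hr).trans ?_
    gcongr
    exact hM τ (Set.Ioc_subset_Icc_self hτ)
  rw [← h, Complex.norm_real, Real.norm_eq_abs, abs_of_nonneg (nW_nonneg hW _), abs_of_nonneg (sub_nonneg.2 hab)] at hb
  have hn := nW_nonneg hW v
  set q := √(nW W v) with hq
  have hq2 : nW W v = q ^ 2 := (Real.sq_sqrt hn).symm
  have hq0 : 0 ≤ q := Real.sqrt_nonneg _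
  have : q ≤ √M * (β - α) := by
    rcases hq0.eq_or_lt with h | h
    · rw [← h]; exact mul_nonneg (Real.sqrt_nonneg _) (sub_nonneg.2 hab)
    · rw [hq2] at hb
      nlinarith
  calc nW W v = q ^ 2 := hq2
    _ ≤ (√M * (β - α)) ^ 2 := by gcongr
    _ = M * (β - α) ^ 2 := by rw [mul_pow, Real.sq_sqrt hM0]

lemma Sol.energy {T ν : ℝ} {u : ℝ → VF} (S : Sol T ν u) {α β : ℝ} (hJ : Set.Icc α β ⊆ Set.Ico 0 T)
    (hQ : QB u (Set.Icc α β)) {W : E3 → ℝ} (hW : Wt W) {c : ℝ} (hc : 0 ≤ c) (hWc : ∀ ξ, W ξ ≤ c * bW 6 ξ)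
    {a : VF} (har : RV a) (had : dF a) {t : ℝ} (ht : t ∈ Set.Icc α β) :
    HasDerivWithinAt (fun s => nW W (u s - a)) (2 * (br (tst W (u t - a)) (FF ν (u t))).re) (Set.Icc α β) t := by
  obtain ⟨M, hM0, hM⟩ := S.FFbd hQ hW hc hWc
  have hr : RV (u t - a) := (S.rv t).sub har
  have hd : dF (u t - a) := dF.sub (S.div t (hJ ht)) had
  have h1 := S.brderiv hJ hQ (DF_tst hW hd) ht
  have h2 : HasDerivWithinAt (fun s => (br (tst W (u t - a)) (u s)).re) (br (tst W (u t - a)) (FF ν (u t))).re (Set.Icc α β) t :=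
    Complex.reCLM.hasFDerivAt.comp_hasDerivWithinAt t h1
  have h3 : HasDerivWithinAt (fun s => nW W (u s - u t)) 0 (Set.Icc α β) t := by
    have hO : (fun s => nW W (u s - u t)) =O[nhdsWithin t (Set.Icc α β)] fun s => ‖s - t‖ ^ 2 := by
      refine Asymptotics.IsBigO.of_bound M ?_
      filter_upwards [self_mem_nhdsWithin] with s hs
      rw [Real.norm_eq_abs, abs_of_nonneg (nW_nonneg hW _)]
      simp only [Real.norm_eq_abs, sq_abs, abs_pow]
      rcases le_total t s with h | h
      · have sub : Set.Icc t s ⊆ Set.Icc α β := Set.Icc_subset_Icc ht.1 hs.2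
        exact S.quad h (sub.trans hJ) (by obtain ⟨M, hM⟩ := hQ; exact ⟨M, fun r hr => hM r (sub hr)⟩) hW hM0 (fun r hr => hM r (sub hr))
      · have sub : Set.Icc s t ⊆ Set.Icc α β := Set.Icc_subset_Icc hs.1 ht.2
        have := S.quad h (sub.trans hJ) (by obtain ⟨M, hM⟩ := hQ; exact ⟨M, fun r hr => hM r (sub hr)⟩) hW hM0 (fun r hr => hM r (sub hr))
        have e : nW W (u s - u t) = nW W (u t - u s) := by
          unfold nW
          refine Finset.sum_congr rfl fun j _ => ?_
          have : (u s - u t) j = (-1 : ℂ) • (u t - u s) j := by simp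
          rw [this, n1_smul]; simp
        rw [e]; nlinarith
    have := hO.hasFDerivWithinAt (𝕜 := ℝ) ht (by norm_num)
    have := this.hasDerivWithinAt
    simpa using this
  have e : ∀ s, nW W (u s - a) = nW W (u t - a) + nW W (u s - u t) + 2 * ((br (tst W (u t - a)) (u s)).re - (br (tst W (u t - a)) (u t)).re) := by
    intro s
    have : u s - a = (u t - a) + (u s - u t) := by abel
    rw [this, nW_add_eq hW _ hr, br_sub, Complex.sub_re]
  rw [show (fun s => nW W (u s - a)) = _ from funext e]
  have := ((h3.const_add (nW W (u t - a))).add ((h2.sub_const (br (tst W (u t - a)) (u t)).re).const_mul 2))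
  exact this.congr_deriv (by ring)

end
end NSE


namespace NSE
open SchwartzMap LineDeriv FourierTransform
open scoped SchwartzMap ENNReal NNReal ContDiff
open Filter Topology

/-! ODE lemmas -/
def LZ (g : ℝ → ℝ) (a : ℝ) : Prop := ∀ ε > 0, ∃ᶠ s in 𝓝[>] a, g s < ε

lemma barrier {g g' : ℝ → ℝ} {a b δ ε s1 s2 : ℝ} (hd : ∀ s ∈ Set.Ioo a b, HasDerivAt g (g' s) s)
    (h : ∀ s ∈ Set.Ioo a b, g s < δ → g' s < ε) (hε : 0 ≤ ε) (h1 : s1 ∈ Set.Ioo a b) (h2 : s2 ∈ Set.Ioo a b) (h12 : s1 ≤ s2)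
    (hb : g s1 + ε * (s2 - s1) < δ) : g s2 ≤ g s1 + ε * (s2 - s1) := by
  have hsub : ∀ x ∈ Set.Icc s1 s2, x ∈ Set.Ioo a b := fun x hx => ⟨h1.1.trans_le hx.1, hx.2.trans_lt h2.2⟩
  refine image_le_of_deriv_right_lt_deriv_boundary' (f := g) (f' := g') (a := s1) (b := s2) (B := fun x => g s1 + ε * (x - s1)) (B' := fun _ => ε)
    (fun x hx => (hd x (hsub x hx)).continuousAt.continuousWithinAt)
    (fun x hx => (hd x (hsub x (Set.Ico_subset_Icc_self hx))).hasDerivWithinAt) (by simp) (by fun_prop) ?_ ?_ ⟨h12, le_rfl⟩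
  · intro x _
    have := (((hasDerivAt_id x).sub_const s1).const_mul ε).const_add (g s1)
    simpa using this.hasDerivWithinAt
  · intro x hx e
    refine h x (hsub x (Set.Ico_subset_Icc_self hx)) ?_
    rw [e]
    have : ε * (x - s1) ≤ ε * (s2 - s1) := by gcongr; exact hx.2.le
    linarith

lemma LZ.exists {g : ℝ → ℝ} {a : ℝ} (h : LZ g a) {ε c : ℝ} (hε : 0 < ε) (hc : a < c) : ∃ s, a < s ∧ s < c ∧ g s < ε := by
  have := (h ε hε).and_eventually (Ioo_mem_nhdsGT hc)
  obtain ⟨s, h1, h2⟩ := this.exists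
  exact ⟨s, h2.1, h2.2, h1⟩

lemma LZ.of_exists {g : ℝ → ℝ} {a b : ℝ} (hab : a < b) (h : ∀ ε > 0, ∀ c, a < c → c < b → ∃ s, a < s ∧ s < c ∧ g s < ε) : LZ g a := by
  intro ε hε
  rw [Filter.frequently_iff]
  intro U hU
  obtain ⟨c, hc, hs⟩ := (mem_nhdsGT_iff_exists_Ioo_subset' hab).1 hU
  have hc : a < c := hc
  obtain ⟨s, h1, h2, h3⟩ := h ε hε (min c ((a + b) / 2)) (lt_min hc (by linarith)) (lt_of_le_of_lt (min_le_right _ _) (by linarith))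
  exact ⟨s, hs ⟨h1, h2.trans_le (min_le_left _ _)⟩, h3⟩

lemma ode_up {g g' : ℝ → ℝ} {a b δ ε : ℝ} (hd : ∀ s ∈ Set.Ioo a b, HasDerivAt g (g' s) s)
    (h : ∀ s ∈ Set.Ioo a b, g s < δ → g' s < ε) (hε : 0 ≤ ε) (hz : LZ g a) {s : ℝ} (hs : s ∈ Set.Ioo a b)
    (hsδ : ε * (s - a) < δ) : g s ≤ ε * (s - a) := by
  refine le_of_forall_pos_le_add fun κ hκ => ?_
  set κ' := min κ (δ - ε * (s - a)) with hk
  have hκ' : 0 < κ' := lt_min hκ (by linarith)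
  obtain ⟨s1, h1, h2, h3⟩ := hz.exists hκ' hs.1
  have h4 : ε * (s - s1) ≤ ε * (s - a) := by gcongr
  have := barrier hd h hε ⟨h1, h2.trans hs.2⟩ hs h2.le (by
    have : κ' ≤ δ - ε * (s - a) := min_le_right _ _
    linarith)
  have : κ' ≤ κ := min_le_left _ _
  linarith

lemma ode1 {g g' d : ℝ → ℝ} {a b : ℝ} (hab : a < b) (hd : ∀ s ∈ Set.Ioo a b, HasDerivAt g (g' s) s)
    (hg0 : ∀ s ∈ Set.Ioo a b, 0 ≤ g s) (hd0 : ∀ s ∈ Set.Ioo a b, 0 ≤ d s)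
    (h : ∀ ε > 0, ∃ δ > 0, ∀ s ∈ Set.Ioo a b, g s < δ → g' s + d s ≤ ε)
    (hz : LZ g a) : Tendsto g (𝓝[>] a) (𝓝 0) ∧ LZ d a := by
  have hT : Tendsto g (𝓝[>] a) (𝓝 0) := by
    obtain ⟨δ, hδ, h1⟩ := h (1 / 2) (by norm_num)
    have h2 : ∀ s ∈ Set.Ioo a b, g s < δ → g' s < 1 := fun s hs hg => by
      have := h1 s hs hg; have := hd0 s hs; linarith
    have h3 : ∀ᶠ s in 𝓝[>] a, s ∈ Set.Ioo a (min b (a + δ)) := Ioo_mem_nhdsGT (lt_min hab (by linarith))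
    refine tendsto_of_tendsto_of_tendsto_of_le_of_le' (tendsto_const_nhds (x := (0:ℝ))) (h := fun s => s - a) ?_ ?_ ?_
    · have : Tendsto (fun s => s - a) (𝓝 a) (𝓝 (a - a)) := (continuous_id.sub continuous_const).tendsto a
      rw [sub_self] at this
      exact this.mono_left nhdsWithin_le_nhds
    · filter_upwards [h3] with s hs
      exact hg0 s ⟨hs.1, hs.2.trans_le (min_le_left _ _)⟩
    · filter_upwards [h3] with s hs
      have := ode_up hd h2 zero_le_one hz (s := s) ⟨hs.1, hs.2.trans_le (min_le_left _ _)⟩ (by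
        have := hs.2.trans_le (min_le_right _ _); linarith)
      linarith
  refine ⟨hT, LZ.of_exists hab fun ε hε c hac hcb => ?_⟩
  by_contra hcon
  push Not at hcon
  obtain ⟨δ, hδ, h1⟩ := h (ε / 2) (by linarith)
  have h3 : ∀ᶠ s in 𝓝[>] a, g s < δ := hT.eventually (gt_mem_nhds hδ)
  obtain ⟨c', hc', hs'⟩ := (mem_nhdsGT_iff_exists_Ioo_subset' hac).1 h3
  have hc' : a < c' := hc'
  set c2 := min c c' with hc2
  have hac2 : a < c2 := lt_min hac hc'
  have hder : ∀ s ∈ Set.Ioo a c2, g' s ≤ - (ε / 2) := by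
    intro s hs
    have h4 := h1 s ⟨hs.1, hs.2.trans_le ((min_le_left _ _).trans hcb.le)⟩ (hs' ⟨hs.1, hs.2.trans_le (min_le_right _ _)⟩)
    have := hcon s hs.1 (hs.2.trans_le (min_le_left _ _))
    linarith
  have hin : ∀ s ∈ Set.Ioo a c2, s ∈ Set.Ioo a b := fun s hs => ⟨hs.1, hs.2.trans_le ((min_le_left _ _).trans hcb.le)⟩
  set s2 := (a + c2) / 2 with hs2
  have hs2' : s2 ∈ Set.Ioo a c2 := ⟨by linarith, by linarith⟩
  set s3 := (a + s2) / 2 with hs3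
  have hs3' : s3 ∈ Set.Ioo a c2 := ⟨by linarith [hs2'.1], by linarith [hs2'.1, hs2'.2]⟩
  have h32 : s3 < s2 := by linarith [hs2'.1]
  have hpos : 0 < ε / 4 * (s2 - s3) := by apply mul_pos (by linarith); linarith
  obtain ⟨s1, q1, q2, q3⟩ := hz.exists hpos hs3'.1
  have hs1' : s1 ∈ Set.Ioo a c2 := ⟨q1, q2.trans hs3'.2⟩
  have hmv := Convex.image_sub_le_mul_sub_of_deriv_le (convex_Icc s1 s2) (f := g) (C := -(ε / 2))
    (fun x hx => (hd x (hin x ⟨q1.trans_le hx.1, hx.2.trans_lt hs2'.2⟩)).continuousAt.continuousWithinAt)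
    (fun x hx => by
      rw [interior_Icc] at hx
      exact (hd x (hin x ⟨q1.trans hx.1, hx.2.trans hs2'.2⟩)).differentiableAt.differentiableWithinAt)
    (fun x hx => by
      rw [interior_Icc] at hx
      rw [(hd x (hin x ⟨q1.trans hx.1, hx.2.trans hs2'.2⟩)).deriv]
      exact hder x ⟨q1.trans hx.1, hx.2.trans hs2'.2⟩)
    s1 ⟨le_rfl, (q2.trans h32).le⟩ s2 ⟨(q2.trans h32).le, le_rfl⟩ (q2.trans h32).le
  have := hg0 s2 (hin s2 hs2')
  nlinarith

lemma gron_fwd {g g' : ℝ → ℝ} {α β C K : ℝ} (hab : α ≤ β) (hc : ContinuousOn g (Set.Icc α β))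
    (hd : ∀ s ∈ Set.Ioo α β, HasDerivAt g (g' s) s) (h : ∀ s ∈ Set.Ioo α β, g' s ≤ C * (K + g s)) :
    K + g β ≤ exp (C * (β - α)) * (K + g α) := by
  have hanti : AntitoneOn (fun s => exp (-(C * s)) * (K + g s)) (Set.Icc α β) := by
    have hdd : ∀ x ∈ Set.Ioo α β, HasDerivAt (fun s => exp (-(C * s)) * (K + g s)) (exp (-(C * x)) * (-C) * (K + g x) + exp (-(C * x)) * g' x) x := by
      intro x hx
      have h1 : HasDerivAt (fun s => exp (-(C * s))) (exp (-(C * x)) * (-C)) x := by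
        have := (((hasDerivAt_id x).const_mul C).neg).exp
        simpa using this
      exact h1.mul ((hd x hx).const_add K)
    apply antitoneOn_of_deriv_nonpos (convex_Icc _ _)
    · exact (by fun_prop : Continuous fun s => exp (-(C * s))).continuousOn.mul (continuousOn_const.add hc)
    · intro x hx; rw [interior_Icc] at hx; exact (hdd x hx).differentiableAt.differentiableWithinAt
    · intro x hx; rw [interior_Icc] at hx
      rw [(hdd x hx).deriv]
      have := mul_le_mul_of_nonneg_left (h x hx) (exp_pos (-(C * x))).le
      linarith
  have := hanti ⟨le_rfl, hab⟩ ⟨hab, le_rfl⟩ hab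
  have h2 := mul_le_mul_of_nonneg_left this (exp_pos (C * β)).le
  simp only [← mul_assoc, ← exp_add] at h2
  rw [show C * β + -(C * β) = 0 by ring, exp_zero, one_mul] at h2
  rw [show C * (β - α) = C * β + -(C * α) by ring]; exact h2

lemma gron_bwd {g g' : ℝ → ℝ} {α β C K : ℝ} (hab : α ≤ β) (hc : ContinuousOn g (Set.Icc α β))
    (hd : ∀ s ∈ Set.Ioo α β, HasDerivAt g (g' s) s) (h : ∀ s ∈ Set.Ioo α β, -(C * (K + g s)) ≤ g' s) :
    K + g α ≤ exp (C * (β - α)) * (K + g β) := by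
  have := gron_fwd (g := fun s => g (-s)) (g' := fun s => - g' (-s)) (α := -β) (β := -α) (C := C) (K := K) (by linarith)
    (hc.comp continuous_neg.continuousOn fun x hx => ⟨by linarith [hx.2], by linarith [hx.1]⟩)
    (fun s hs => by
      have := (hd (-s) ⟨by linarith [hs.2], by linarith [hs.1]⟩).comp s (hasDerivAt_neg s)
      simpa [Function.comp_def] using this)
    (fun s hs => by have := h (-s) ⟨by linarith [hs.2], by linarith [hs.1]⟩; linarith)
  simpa [add_comm, sub_eq_add_neg] using this

/-! Baire skeleton -/
lemma skeleton {q : ℝ → ℝ} {α β : ℝ} {Cn : ℕ → Set ℝ} (hcl : ∀ n, IsClosed (Cn n)) (hmono : Monotone Cn)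
    (hcov : Set.Icc α β ⊆ ⋃ n, Cn n)
    (H : ∀ n, ∃ M, (∀ s ∈ Cn n, s ∈ Set.Icc α β → q s ≤ M) ∧
      ∀ a s, a ∈ Cn n → α ≤ a → a < s → s ≤ β → (∀ s1, a < s1 → s1 < s → ∃ M', ∀ r ∈ Set.Icc s1 s, q r ≤ M') → q s ≤ M) :
    ∃ M, ∀ s ∈ Set.Icc α β, q s ≤ M := by
  let LB : ℝ → Prop := fun s => ∃ M, ∀ᶠ r in 𝓝[Set.Icc α β] s, q r ≤ M
  have hcomp : ∀ K : Set ℝ, IsCompact K → K ⊆ Set.Icc α β → (∀ s ∈ K, LB s) → ∃ M, ∀ s ∈ K, q s ≤ M := by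
    intro K hK hKI hL
    refine hK.induction_on (p := fun S => ∃ M, ∀ s ∈ S, q s ≤ M) ⟨0, by simp⟩ ?_ ?_ ?_
    · rintro s t hst ⟨M, hM⟩; exact ⟨M, fun r hr => hM r (hst hr)⟩
    · rintro s t ⟨M, hM⟩ ⟨M', hM'⟩
      refine ⟨max M M', ?_⟩
      rintro r (hr | hr)
      · exact (hM r hr).trans (le_max_left _ _)
      · exact (hM' r hr).trans (le_max_right _ _)
    · intro x hx
      obtain ⟨M, hM⟩ := hL x hx
      exact ⟨_, nhdsWithin_mono x hKI hM, M, fun s hs => hs⟩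
  by_contra hcon
  let Z : Set ℝ := {s | s ∈ Set.Icc α β ∧ ¬ LB s}
  have hZI : Z ⊆ Set.Icc α β := fun s hs => hs.1
  have hZne : Z.Nonempty := by
    by_contra hne
    rw [Set.not_nonempty_iff_eq_empty] at hne
    refine hcon (hcomp _ isCompact_Icc subset_rfl fun s hs => ?_)
    by_contra hs'
    have : s ∈ Z := ⟨hs, hs'⟩
    rw [hne] at this; exact this
  have hZcl : IsClosed Z := by
    rw [← isOpen_compl_iff, isOpen_iff_mem_nhds]
    intro s hs
    by_cases hsI : s ∈ Set.Icc α β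
    · have hL : LB s := by by_contra h; exact hs ⟨hsI, h⟩
      obtain ⟨M, hM⟩ := hL
      have := eventually_eventually_nhdsWithin.2 hM
      have h2 := eventually_nhdsWithin_iff.1 this
      filter_upwards [h2] with r hr hrZ
      exact hrZ.2 ⟨M, hr hrZ.1⟩
    · filter_upwards [isClosed_Icc.isOpen_compl.mem_nhds hsI] with r hr hrZ
      exact hr hrZ.1
  haveI : CompleteSpace Z := hZcl.completeSpace_coe
  haveI : Nonempty Z := hZne.to_subtype
  obtain ⟨n, hn⟩ := nonempty_interior_of_iUnion_of_closed (X := Z) (f := fun n => Subtype.val ⁻¹' Cn n)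
    (fun n => (hcl n).preimage continuous_subtype_val) (by
      rw [← Set.preimage_iUnion, Set.eq_univ_iff_forall]
      intro z; exact hcov z.2.1)
  obtain ⟨⟨z, hz⟩, hzi⟩ := hn
  rw [mem_interior_iff_mem_nhds, Metric.mem_nhds_iff] at hzi
  obtain ⟨ε, hε, hball⟩ := hzi
  have hsub : ∀ r ∈ Z, |r - z| < ε → r ∈ Cn n := fun r hr hrz =>
    hball (show (⟨r, hr⟩ : Z) ∈ Metric.ball _ ε from by rw [Metric.mem_ball, Subtype.dist_eq, Real.dist_eq]; exact hrz)
  have hs0 : ∃ s0 ∈ Set.Icc α β, z - ε < s0 ∧ s0 ≤ z ∧ ∀ᶠ r in 𝓝[Set.Icc α β] z, s0 ≤ r := by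
    rcases hz.1.1.eq_or_lt with h | h
    · exact ⟨α, ⟨le_rfl, h ▸ hz.1.2⟩, by linarith, h.le, by filter_upwards [self_mem_nhdsWithin] with r hr using hr.1⟩
    · have hm : max α (z - ε / 2) < z := max_lt h (by linarith)
      refine ⟨max α (z - ε / 2), ⟨le_max_left _ _, hm.le.trans hz.1.2⟩, lt_of_lt_of_le (by linarith) (le_max_right _ _), hm.le, ?_⟩
      exact mem_nhdsWithin_of_mem_nhds (Ici_mem_nhds hm)
  obtain ⟨s0, hs0I, hs0z, hs0le, hs0ev⟩ := hs0
  obtain ⟨m, hm⟩ := Set.mem_iUnion.1 (hcov hs0I)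
  set N := max n m
  obtain ⟨M, hM1, hM2⟩ := H N
  apply hz.2
  refine ⟨M, ?_⟩
  have hev2 : ∀ᶠ r in 𝓝[Set.Icc α β] z, r < z + ε := mem_nhdsWithin_of_mem_nhds (Iio_mem_nhds (by linarith))
  filter_upwards [hs0ev, hev2, self_mem_nhdsWithin] with r hr1 hr2 hrI
  have hZs : ∀ x ∈ Z, s0 ≤ x → x ≤ r → x ∈ Cn N := fun x hx h1 h2 =>
    hmono (le_max_left n m) (hsub x hx (abs_lt.2 ⟨by linarith, by linarith⟩))
  have hs0N : s0 ∈ Cn N := hmono (le_max_right n m) hm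
  set K : Set ℝ := (Z ∩ Set.Icc s0 r) ∪ {s0} with hK
  have hKc : IsCompact K := (isCompact_Icc.inter_left hZcl).union isCompact_singleton
  have hKne : K.Nonempty := ⟨s0, Or.inr rfl⟩
  have haK : sSup K ∈ K := hKc.sSup_mem hKne
  set a := sSup K
  have hKr : ∀ x ∈ K, s0 ≤ x ∧ x ≤ r ∧ x ∈ Cn N := by
    rintro x (⟨hx, hx2⟩ | hx)
    · exact ⟨hx2.1, hx2.2, hZs x hx hx2.1 hx2.2⟩
    · rw [Set.mem_singleton_iff] at hx; subst hx; exact ⟨le_rfl, hr1, hs0N⟩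
  obtain ⟨ha1, ha2, ha3⟩ := hKr a haK
  rcases ha2.eq_or_lt with h | h
  · exact hM1 r (h ▸ ha3) hrI
  · refine hM2 a r ha3 (hs0I.1.trans ha1) h hrI.2 fun s1 h1 h2 => ?_
    refine hcomp _ isCompact_Icc (fun x hx => ⟨(hs0I.1.trans ha1).trans (h1.le.trans hx.1), hx.2.trans hrI.2⟩) fun x hx => ?_
    by_contra hx'
    have hxZ : x ∈ Z := ⟨⟨(hs0I.1.trans ha1).trans (h1.le.trans hx.1), hx.2.trans hrI.2⟩, hx'⟩
    have : x ≤ a := le_csSup hKc.bddAbove (Or.inl ⟨hxZ, ha1.trans (h1.le.trans hx.1), hx.2⟩)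
    linarith [hx.1]

end NSE


namespace NSE
open SchwartzMap LineDeriv FourierTransform
open scoped SchwartzMap ENNReal NNReal ContDiff

noncomputable def xW (W : E3 → ℝ) (ξ : E3) : ℝ := W ξ * ‖ξ‖ ^ 2
lemma wt_xW {W : E3 → ℝ} (hW : Wt W) : Wt (xW W) := wt_mul hW wt_nsq
def w1 (_ : E3) : ℝ := 1
lemma wt_w1 : Wt w1 := wt_one

lemma n1_w1 (f : SC) : n1 w1 f = ∫ x, ‖f x‖ ^ 2 := by
  rw [← parseval]; simp [n1, w1]

lemma n1_xw1 (f : SC) : ∫ x, ∑ i, ‖DD i f x‖ ^ 2 = 4 * π ^ 2 * n1 (xW w1) f := by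
  rw [integral_finsetSum _ fun i _ => int_pow (DD i f) 2 (by norm_num)]
  rw [Finset.sum_congr rfl fun i _ => (parseval (DD i f)).symm]
  rw [← integral_finsetSum _ fun i _ => int_pow (ft (DD i f)) 2 (by norm_num), n1, ← integral_const_mul]
  congr 1; funext ξ; rw [sum_DD_sq, xW, w1]; ring

noncomputable def n3 (f : SC) : ℝ := (∫ x, ‖f x‖ ^ 3) ^ ((1:ℝ) / 3)
lemma n3_nonneg (f : SC) : 0 ≤ n3 f := Real.rpow_nonneg (integral_nonneg fun x => by positivity) _
lemma n3_cube (f : SC) : n3 f ^ 3 = ∫ x, ‖f x‖ ^ 3 := by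
  have h : 0 ≤ ∫ x, ‖f x‖ ^ 3 := integral_nonneg fun x => by positivity
  rw [n3, ← Real.rpow_natCast, ← Real.rpow_mul h]; norm_num

lemma int3 (f g h : SC) : Integrable (fun x => ‖f x‖ * (‖g x‖ * ‖h x‖)) := by
  have := (int_mul f (prodS g h)).norm
  simpa [prodS_apply] using this

/-- Hölder 3/2, 3 -/
lemma hold23 (g h : SC) : ∫ x, ‖g x‖ ^ 2 * ‖h x‖ ^ 2 ≤ n3 g ^ 2 * (∫ x, ‖h x‖ ^ 6) ^ ((1:ℝ) / 3) := by
  have hpq : Real.HolderConjugate (3 / 2 : ℝ) 3 := by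
    rw [Real.holderConjugate_iff]; norm_num
  have mem : ∀ (f : SC) (p : ℝ), 1 ≤ p → MemLp (fun x => ‖f x‖ ^ 2) (ENNReal.ofReal p) volume := by
    intro f p hp
    have h1 : MemLp (fun x => ‖prodS f f x‖) (ENNReal.ofReal p) volume := ((prodS f f).memLp _ volume).norm
    refine h1.congr_norm ?_ ?_
    · exact (f.continuous.norm.pow 2).aestronglyMeasurable
    · exact Filter.Eventually.of_forall fun x => by simp [prodS_apply, sq]
  have := integral_mul_le_Lp_mul_Lq_of_nonneg (μ := volume) hpq (f := fun x => ‖g x‖ ^ 2) (g := fun x => ‖h x‖ ^ 2)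
    (Filter.Eventually.of_forall fun x => by positivity) (Filter.Eventually.of_forall fun x => by positivity)
    (mem g _ (by norm_num)) (mem h _ (by norm_num))
  refine this.trans (le_of_eq ?_)
  have e1 : ∀ x, (‖g x‖ ^ 2) ^ (3 / 2 : ℝ) = ‖g x‖ ^ 3 := fun x => by
    rw [← Real.rpow_natCast, ← Real.rpow_natCast, ← Real.rpow_mul (norm_nonneg _)]; norm_num
  have e2 : ∀ x, (‖h x‖ ^ 2) ^ (3 : ℝ) = ‖h x‖ ^ 6 := fun x => by
    rw [← Real.rpow_natCast, ← Real.rpow_natCast, ← Real.rpow_mul (norm_nonneg _)]; norm_num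
  simp only [e1, e2]
  congr 1
  rw [n3, ← Real.rpow_natCast, ← Real.rpow_mul (integral_nonneg fun x => by positivity)]
  norm_num

lemma tri236 : ∃ C : ℝ, 0 < C ∧ ∀ f g h : SC, ∫ x, ‖f x‖ * (‖g x‖ * ‖h x‖) ≤ C * √(n1 w1 f) * n3 g * √(n1 (xW w1) h) := by
  obtain ⟨C, hC, hS⟩ := sobolev6
  refine ⟨√(C ^ ((1:ℝ) / 3) * (4 * π ^ 2)), by positivity, fun f g h => ?_⟩
  have hh : 0 ≤ n1 (xW w1) h := n1_nonneg (wt_xW wt_w1) h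
  have h6 : (∫ x, ‖h x‖ ^ 6) ^ ((1:ℝ) / 3) ≤ C ^ ((1:ℝ) / 3) * (4 * π ^ 2) * n1 (xW w1) h := by
    have := Real.rpow_le_rpow (integral_nonneg fun x => by positivity) (hS h) (show (0:ℝ) ≤ 1 / 3 by norm_num)
    refine this.trans (le_of_eq ?_)
    rw [n1_xw1, Real.mul_rpow hC.le (by positivity), ← Real.rpow_natCast, ← Real.rpow_mul (by positivity)]
    norm_num; ring
  have ep : (fun x => (‖g x‖ * ‖h x‖) ^ 2) = fun x => ‖prodS g h x‖ ^ 2 := by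
    funext x; rw [prodS_apply, norm_mul]
  obtain ⟨hi, hc⟩ := cs (f := fun x => ‖f x‖) (g := fun x => ‖g x‖ * ‖h x‖) f.continuous.norm.aestronglyMeasurable
    (g.continuous.norm.mul h.continuous.norm).aestronglyMeasurable (int_pow f 2 (by norm_num)) (by
      rw [ep]; exact int_pow (prodS g h) 2 (by norm_num))
  have e : ∫ x, ‖f x‖ * (‖g x‖ * ‖h x‖) = ∫ x, |‖f x‖ * (‖g x‖ * ‖h x‖)| := by
    congr 1; funext x; rw [abs_of_nonneg (by positivity)]
  rw [e]; refine hc.trans ?_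
  rw [← n1_w1]
  have h7 : ∫ x, (‖g x‖ * ‖h x‖) ^ 2 ≤ n3 g ^ 2 * (C ^ ((1:ℝ) / 3) * (4 * π ^ 2) * n1 (xW w1) h) := by
    simp only [mul_pow]
    refine (hold23 g h).trans ?_
    gcongr
  calc _ ≤ √(n1 w1 f) * √(n3 g ^ 2 * (C ^ ((1:ℝ) / 3) * (4 * π ^ 2) * n1 (xW w1) h)) := by gcongr
    _ = _ := by
      rw [Real.sqrt_mul (by positivity), Real.sqrt_sq (n3_nonneg g), Real.sqrt_mul (by positivity)]; ring

lemma n3_interp : ∃ C : ℝ, 0 < C ∧ ∀ f : SC, n3 f ^ 2 ≤ C * (√(n1 w1 f) * √(n1 (xW w1) f)) := by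
  obtain ⟨C, hC, h⟩ := tri236
  refine ⟨C, hC, fun f => ?_⟩
  have h1 := h f f f
  have e : (fun x => ‖f x‖ * (‖f x‖ * ‖f x‖)) = fun x => ‖f x‖ ^ 3 := by funext x; ring
  rw [e, ← n3_cube] at h1
  rcases (n3_nonneg f).eq_or_lt with h0 | h0
  · rw [← h0]; have : 0 ≤ C * (√(n1 w1 f) * √(n1 (xW w1) f)) := by positivity
    simpa using this
  · have : n3 f * n3 f ^ 2 ≤ n3 f * (C * (√(n1 w1 f) * √(n1 (xW w1) f))) := by
      calc _ = n3 f ^ 3 := by ring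
        _ ≤ _ := h1
        _ = _ := by ring
    exact le_of_mul_le_mul_left this h0

/-- Hölder 3,3,3 -/
lemma tri333 (f g h : SC) : ∫ x, ‖f x‖ * (‖g x‖ * ‖h x‖) ≤ n3 f * n3 g * n3 h := by
  have hpq : Real.HolderConjugate (3 : ℝ) (3 / 2) := by
    rw [Real.holderConjugate_iff]; norm_num
  have h1 := integral_mul_le_Lp_mul_Lq_of_nonneg (μ := volume) hpq (f := fun x => ‖f x‖) (g := fun x => ‖g x‖ * ‖h x‖)
    (Filter.Eventually.of_forall fun x => by positivity) (Filter.Eventually.of_forall fun x => by positivity)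
    ((f.memLp _ volume).norm) (by
      have h1 : MemLp (fun x => ‖prodS g h x‖) (ENNReal.ofReal (3/2)) volume := ((prodS g h).memLp _ volume).norm
      simpa [prodS_apply] using h1)
  have h2 : 0 ≤ ∫ x, (‖g x‖ * ‖h x‖) ^ (3 / 2 : ℝ) := integral_nonneg fun x => by positivity
  have e1 : ∀ x, ‖f x‖ ^ (3 : ℝ) = ‖f x‖ ^ 3 := fun x => by
    rw [← Real.rpow_natCast]; norm_num
  simp only [e1] at h1
  refine h1.trans ?_
  have h3 : (∫ x, (‖g x‖ * ‖h x‖) ^ (3 / 2 : ℝ)) ≤ √(∫ x, ‖g x‖ ^ 3) * √(∫ x, ‖h x‖ ^ 3) := by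
    have e2 : ∀ (g : SC), (fun x => (‖g x‖ ^ (3 / 2 : ℝ)) ^ 2) = fun x => ‖g x‖ ^ 3 := fun g => by
      funext x; rw [← Real.rpow_natCast, ← Real.rpow_mul (norm_nonneg _), ← Real.rpow_natCast]; norm_num
    have hm : ∀ g : SC, AEStronglyMeasurable (fun x => ‖g x‖ ^ (3 / 2 : ℝ)) volume := fun g =>
      (g.continuous.norm.rpow_const fun x => Or.inr (by norm_num)).aestronglyMeasurable
    obtain ⟨_, hc⟩ := cs (f := fun x => ‖g x‖ ^ (3 / 2 : ℝ)) (g := fun x => ‖h x‖ ^ (3 / 2 : ℝ)) (hm g) (hm h)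
      (by rw [e2]; exact int_pow g 3 (by norm_num)) (by rw [e2]; exact int_pow h 3 (by norm_num))
    rw [e2, e2] at hc
    refine le_trans (le_of_eq ?_) hc
    congr 1; funext x
    rw [Real.mul_rpow (norm_nonneg _) (norm_nonneg _), abs_of_nonneg (by positivity)]
  have h4 := Real.rpow_le_rpow h2 h3 (show (0:ℝ) ≤ 1 / (3 / 2) by norm_num)
  have ig : ∀ g : SC, 0 ≤ ∫ x, ‖g x‖ ^ 3 := fun g => integral_nonneg fun x => by positivity
  have e3 : (√(∫ x, ‖g x‖ ^ 3) * √(∫ x, ‖h x‖ ^ 3)) ^ (1 / (3 / 2) : ℝ) = n3 g * n3 h := by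
    rw [Real.mul_rpow (by positivity) (by positivity), Real.sqrt_eq_rpow, Real.sqrt_eq_rpow, ← Real.rpow_mul (ig g), ← Real.rpow_mul (ig h), n3, n3]
    norm_num
  rw [e3] at h4
  calc _ ≤ n3 f * (n3 g * n3 h) := mul_le_mul_of_nonneg_left h4 (n3_nonneg f)
    _ = _ := by ring

lemma IsR.DD {f : SC} (hf : IsR f) (i : Fin 3) : IsR (DD i f) := by
  intro x
  rw [DD_apply]
  have h1 : HasFDerivAt (fun y => (starRingEnd ℂ) (f y)) ((Complex.conjCLE : ℂ →L[ℝ] ℂ).comp (fderiv ℝ f x)) x :=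
    (Complex.conjCLE : ℂ →L[ℝ] ℂ).hasFDerivAt.comp x (f.differentiableAt.hasFDerivAt)
  have h2 : (fun y => (starRingEnd ℂ) (f y)) = f := funext hf
  rw [h2] at h1
  conv_rhs => rw [h1.fderiv]
  rfl

lemma fi_DD (i : Fin 3) (f : SC) (ξ : E3) : fi (DD i f) ξ = -((2 * π * Complex.I) * (ξ i : ℝ) * fi f ξ) := by
  rw [← ft_neg, ft_DD, ft_neg]; simp

lemma br_add (θ f g : VF) : br θ (f + g) = br θ f + br θ g := by
  have := br_sub θ (f + g) g
  rw [add_sub_cancel_right] at this; rw [this]; ring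

lemma br_lap {W : E3 → ℝ} (hW : Wt W) {f : VF} (hf : RV f) (ν : ℝ) :
    br (tst W f) (fun j => (ν : ℂ) • ∑ k, DD k (DD k (f j))) = ((-(4 * π ^ 2 * ν * nW (xW W) f) : ℝ) : ℂ) := by
  simp only [nW, br, Finset.mul_sum, ← Finset.sum_neg_distrib, Complex.ofReal_sum]
  refine Finset.sum_congr rfl fun j _ => ?_
  rw [n1, ← integral_const_mul, ← integral_neg, ← integral_complex_ofReal]
  congr 1; funext ξ
  rw [tst_apply hW, ft_smul, smul_apply, ft_sum, sum_apply']
  simp only [ft_DD]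
  have e : ∑ k, 2 * π * Complex.I * ((ξ k : ℝ) : ℂ) * (2 * π * Complex.I * ((ξ k : ℝ) : ℂ) * ft (f j) ξ) =
      -(4 * π ^ 2) * ((‖ξ‖ ^ 2 : ℝ) : ℂ) * ft (f j) ξ := by
    rw [EuclideanSpace.norm_sq_eq]
    simp only [Real.norm_eq_abs, sq_abs]
    push_cast
    rw [Finset.mul_sum, Finset.sum_mul]
    refine Finset.sum_congr rfl fun k _ => ?_
    linear_combination (4 * π ^ 2 * (ξ k : ℂ) ^ 2 * ft (f j) ξ) * Complex.I_sq
  rw [e, smul_eq_mul]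
  calc _ = -(4 * π ^ 2) * ν * W ξ * ((‖ξ‖ ^ 2 : ℝ) : ℂ) * (fi (f j) ξ * ft (f j) ξ) := by ring
    _ = _ := by rw [fi_mul_ft (hf j), xW]; push_cast; ring

noncomputable def dv (G : Fin 3 → Fin 3 → SC) : VF := fun j => ∑ k, DD k (G k j)

/-- bound by termwise estimates -/
lemma br_dv_le (θ : VF) (G : Fin 3 → Fin 3 → SC) {X : ℝ} (h : ∀ j k, ‖∫ ξ, θ j ξ * ft (DD k (G k j)) ξ‖ ≤ X) :
    ‖br θ (dv G)‖ ≤ 9 * X := by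
  have e : br θ (dv G) = ∑ j, ∑ k, ∫ ξ, θ j ξ * ft (DD k (G k j)) ξ := by
    unfold br dv
    refine Finset.sum_congr rfl fun j _ => ?_
    rw [← integral_finsetSum _ fun k _ => int_mul _ _]
    congr 1; funext ξ
    rw [ft_sum, sum_apply', Finset.mul_sum]
  rw [e]
  calc _ ≤ ∑ j : Fin 3, ∑ k : Fin 3, X := (norm_sum_le _ _).trans (Finset.sum_le_sum fun j _ =>
        (norm_sum_le _ _).trans (Finset.sum_le_sum fun k _ => h j k))
    _ = 9 * X := by simp; ring

lemma flux1 {W : E3 → ℝ} (hW : Wt W) {f : VF} (hf : RV f) (j k : Fin 3) (G : SC) :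
    ‖∫ ξ, tst W f j ξ * ft (DD k G) ξ‖ ≤ 2 * π * (√(nW (xW W) f) * √(n1 W G)) := by
  have e : ∫ ξ, tst W f j ξ * ft (DD k G) ξ = - ∫ ξ, mulS (fun ξ => (W ξ : ℂ)) (fi (DD k (f j))) ξ * ft G ξ := by
    rw [← integral_neg]; congr 1; funext ξ
    rw [tst_apply hW, mulS_apply (tg_ofReal hW.tg), ft_DD, fi_DD]; ring
  rw [e, norm_neg]
  refine (pair1 hW hW hW (fun ξ => by rw [sq]) G ((hf j).DD k)).trans ?_
  have h1 := n1_DD_le hW k (f j)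
  have h2 : n1 (fun ξ => W ξ * ‖ξ‖ ^ 2) (f j) ≤ nW (xW W) f := n1_le_nW (wt_xW hW) f j
  have : √(n1 W (DD k (f j))) ≤ 2 * π * √(nW (xW W) f) := by
    rw [show 2 * π * √(nW (xW W) f) = √(4 * π ^ 2 * nW (xW W) f) by
      rw [Real.sqrt_mul (by positivity), show 4 * π ^ 2 = (2 * π) ^ 2 by ring, Real.sqrt_sq (by positivity)]]
    apply Real.sqrt_le_sqrt
    refine h1.trans ?_; gcongr
  calc _ ≤ 2 * π * √(nW (xW W) f) * √(n1 W G) := by gcongr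
    _ = _ := by ring

noncomputable def psi (W : E3 → ℝ) (f : SC) : SC := ft (mulS (fun ξ => (W ξ : ℂ)) (fi f))

lemma flux2 (W : E3 → ℝ) (f : VF) (j k : Fin 3) (p q : SC) :
    ‖∫ ξ, tst W f j ξ * ft (DD k (prodS p q)) ξ‖ ≤ ∫ x, ‖DD k (psi W (f j)) x‖ * (‖p x‖ * ‖q x‖) := by
  rw [← int_ft_mul]
  have := ibp (psi W (f j)) (prodS p q) k
  unfold psi at this ⊢
  unfold tst
  rw [this, norm_neg]
  refine (norm_integral_le_integral_norm _).trans (le_of_eq ?_)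
  congr 1; funext x; rw [norm_mul, prodS_apply, norm_mul]

lemma n1_psi {W V : E3 → ℝ} (hW : Wt W) (hV : ∀ ξ, V (-ξ) = V ξ) {f : SC} (hf : IsR f) :
    n1 V (psi W f) = n1 (fun ξ => V ξ * W ξ ^ 2) f := by
  unfold n1
  rw [← integral_neg_eq_self]
  congr 1; funext ξ
  rw [hV, psi, ft_neg, fi_ft, mulS_apply (tg_ofReal hW.tg), norm_mul, norm_fi hf, Complex.norm_real, mul_pow, Real.norm_eq_abs, sq_abs]
  ring

lemma n1_DD_w1 (i : Fin 3) (f : SC) : n1 w1 (DD i f) ≤ 4 * π ^ 2 * n1 (xW w1) f := n1_DD_le wt_w1 i f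
lemma n1_DD_xw1 (i : Fin 3) (f : SC) : n1 (xW w1) (DD i f) ≤ 4 * π ^ 2 * n1 (xW (xW w1)) f := n1_DD_le (wt_xW wt_w1) i f

end NSE


namespace NSE
open SchwartzMap LineDeriv FourierTransform
open scoped SchwartzMap ENNReal NNReal ContDiff
open Filter Topology

noncomputable def rW (ξ : E3) : ℝ := (1 + ‖ξ‖ ^ 2)⁻¹
lemma wt_rW : Wt rW := ⟨by have := tg_resolvent 1; simp only [one_pow, one_mul] at this; exact this, fun ξ => by unfold rW; positivity⟩
lemma rW_le (ξ : E3) : rW ξ ≤ 1 := inv_le_one_of_one_le₀ (by nlinarith [sq_nonneg ‖ξ‖])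
lemma xrW_le (ξ : E3) : rW ξ * ‖ξ‖ ^ 2 ≤ 1 := by
  unfold rW; rw [inv_mul_le_one₀ (by positivity)]; linarith

lemma exists_cut : ∃ X : ℕ → E3 → ℝ, (∀ n, Wt (X n)) ∧ (∀ n ξ, X n ξ ≤ 1) ∧
    (∀ n, ∃ R, 0 ≤ R ∧ ∀ ξ, X n ξ * ‖ξ‖ ^ 2 ≤ R * X n ξ) ∧ ∀ ξ, ∀ᶠ n in atTop, X n ξ = 1 := by
  obtain ⟨χ, h1, h2, h3, h4⟩ := exists_bump
  obtain ⟨c, hc0, hc1, hc2⟩ := exists_seq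
  have hcs : ∀ n, HasCompactSupport (fun x : E3 => χ (c n • x)) := fun n =>
    h2.comp_homeomorph (Homeomorph.smulOfNeZero (c n) (hc0 n).ne')
  have hcd : ∀ n, ContDiff ℝ ∞ (fun x : E3 => χ (c n • x)) := fun n => h1.comp (contDiff_const_smul (c n))
  refine ⟨fun n ξ => χ (c n • ξ), fun n => ⟨?_, fun ξ => (h3 _).1⟩, fun n ξ => (h3 _).2, fun n => ?_, fun ξ => ?_⟩
  · exact ((hcs n).toSchwartzMap (hcd n)).hasTemperateGrowth
  · obtain ⟨R, hR⟩ := (hcs n).isCompact.isBounded.exists_norm_le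
    refine ⟨R ^ 2, by positivity, fun ξ => ?_⟩
    by_cases h : χ (c n • ξ) = 0
    · simp [h]
    · have hm : ξ ∈ tsupport (fun x : E3 => χ (c n • x)) := subset_tsupport _ h
      have := hR ξ hm
      have h5 := (h3 (c n • ξ)).1
      rw [mul_comm]
      gcongr
  · obtain ⟨N, hN⟩ := exists_nat_ge ‖ξ‖
    filter_upwards [eventually_ge_atTop N] with n hn
    apply h4
    rw [norm_smul, Real.norm_eq_abs, abs_of_pos (hc0 n)]
    exact hc1 n _ (hN.trans (by exact_mod_cast hn))

lemma nW_lim {X : ℕ → E3 → ℝ} {W : E3 → ℝ} (hX : ∀ n, Wt (X n)) (hW : Wt W) (hle : ∀ n ξ, X n ξ ≤ W ξ)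
    (hlim : ∀ ξ, Tendsto (fun n => X n ξ) atTop (𝓝 (W ξ))) {f : VF} {M : ℝ} (hM : ∀ n, nW (X n) f ≤ M) : nW W f ≤ M := by
  have : Tendsto (fun n => nW (X n) f) atTop (𝓝 (nW W f)) := by
    refine tendsto_finsetSum _ fun j _ => ?_
    refine tendsto_integral_of_dominated_convergence (fun ξ => W ξ * ‖ft (f j) ξ‖ ^ 2)
      (fun n => (int_sq _ _ (hX n).tg).aestronglyMeasurable) (int_sq _ _ hW.tg) (fun n => Eventually.of_forall fun ξ => ?_)
      (Eventually.of_forall fun ξ => (hlim ξ).mul_const _)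
    have := (hX n).nn ξ
    rw [Real.norm_eq_abs, abs_of_nonneg (by positivity)]
    gcongr; exact hle n ξ
  exact le_of_tendsto' this hM

/-! decompositions of the right-hand side -/
noncomputable def lap (ν : ℝ) (f : VF) : VF := fun j => (ν : ℂ) • ∑ k, DD k (DD k (f j))

lemma ft_lap (ν : ℝ) (f : VF) (j : Fin 3) (ξ : E3) : ft (lap ν f j) ξ = -(4 * π ^ 2 * ν * ((‖ξ‖ ^ 2 : ℝ) : ℂ) * ft (f j) ξ) := by
  rw [lap, ft_smul, smul_apply, ft_sum, sum_apply']
  simp only [ft_DD]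
  rw [EuclideanSpace.norm_sq_eq]
  simp only [Real.norm_eq_abs, sq_abs, smul_eq_mul]
  push_cast
  rw [Finset.mul_sum, Finset.mul_sum, Finset.sum_mul, ← Finset.sum_neg_distrib]
  refine Finset.sum_congr rfl fun k _ => ?_
  linear_combination (4 * π ^ 2 * ν * (ξ k : ℂ) ^ 2 * ft (f j) ξ) * Complex.I_sq

lemma nW_lap (W : E3 → ℝ) (ν : ℝ) (f : VF) : nW W (lap ν f) = (4 * π ^ 2 * ν) ^ 2 * nW (xW (xW W)) f := by
  simp only [nW, Finset.mul_sum]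
  refine Finset.sum_congr rfl fun j _ => ?_
  rw [n1, n1, ← integral_const_mul]
  congr 1; funext ξ
  have : ‖ft (lap ν f j) ξ‖ ^ 2 = (4 * π ^ 2 * ν) ^ 2 * (‖ξ‖ ^ 2) ^ 2 * ‖ft (f j) ξ‖ ^ 2 := by
    rw [ft_lap, norm_neg, norm_mul, mul_pow]
    congr 1
    rw [show (4 * π ^ 2 * ν * ((‖ξ‖ ^ 2 : ℝ) : ℂ) : ℂ) = ((4 * π ^ 2 * ν * ‖ξ‖ ^ 2 : ℝ) : ℂ) by push_cast; ring,
      Complex.norm_real, Real.norm_eq_abs, sq_abs, mul_pow]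
  rw [this, xW, xW]; ring

lemma FF_dec1 (ν : ℝ) (u A : VF) : FF ν u = lap ν (u - A) + lap ν A - dv (fun k j => prodS (u k) (u j)) := by
  funext j
  simp only [FF, lap, dv, Pi.add_apply, Pi.sub_apply, DD_sub, Finset.sum_sub_distrib, smul_sub]
  abel

lemma FF_dec2 (ν : ℝ) (u A : VF) : FF ν u = lap ν (u - A) + FF ν A -
    dv (fun k j => prodS ((u - A) k) ((u - A) j) + (prodS ((u - A) k) (A j) + prodS (A k) ((u - A) j))) := by
  have e : ∀ k j, prodS ((u - A) k) ((u - A) j) + (prodS ((u - A) k) (A j) + prodS (A k) ((u - A) j)) = prodS (u k) (u j) - prodS (A k) (A j) := by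
    intro k j; ext x; simp only [add_apply, sub_apply, prodS_apply, Pi.sub_apply]; ring
  funext j
  simp only [e]
  simp only [FF, lap, dv, Pi.add_apply, Pi.sub_apply, DD_sub, Finset.sum_sub_distrib, smul_sub]
  abel

lemma lap_zero (ν : ℝ) : lap ν 0 = 0 := by
  funext j; simp [lap, DD_zero]

lemma br_est {W : E3 → ℝ} (hW : Wt W) {ν : ℝ} {w : VF} (hw : RV w) (R D : VF) :
    |(br (tst W w) (lap ν w + R - D)).re + 4 * π ^ 2 * ν * nW (xW W) w| ≤ ‖br (tst W w) R‖ + ‖br (tst W w) D‖ := by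
  have h : br (tst W w) (lap ν w) = ((-(4 * π ^ 2 * ν * nW (xW W) w) : ℝ) : ℂ) := br_lap hW hw ν
  rw [br_sub, br_add, h]
  have : ((((-(4 * π ^ 2 * ν * nW (xW W) w) : ℝ) : ℂ) + br (tst W w) R - br (tst W w) D).re + 4 * π ^ 2 * ν * nW (xW W) w) =
    (br (tst W w) R - br (tst W w) D).re := by
    simp only [Complex.add_re, Complex.sub_re, Complex.ofReal_re]; ring
  rw [this]
  exact (Complex.abs_re_le_norm _).trans (norm_sub_le _ _)

/-- the `L³` estimate at negative level, test field arbitrary -/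
lemma neg_est : ∃ C : ℝ, 0 < C ∧ ∀ (W : E3 → ℝ), Wt W → (∀ ξ, W ξ * ‖ξ‖ ^ 2 ≤ 1) → ∀ (w u : VF), RV w → ∀ K : ℝ,
    (∀ k, n3 (u k) ≤ K) → ‖br (tst W w) (dv (fun k j => prodS (u k) (u j)))‖ ≤
      C * K ^ 2 * √(√(nW W w) * √(nW (xW W) w)) := by
  obtain ⟨C, hC, hI⟩ := n3_interp
  refine ⟨9 * √(C * (4 * π ^ 2)), by positivity, fun W hW hx w u hw K hK => ?_⟩
  have hK0 : 0 ≤ K := (n3_nonneg (u 0)).trans (hK 0)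
  rw [show 9 * √(C * (4 * π ^ 2)) * K ^ 2 * √(√(nW W w) * √(nW (xW W) w)) =
    9 * (√(C * (4 * π ^ 2) * (√(nW W w) * √(nW (xW W) w))) * K * K) by rw [Real.sqrt_mul (x := C * (4 * π ^ 2)) (by positivity)]; ring]
  refine br_dv_le _ _ fun j k => ?_
  refine (flux2 W w j k _ _).trans ((tri333 _ _ _).trans ?_)
  have h1 : n3 (DD k (psi W (w j))) ≤ √(C * (4 * π ^ 2) * (√(nW W w) * √(nW (xW W) w))) := by
    apply Real.le_sqrt_of_sq_le
    refine (hI _).trans ?_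
    have hsq : √(4 * π ^ 2) * √(4 * π ^ 2) = 4 * π ^ 2 := Real.mul_self_sqrt (by positivity)
    have a1 : n1 w1 (DD k (psi W (w j))) ≤ 4 * π ^ 2 * nW W w := by
      refine (n1_DD_w1 k _).trans ?_
      rw [n1_psi hW (fun ξ => by simp [xW, w1]) (hw j)]
      have : n1 (fun ξ => xW w1 ξ * W ξ ^ 2) (w j) ≤ 1 * n1 W (w j) := n1_mono (by
        simpa only [sq] using wt_mul (wt_xW wt_w1) (wt_mul hW hW)) hW (fun ξ => by
          have := hW.nn ξ; have := hx ξ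
          simp only [xW, w1]; nlinarith) _
      have := n1_le_nW hW w j
      gcongr; linarith
    have a2 : n1 (xW w1) (DD k (psi W (w j))) ≤ 4 * π ^ 2 * nW (xW W) w := by
      refine (n1_DD_xw1 k _).trans ?_
      rw [n1_psi hW (fun ξ => by simp [xW, w1]) (hw j)]
      have : n1 (fun ξ => xW (xW w1) ξ * W ξ ^ 2) (w j) ≤ 1 * n1 (xW W) (w j) := n1_mono (by
        simpa only [sq] using wt_mul (wt_xW (wt_xW wt_w1)) (wt_mul hW hW)) (wt_xW hW) (fun ξ => by
          have := hW.nn ξ; have := hx ξ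
          simp only [xW, w1]
          have : 0 ≤ W ξ * ‖ξ‖ ^ 2 := by positivity
          nlinarith) _
      have := n1_le_nW (wt_xW hW) w j
      gcongr; linarith
    calc C * (√(n1 w1 (DD k (psi W (w j)))) * √(n1 (xW w1) (DD k (psi W (w j)))))
        ≤ C * (√(4 * π ^ 2 * nW W w) * √(4 * π ^ 2 * nW (xW W) w)) := by gcongr
      _ = C * ((√(4 * π ^ 2) * √(4 * π ^ 2)) * (√(nW W w) * √(nW (xW W) w))) := by
        rw [Real.sqrt_mul (x := 4 * π ^ 2) (by positivity) (nW W w), Real.sqrt_mul (x := 4 * π ^ 2) (by positivity) (nW (xW W) w)]; ring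
      _ = _ := by rw [hsq]; ring
  have := n3_nonneg (u k); have := n3_nonneg (u j)
  gcongr
  · exact hK k
  · exact hK j

/-! real-variable facts -/
lemma small1 (A B : ℝ) {ε : ℝ} (hε : 0 < ε) : ∃ δ > 0, δ ≤ 1 ∧ ∀ g, g < δ → 0 ≤ g → A * √g + B * √(√g) ≤ ε := by
  have hc : Continuous (fun g : ℝ => A * √g + B * √(√g)) := by fun_prop
  have h0 : ∀ᶠ g in 𝓝 (0:ℝ), A * √g + B * √(√g) < ε := by
    apply hc.continuousAt.eventually_lt continuousAt_const
    simpa using hε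
  obtain ⟨δ, hδ, h⟩ := Metric.eventually_nhds_iff.1 h0
  refine ⟨min δ 1, lt_min hδ one_pos, min_le_right _ _, fun g hg hg0 => (h ?_).le⟩
  rw [Real.dist_eq, sub_zero, abs_of_nonneg hg0]; exact hg.trans_le (min_le_left _ _)

lemma quart (B : ℝ) {c : ℝ} (hB : 0 ≤ B) (hc : 0 < c) : ∃ C, 0 ≤ C ∧ ∀ d, 0 ≤ d → B * √(√d) ≤ C + c * d := by
  set t0 := max 1 (B / c) with ht0
  refine ⟨B * t0, by positivity, fun d hd => ?_⟩
  set t := √(√d) with ht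
  have h4 : d = t ^ 4 := by
    rw [show t ^ 4 = (t ^ 2) ^ 2 by ring, ht, Real.sq_sqrt (Real.sqrt_nonneg _), Real.sq_sqrt hd]
  have ht' : 0 ≤ t := Real.sqrt_nonneg _
  rcases le_total t t0 with h | h
  · have : 0 ≤ c * d := by positivity
    have : B * t ≤ B * t0 := by gcongr
    linarith
  · have h1 : 1 ≤ t := (le_max_left _ _).trans h
    have h2 : B / c ≤ t := (le_max_right _ _).trans h
    rw [div_le_iff₀ hc] at h2
    have h3 : t ≤ t ^ 3 := le_self_pow₀ h1 (by norm_num)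
    have : B * t ≤ c * d := by
      rw [h4]
      calc B * t ≤ (t ^ 3 * c) * t := by gcongr; nlinarith
        _ = _ := by ring
    have : 0 ≤ B * t0 := by positivity
    linarith

lemma sqrt_le_one_add {g : ℝ} (hg : 0 ≤ g) : √g ≤ 1 + g := by
  rw [Real.sqrt_le_left (by linarith)]; nlinarith
lemma qrt_le_one_add {g : ℝ} (hg : 0 ≤ g) : √(√g) ≤ 1 + g := by
  rw [Real.sqrt_le_left (by linarith)]
  have := sqrt_le_one_add hg; nlinarith

/-! gap structure -/
structure Gap (T ν : ℝ) (u : ℝ → VF) (a b : ℝ) : Prop where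
  S : Sol T ν u
  hν : 0 < ν
  h0 : 0 ≤ a
  hab : a < b
  hbT : b < T
  qb : ∀ s1, a < s1 → s1 < b → QB u (Set.Icc s1 b)

section

lemma Gap.ma {T ν : ℝ} {u : ℝ → VF} {a b : ℝ} (P : Gap T ν u a b) : a ∈ Set.Ico 0 T := ⟨P.h0, P.hab.trans P.hbT⟩
lemma Gap.mem {T ν : ℝ} {u : ℝ → VF} {a b : ℝ} (P : Gap T ν u a b) {s : ℝ} (hs : s ∈ Set.Ioc a b) : s ∈ Set.Ico 0 T := ⟨P.h0.trans hs.1.le, hs.2.trans_lt P.hbT⟩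
lemma Gap.sub {T ν : ℝ} {u : ℝ → VF} {a b : ℝ} (P : Gap T ν u a b) {s1 : ℝ} (h : a < s1) : Set.Icc s1 b ⊆ Set.Ico 0 T := fun _ hs => P.mem ⟨h.trans_le hs.1, hs.2⟩
lemma Gap.rw {T ν : ℝ} {u : ℝ → VF} {a b : ℝ} (P : Gap T ν u a b) (s) : RV (u s - u a) := (P.S.rv s).sub (P.S.rv a)
lemma Gap.dw {T ν : ℝ} {u : ℝ → VF} {a b : ℝ} (P : Gap T ν u a b) {s} (hs : s ∈ Set.Ioc a b) : dF (u s - u a) := dF.sub (P.S.div s (P.mem hs)) (P.S.div a P.ma)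

lemma Gap.deriv {T ν : ℝ} {u : ℝ → VF} {a b : ℝ} (P : Gap T ν u a b) {W : E3 → ℝ} (hW : Wt W) {c : ℝ} (hc : 0 ≤ c) (hWc : ∀ ξ, W ξ ≤ c * bW 6 ξ)
    {A : VF} (har : RV A) (had : dF A) {t : ℝ} (ht : t ∈ Set.Ioo a b) :
    HasDerivAt (fun s => nW W (u s - A)) (2 * (br (tst W (u t - A)) (FF ν (u t))).re) t := by
  have h1 : a < (a + t) / 2 := by linarith [ht.1]
  have h2 : (a + t) / 2 < t := by linarith [ht.1]
  exact (P.S.energy (P.sub h1) (P.qb _ h1 (h2.trans ht.2)) hW hc hWc har had ⟨h2.le, ht.2.le⟩).hasDerivAt (Icc_mem_nhds h2 ht.2)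

lemma Gap.cont {T ν : ℝ} {u : ℝ → VF} {a b : ℝ} (P : Gap T ν u a b) {W : E3 → ℝ} (hW : Wt W) {c : ℝ} (hc : 0 ≤ c) (hWc : ∀ ξ, W ξ ≤ c * bW 6 ξ)
    {A : VF} (har : RV A) (had : dF A) {s1 : ℝ} (h1 : a < s1) (h2 : s1 < b) :
    ContinuousOn (fun s => nW W (u s - A)) (Set.Icc s1 b) := fun t ht =>
  (P.S.energy (P.sub h1) (P.qb _ h1 h2) hW hc hWc har had ht).continuousWithinAt
end

lemma Sol.br_tendsto {T ν : ℝ} {u : ℝ → VF} (S : Sol T ν u) {a : ℝ} {l : Filter ℝ} [l.IsCountablyGenerated] (hl : l ≤ 𝓝 a)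
    {p : ℕ} (hp : 2 ≤ p) {B : ℝ} (hB : ∀ᶠ s in l, ∀ j, ∫ x, ‖u s j x‖ ^ p ≤ B) (θ : VF) :
    Tendsto (fun s => br θ (u s)) l (𝓝 (br θ (u a))) := by
  refine tendsto_finsetSum _ fun j _ => ?_
  simp_rw [← int_ft_mul]
  refine weakW (ft (θ j)) (fun s => u s j) (u a j) hp (fun x => ?_) (B := B) ?_
  · exact ((S.smooth j x).continuous.tendsto a).mono_left hl
  · filter_upwards [hB] with s hs using hs j

end NSE


namespace NSE
open SchwartzMap LineDeriv FourierTransform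
open scoped SchwartzMap ENNReal NNReal ContDiff
open Filter Topology

lemma nW_addW {W V : E3 → ℝ} (hW : Wt W) (hV : Wt V) (f : VF) : nW (fun ξ => W ξ + V ξ) f = nW W f + nW V f := by
  simp only [nW, n1, ← Finset.sum_add_distrib]
  refine Finset.sum_congr rfl fun j _ => ?_
  rw [← integral_add (int_sq _ _ hW.tg) (int_sq _ _ hV.tg)]
  congr 1; funext ξ; ring

lemma le_bW (m : ℕ) (ξ : E3) : 1 ≤ bW m ξ := by
  unfold bW; exact one_le_pow₀ (by nlinarith [sq_nonneg ‖ξ‖])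

lemma sqrt4 {g R : ℝ} (hg : 0 ≤ g) (hR : 0 ≤ R) : √(√g * √(R * g)) = √(√R) * √g := by
  rw [Real.sqrt_mul hR, show √g * (√R * √g) = √R * (√g * √g) by ring, Real.mul_self_sqrt hg, Real.sqrt_mul (Real.sqrt_nonneg _)]

section

lemma Gap.neg {T ν : ℝ} {u : ℝ → VF} {a b : ℝ} (P : Gap T ν u a b) {K : ℝ} (hK : ∀ s ∈ Set.Ioo a b, ∀ k, n3 (u s k) ≤ K) :
    ∃ A B : ℝ, 0 ≤ A ∧ 0 ≤ B ∧ ∀ W, Wt W → (∀ ξ, W ξ ≤ 1) → (∀ ξ, W ξ * ‖ξ‖ ^ 2 ≤ 1) → ∀ w, RV w → 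
      ‖br (tst W w) (lap ν (u a))‖ ≤ A * √(nW W w) ∧ 
      (∀ s ∈ Set.Ioo a b, ‖br (tst W w) (dv (fun k j => prodS (u s k) (u s j)))‖ ≤ B * √(√(nW W w) * √(nW (xW W) w))) := by
  obtain ⟨C, hC, h⟩ := neg_est
  refine ⟨√(nW w1 (lap ν (u a))), C * K ^ 2, by positivity, by positivity, fun W hW h1 hx w hw => ⟨?_, fun s hs => h W hW hx w (u s) hw K (hK s hs)⟩⟩
  refine (pair_le hW hW wt_w1 (fun ξ => by have := hW.nn ξ; have := h1 ξ; simp only [w1]; nlinarith) _ hw).trans ?_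
  rw [mul_comm]

lemma Gap.neg2 {T ν : ℝ} {u : ℝ → VF} {a b : ℝ} (P : Gap T ν u a b) {A B : ℝ} {W : E3 → ℝ} (hW : Wt W)
    (h : ∀ w, RV w → ‖br (tst W w) (lap ν (u a))‖ ≤ A * √(nW W w) ∧ 
      (∀ s ∈ Set.Ioo a b, ‖br (tst W w) (dv (fun k j => prodS (u s k) (u s j)))‖ ≤ B * √(√(nW W w) * √(nW (xW W) w))))
    {s : ℝ} (hs : s ∈ Set.Ioo a b) :
    |(br (tst W (u s - u a)) (FF ν (u s))).re + 4 * π ^ 2 * ν * nW (xW W) (u s - u a)| ≤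
     A * √(nW W (u s - u a)) + B * √(√(nW W (u s - u a)) * √(nW (xW W) (u s - u a))) := by
  rw [FF_dec1 ν (u s) (u a)]
  refine (br_est hW (P.rw s) _ _).trans (add_le_add (h _ (P.rw s)).1 ((h _ (P.rw s)).2 s hs))

lemma Gap.lowA {T ν : ℝ} {u : ℝ → VF} {a b : ℝ} (P : Gap T ν u a b) {K : ℝ} (hK : ∀ s ∈ Set.Ioo a b, ∀ k, n3 (u s k) ≤ K) {A B R : ℝ} (hA : 0 ≤ A) (hB : 0 ≤ B) (hR : 0 ≤ R) {W : E3 → ℝ} (hW : Wt W)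
    (hW1 : ∀ ξ, W ξ ≤ 1) (hWR : ∀ ξ, W ξ * ‖ξ‖ ^ 2 ≤ R * W ξ)
    (h : ∀ w, RV w → ‖br (tst W w) (lap ν (u a))‖ ≤ A * √(nW W w) ∧ 
      (∀ s ∈ Set.Ioo a b, ‖br (tst W w) (dv (fun k j => prodS (u s k) (u s j)))‖ ≤ B * √(√(nW W w) * √(nW (xW W) w)))) :
    LZ (fun s => nW W (u s - u a)) a := by
  have hν := P.hν
  have hdg : ∀ w : VF, nW (xW W) w ≤ R * nW W w := fun w => nW_mono (wt_xW hW) hW hWR w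
  have g0 : ∀ w : VF, 0 ≤ nW W w := nW_nonneg hW
  have hW6 : ∀ ξ, W ξ ≤ 1 * bW 6 ξ := fun ξ => by rw [one_mul]; exact (hW1 ξ).trans (le_bW 6 ξ)
  have hq : ∀ w : VF, B * √(√(nW W w) * √(nW (xW W) w)) ≤ B * √(√R) * √(nW W w) := fun w => by
    rw [mul_assoc, ← sqrt4 (g0 w) hR]
    have := hdg w
    gcongr
  set C1 := 8 * π ^ 2 * ν * R + 2 * A + 2 * (B * √(√R)) with hC1
  have hC10 : 0 ≤ C1 := by positivity
  set M := exp (C1 * (b - a)) * (1 + nW W (u b - u a)) with hM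
  have hM0 : 0 ≤ M := by have := g0 (u b - u a); positivity
  have hbd : ∀ s ∈ Set.Ioo a b, nW W (u s - u a) ≤ M := by
    intro s hs
    have := gron_bwd (g := fun s => nW W (u s - u a)) (g' := fun t => 2 * (br (tst W (u t - u a)) (FF ν (u t))).re) (C := C1) (K := 1) hs.2.le
      (P.cont hW zero_le_one hW6 (P.S.rv a) (P.S.div a P.ma) hs.1 hs.2)
      (fun t ht => P.deriv hW zero_le_one hW6 (P.S.rv a) (P.S.div a P.ma) ⟨hs.1.trans ht.1, ht.2⟩) (fun t ht => by
        have h2 := P.neg2 hW h ⟨hs.1.trans ht.1, ht.2⟩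
        have h3 := hq (u t - u a)
        have h4 := hdg (u t - u a)
        have h5 := g0 (u t - u a)
        have h6 := sqrt_le_one_add h5
        have h7 := (abs_le.1 h2).1
        have h8 : (A + B * √(√R)) * √(nW W (u t - u a)) ≤ (A + B * √(√R)) * (1 + nW W (u t - u a)) := by gcongr
        have h9 : 4 * π ^ 2 * ν * nW (xW W) (u t - u a) ≤ 4 * π ^ 2 * ν * (R * (1 + nW W (u t - u a))) := by
          gcongr; refine h4.trans ?_; gcongr; linarith
        rw [hC1]
        linarith)
    have h2 : exp (C1 * (b - s)) ≤ exp (C1 * (b - a)) := by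
      apply Real.exp_le_exp.2; have := hs.1; gcongr
    have h3 : exp (C1 * (b - s)) * (1 + nW W (u b - u a)) ≤ M := by
      rw [hM]; have := g0 (u b - u a); gcongr
    linarith
  set C2 := 4 * π ^ 2 * ν * R * √M + A + B * √(√R) with hC2
  have hC20 : 0 ≤ C2 := by positivity
  have key : ∀ s ∈ Set.Ioo a b, nW W (u s - u a) ≤ C2 * √(nW W (u s - u a)) * (s - a) := by
    intro s hs
    set w := u s - u a with hw
    have hwr : RV w := P.rw s
    have hder : ∀ r ∈ Set.Ioo a b, ‖br (tst W w) (FF ν (u r))‖ ≤ C2 * √(nW W w) := by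
      intro r hr
      rw [FF_dec1 ν (u r) (u a), br_sub, br_add]
      refine (norm_sub_le _ _).trans ((add_le_add (norm_add_le _ _) le_rfl).trans ?_)
      have e1 := (h w hwr).1
      have e2 := ((h w hwr).2 r hr).trans (hq w)
      have e3 : ‖br (tst W w) (lap ν (u r - u a))‖ ≤ √(nW W w) * (4 * π ^ 2 * ν * R * √M) := by
        refine (pair_le hW hW hW (fun ξ => by rw [sq]) _ hwr).trans ?_
        gcongr
        apply Real.sqrt_le_iff.2 ⟨by positivity, ?_⟩
        rw [nW_lap, show (4 * π ^ 2 * ν * R * √M) ^ 2 = (4 * π ^ 2 * ν) ^ 2 * (R ^ 2 * √M ^ 2) by ring, Real.sq_sqrt hM0]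
        gcongr
        refine (nW_mono (wt_xW (wt_xW hW)) hW (c := R ^ 2) (fun ξ => ?_) _).trans ?_
        · simp only [xW]
          have := hWR ξ
          nlinarith [sq_nonneg ‖ξ‖]
        · gcongr; exact hbd r hr
      rw [hC2]; linarith
    have hmv : ∀ r ∈ Set.Ioo a s, ‖br (tst W w) (u s) - br (tst W w) (u r)‖ ≤ C2 * √(nW W w) * (s - a) := by
      intro r hr
      have hsub : Set.Icc r s ⊆ Set.Icc r b := Set.Icc_subset_Icc_right hs.2.le
      have hQ : QB u (Set.Icc r s) := by
        obtain ⟨M, hM⟩ := P.qb r hr.1 (hr.2.trans hs.2)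
        exact ⟨M, fun t ht => hM t (hsub ht)⟩
      have := norm_image_sub_le_of_norm_deriv_le_segment' (f := fun t => br (tst W w) (u t)) (f' := fun t => br (tst W w) (FF ν (u t)))
        (a := r) (b := s) (C := C2 * √(nW W w)) (fun t ht => P.S.brderiv (hsub.trans (P.sub hr.1)) hQ (DF_tst hW (P.dw ⟨hs.1, hs.2.le⟩)) ht)
        (fun t ht => hder t ⟨hr.1.trans_le ht.1, ht.2.trans hs.2⟩) s ⟨hr.2.le, le_rfl⟩
      refine this.trans ?_
      have := hr.1
      gcongr
    have hlim : Tendsto (fun r => ‖br (tst W w) (u s) - br (tst W w) (u r)‖) (𝓝[>] a) (𝓝 ‖br (tst W w) (u s) - br (tst W w) (u a)‖) := by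
      refine (tendsto_const_nhds.sub (P.S.br_tendsto nhdsWithin_le_nhds (p := 3) (by norm_num) (B := K ^ 3) ?_ _)).norm
      filter_upwards [Ioo_mem_nhdsGT P.hab] with r hr j
      rw [← n3_cube]
      exact pow_le_pow_left₀ (n3_nonneg _) (hK r hr j) 3
    have hfin := le_of_tendsto hlim (by filter_upwards [Ioo_mem_nhdsGT hs.1] with r hr using hmv r hr)
    rw [← br_sub, ← hw, br_tst_self hW hwr, Complex.norm_real, Real.norm_eq_abs, abs_of_nonneg (g0 w)] at hfin
    exact hfin
  refine LZ.of_exists P.hab fun ε hε c hc hcb => ?_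
  have hc' : Continuous (fun s => C2 ^ 2 * (s - a) ^ 2) := by fun_prop
  have hev : ∀ᶠ s in 𝓝[>] a, C2 ^ 2 * (s - a) ^ 2 < ε := by
    apply nhdsWithin_le_nhds
    apply hc'.continuousAt.eventually_lt continuousAt_const
    simpa using hε
  obtain ⟨s, h1, h2⟩ := (hev.and (Ioo_mem_nhdsGT hc)).exists
  refine ⟨s, h2.1, h2.2, lt_of_le_of_lt ?_ h1⟩
  have k := key s ⟨h2.1, h2.2.trans hcb⟩
  set g := nW W (u s - u a)
  have hg : 0 ≤ g := g0 _
  have hs0 : 0 ≤ s - a := by linarith [h2.1]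
  have e1 : √g * √g = g := Real.mul_self_sqrt hg
  have e2 := Real.sqrt_nonneg g
  have e3 : √g ≤ C2 * (s - a) := by
    rcases e2.eq_or_lt with h | h
    · rw [← h]; positivity
    · by_contra hh
      push Not at hh
      nlinarith
  rw [← mul_pow, ← e1, ← sq]
  gcongr

/-- backward uniqueness-type identification of the initial datum in `L²` -/
lemma Gap.low {T ν : ℝ} {u : ℝ → VF} {a b : ℝ} (P : Gap T ν u a b) {K : ℝ} (hK : ∀ s ∈ Set.Ioo a b, ∀ k, n3 (u s k) ≤ K) : LZ (fun s => nW w1 (u s - u a)) a := by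
  have hν := P.hν
  obtain ⟨A, B, hA, hB, h⟩ := P.neg hK
  obtain ⟨X, hX, hX1, hXR, hXl⟩ := exists_cut
  have hWn : ∀ n, Wt (fun ξ => X n ξ * rW ξ) := fun n => wt_mul (hX n) wt_rW
  have hr0 := wt_rW.nn
  have hWr : ∀ n ξ, X n ξ * rW ξ ≤ rW ξ := fun n ξ => mul_le_of_le_one_left (hr0 ξ) (hX1 n ξ)
  have hWn1 : ∀ n ξ, X n ξ * rW ξ ≤ 1 := fun n ξ => (hWr n ξ).trans (rW_le ξ)
  have hWnx : ∀ n ξ, X n ξ * rW ξ * ‖ξ‖ ^ 2 ≤ 1 := fun n ξ => (mul_le_mul_of_nonneg_right (hWr n ξ) (sq_nonneg _)).trans (xrW_le ξ)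
  have c6 : ∀ {W : E3 → ℝ}, (∀ ξ, W ξ ≤ 1) → ∀ ξ, W ξ ≤ 1 * bW 6 ξ := fun h ξ => by rw [one_mul]; exact (h ξ).trans (le_bW 6 ξ)
  obtain ⟨Cq, hCq, hq⟩ := quart (2 * B) (c := 8 * π ^ 2 * ν) (by positivity) (by positivity)
  set C' := 2 * A + Cq + 1 with hC'
  have hC'0 : 0 < C' := by positivity
  have stepB : ∀ s ∈ Set.Ioo a b, C' * (s - a) < 1 → nW rW (u s - u a) ≤ C' * (s - a) := by
    intro s hs hs1
    refine nW_lim hWn wt_rW hWr (fun ξ => ?_) fun n => ?_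
    · refine tendsto_const_nhds.congr' ?_
      filter_upwards [hXl ξ] with n hn; rw [hn, one_mul]
    obtain ⟨R, hR, hXRn⟩ := hXR n
    have hz := P.lowA hK hA hB hR (hWn n) (hWn1 n) (fun ξ => by have := hXRn ξ; have := hr0 ξ; nlinarith) (h _ (hWn n) (hWn1 n) (hWnx n))
    refine ode_up (g' := fun t => 2 * (br (tst (fun ξ => X n ξ * rW ξ) (u t - u a)) (FF ν (u t))).re) (δ := 1) (ε := C')
      (fun t ht => P.deriv (hWn n) zero_le_one (c6 (hWn1 n)) (P.S.rv a) (P.S.div a P.ma) ht) (fun t ht hg => ?_) hC'0.le hz hs hs1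
    have h2 := (abs_le.1 (P.neg2 (hWn n) (h _ (hWn n) (hWn1 n) (hWnx n)) ht)).2
    set g := nW (fun ξ => X n ξ * rW ξ) (u t - u a)
    set d := nW (xW fun ξ => X n ξ * rW ξ) (u t - u a)
    have hd : 0 ≤ d := nW_nonneg (wt_xW (hWn n)) _
    have h3 : √g ≤ 1 := Real.sqrt_le_iff.2 ⟨zero_le_one, by linarith⟩
    have h4 : √(√g * √d) ≤ √(√d) := by apply Real.sqrt_le_sqrt; exact mul_le_of_le_one_left (Real.sqrt_nonneg _) h3
    have h5 := hq d hd
    have h6 : A * √g ≤ A := mul_le_of_le_one_right hA h3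
    have h7 : B * √(√g * √d) ≤ B * √(√d) := by gcongr
    rw [hC']; linarith
  have hz : LZ (fun s => nW rW (u s - u a)) a := by
    refine LZ.of_exists P.hab fun ε hε c hc hcb => ?_
    have hev : ∀ᶠ s in 𝓝[>] a, C' * (s - a) < min ε 1 := by
      apply nhdsWithin_le_nhds
      have hc' : Continuous (fun s => C' * (s - a)) := by fun_prop
      apply hc'.continuousAt.eventually_lt continuousAt_const
      simpa using hε
    obtain ⟨s, h1, h2⟩ := (hev.and (Ioo_mem_nhdsGT hc)).exists
    exact ⟨s, h2.1, h2.2, (stepB s ⟨h2.1, h2.2.trans hcb⟩ (h1.trans_le (min_le_right _ _))).trans_lt (h1.trans_le (min_le_left _ _))⟩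
  have hrr := h rW wt_rW rW_le xrW_le
  have hk : 0 < 4 * π ^ 2 * ν := by positivity
  obtain ⟨hT, hd⟩ := ode1 (d := fun s => 4 * π ^ 2 * ν * nW (xW rW) (u s - u a)) P.hab
    (fun t ht => P.deriv wt_rW zero_le_one (c6 rW_le) (P.S.rv a) (P.S.div a P.ma) ht) (fun s _ => nW_nonneg wt_rW _)
    (fun s _ => mul_nonneg hk.le (nW_nonneg (wt_xW wt_rW) _)) (fun ε hε => by
      obtain ⟨δ, hδ, hδ1, hsm⟩ := small1 (2 * A) (2 * B) (lt_min hε hk)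
      refine ⟨δ, hδ, fun s hs hg => ?_⟩
      have h2 := (abs_le.1 (P.neg2 wt_rW hrr hs)).2
      have hg0 : 0 ≤ nW rW (u s - u a) := nW_nonneg wt_rW _
      have hs' := hsm _ hg hg0
      have hd : 0 ≤ nW (xW rW) (u s - u a) := nW_nonneg (wt_xW wt_rW) _
      rw [Real.sqrt_mul (Real.sqrt_nonneg _)] at h2
      set g := nW rW (u s - u a)
      set d := nW (xW rW) (u s - u a)
      have h3 : B * (√(√g) * √(√d)) ≤ B * (√(√g) * (1 + d)) := by
        gcongr; exact qrt_le_one_add hd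
      have h4 : 0 ≤ A * √g := by positivity
      have h5 : 2 * B * √(√g) * d ≤ 4 * π ^ 2 * ν * d := by
        refine mul_le_mul_of_nonneg_right ?_ hd
        have := min_le_right ε (4 * π ^ 2 * ν); linarith
      have := min_le_left ε (4 * π ^ 2 * ν)
      linarith) hz
  intro ε hε
  have e1 : ∀ᶠ s in 𝓝[>] a, nW rW (u s - u a) < ε / 2 := hT.eventually_lt_const (half_pos hε)
  refine ((hd (4 * π ^ 2 * ν * (ε / 2)) (by positivity)).and_eventually e1).mono fun s hs => ?_
  have e2 : nW (xW rW) (u s - u a) < ε / 2 := lt_of_mul_lt_mul_left hs.1 hk.le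
  have e3 : nW w1 (u s - u a) = nW rW (u s - u a) + nW (xW rW) (u s - u a) := by
    rw [← nW_addW wt_rW (wt_xW wt_rW)]
    congr 1; funext ξ
    simp only [w1, xW, rW]; field_simp
  dsimp only
  rw [e3]; linarith [hs.2]
end

end NSE


namespace NSE
open SchwartzMap LineDeriv FourierTransform
open scoped SchwartzMap ENNReal NNReal ContDiff
open Filter Topology

lemma n1_prod_sup (f g : SC) : n1 w1 (prodS f g) ≤ A1 g ^ 2 * n1 w1 f := by
  rw [n1_w1, n1_w1, ← integral_const_mul]
  apply integral_mono (int_pow _ 2 (by norm_num)) ((int_pow f 2 (by norm_num)).const_mul _)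
  intro x
  dsimp only
  rw [prodS_apply, norm_mul, mul_pow, mul_comm]
  have := norm_le_A1 g x
  gcongr

lemma prodS_comm (f g : SC) : prodS f g = prodS g f := by ext x; simp only [prodS_apply]; ring

lemma flux_add (θ : SC) (k : Fin 3) (G H : SC) :
    ‖∫ ξ, θ ξ * ft (DD k (G + H)) ξ‖ ≤ ‖∫ ξ, θ ξ * ft (DD k G) ξ‖ + ‖∫ ξ, θ ξ * ft (DD k H) ξ‖ := by
  have : ∫ ξ, θ ξ * ft (DD k (G + H)) ξ = (∫ ξ, θ ξ * ft (DD k G) ξ) + ∫ ξ, θ ξ * ft (DD k H) ξ := by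
    rw [← integral_add (int_mul _ _) (int_mul _ _)]
    congr 1; funext ξ; rw [DD_add, ft_add, add_apply]; ring
  rw [this]; exact norm_add_le _ _

noncomputable def SA (f : VF) : ℝ := ∑ j, A1 (f j)
lemma A1_le_SA (f : VF) (j) : A1 (f j) ≤ SA f :=
  Finset.single_le_sum (f := fun j => A1 (f j)) (fun j _ => A1_nonneg (f j)) (Finset.mem_univ j)
lemma SA_nonneg (f : VF) : 0 ≤ SA f := Finset.sum_nonneg fun j _ => A1_nonneg _

/-- `L²` level trilinear bound -/
lemma tri0 : ∃ C : ℝ, 0 < C ∧ ∀ (w : VF), RV w → ∀ N : ℝ, (∀ k, n3 (w k) ≤ N) → ∀ j k,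
    ‖∫ ξ, tst w1 w j ξ * ft (DD k (prodS (w k) (w j))) ξ‖ ≤ C * N * nW (xW w1) w := by
  obtain ⟨C, hC, h⟩ := tri236
  refine ⟨C * (2 * π), by positivity, fun w hw N hN j k => ?_⟩
  refine (flux2 _ _ _ _ _ _).trans ((h _ _ _).trans ?_)
  have hN0 : 0 ≤ N := (n3_nonneg _).trans (hN 0)
  have e1 : √(n1 w1 (DD k (psi w1 (w j)))) ≤ 2 * π * √(nW (xW w1) w) := by
    apply Real.sqrt_le_iff.2 ⟨by positivity, ?_⟩
    rw [mul_pow, Real.sq_sqrt (nW_nonneg (wt_xW wt_w1) w)]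
    refine (n1_DD_w1 _ _).trans ?_
    rw [n1_psi wt_w1 (fun ξ => by simp [xW, w1]) (hw j)]
    have : n1 (fun ξ => xW w1 ξ * w1 ξ ^ 2) (w j) ≤ nW (xW w1) w := by
      simp only [w1, one_pow, mul_one]; exact n1_le_nW (wt_xW wt_w1) w j
    nlinarith [Real.pi_pos, sq_nonneg π]
  have e2 : √(n1 (xW w1) (w j)) ≤ √(nW (xW w1) w) := Real.sqrt_le_sqrt (n1_le_nW (wt_xW wt_w1) w j)
  have := n3_nonneg (w k)
  calc _ ≤ C * (2 * π * √(nW (xW w1) w)) * N * √(nW (xW w1) w) := by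
        gcongr; exact hN k
    _ = C * (2 * π) * N * (√(nW (xW w1) w) * √(nW (xW w1) w)) := by ring
    _ = _ := by rw [Real.mul_self_sqrt (nW_nonneg (wt_xW wt_w1) w)]

lemma br_self_le {W : E3 → ℝ} (hW : Wt W) {f : VF} (g : VF) (hf : RV f) : ‖br (tst W f) g‖ ≤ √(nW W f) * √(nW W g) :=
  pair_le hW hW hW (fun ξ => by rw [sq]) g hf

lemma LZ.join {W : E3 → ℝ} (hW : Wt W) {w : ℝ → VF} {a : ℝ} (h1 : Tendsto (fun s => nW W (w s)) (𝓝[>] a) (𝓝 0))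
    {c : ℝ} (hc : 0 < c) (h2 : LZ (fun s => c * nW (xW W) (w s)) a) : LZ (fun s => nW (fun ξ => W ξ * (1 + ‖ξ‖ ^ 2)) (w s)) a := by
  intro ε hε
  have e1 : ∀ᶠ s in 𝓝[>] a, nW W (w s) < ε / 2 := h1.eventually_lt_const (half_pos hε)
  refine ((h2 (c * (ε / 2)) (by positivity)).and_eventually e1).mono fun s hs => ?_
  have e2 : nW (xW W) (w s) < ε / 2 := lt_of_mul_lt_mul_left hs.1 hc.le
  have e3 : (fun ξ => W ξ * (1 + ‖ξ‖ ^ 2)) = fun ξ => W ξ + xW W ξ := by funext ξ; simp only [xW]; ring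
  dsimp only
  rw [e3, nW_addW hW (wt_xW hW)]; linarith [hs.2]

lemma lvl0 : ∃ c0 : ℝ, 0 < c0 ∧ ∀ {T ν : ℝ} {u : ℝ → VF} {a b : ℝ} (_ : Gap T ν u a b),
    (∃ δ0 > 0, ∀ s ∈ Set.Ioo a b, nW w1 (u s - u a) < δ0 → ∀ k, n3 ((u s - u a) k) ≤ c0 * ν) →
    LZ (fun s => nW w1 (u s - u a)) a → LZ (fun s => nW (bW 1) (u s - u a)) a := by
  obtain ⟨C, hC, htri⟩ := tri0
  refine ⟨π ^ 2 / (9 * C), by positivity, fun {T ν u a b} P ⟨δ0, hδ0, hsm⟩ hz => ?_⟩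
  have hν := P.hν
  set F := √(nW w1 (FF ν (u a)))
  set α := SA (u a)
  have hα : 0 ≤ α := SA_nonneg _
  have hF : 0 ≤ F := Real.sqrt_nonneg _
  have hk : 0 < 4 * π ^ 2 * ν := by positivity
  have c6 : ∀ ξ, w1 ξ ≤ 1 * bW 6 ξ := fun ξ => by rw [one_mul]; exact le_bW 6 ξ
  have := ode1 (d := fun s => 2 * π ^ 2 * ν * nW (xW w1) (u s - u a)) P.hab
    (fun t ht => P.deriv wt_w1 zero_le_one c6 (P.S.rv a) (P.S.div a P.ma) ht) (fun s _ => nW_nonneg wt_w1 _)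
    (fun s _ => mul_nonneg (by positivity) (nW_nonneg (wt_xW wt_w1) _)) (fun ε hε => by
      obtain ⟨δ, hδ, -, hsm1⟩ := small1 (2 * F + 72 * π * α) 0 (lt_min hε hk)
      refine ⟨min δ δ0, lt_min hδ hδ0, fun s hs hg => ?_⟩
      have hN := hsm s hs (hg.trans_le (min_le_right _ _))
      have hg1 := hg.trans_le (min_le_left _ _)
      have hw := P.rw s
      rw [FF_dec2 ν (u s) (u a)]
      set w := u s - u a with hwdef
      have hg0 : 0 ≤ nW w1 w := nW_nonneg wt_w1 _
      have hE0 : 0 ≤ nW (xW w1) w := nW_nonneg (wt_xW wt_w1) _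
      have h1 := hsm1 _ hg1 hg0
      have hR := br_self_le wt_w1 (FF ν (u a)) hw
      have hD := br_dv_le (tst w1 w) (fun k j => prodS (w k) (w j) + (prodS (w k) (u a j) + prodS (u a k) (w j)))
        (X := C * (π ^ 2 / (9 * C) * ν) * nW (xW w1) w + 2 * π * (√(nW (xW w1) w) * (2 * α * √(nW w1 w)))) (fun j k => by
          refine (flux_add _ _ _ _).trans (add_le_add (htri w hw _ hN j k) ((flux1 wt_w1 hw j k _).trans ?_))
          gcongr
          apply Real.sqrt_le_iff.2 ⟨by positivity, ?_⟩
          rw [mul_pow, Real.sq_sqrt hg0]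
          refine (n1_add_le wt_w1 _ _).trans ?_
          rw [prodS_comm (u a k)]
          have a1 := n1_prod_sup (w k) (u a j)
          have a2 := n1_prod_sup (w j) (u a k)
          have b1 : A1 (u a j) ^ 2 * n1 w1 (w k) ≤ α ^ 2 * nW w1 w := by
            have := A1_nonneg (u a j); have := A1_le_SA (u a) j; have := n1_le_nW wt_w1 w k; have := n1_nonneg wt_w1 (w k)
            gcongr
          have b2 : A1 (u a k) ^ 2 * n1 w1 (w j) ≤ α ^ 2 * nW w1 w := by
            have := A1_nonneg (u a k); have := A1_le_SA (u a) k; have := n1_le_nW wt_w1 w j; have := n1_nonneg wt_w1 (w j)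
            gcongr
          linarith)
      have hm := (abs_le.1 (br_est wt_w1 (ν := ν) hw (FF ν (u a)) (dv (fun k j => prodS (w k) (w j) + (prodS (w k) (u a j) + prodS (u a k) (w j)))))).2
      have hc : C * (π ^ 2 / (9 * C) * ν) = π ^ 2 * ν / 9 := by field_simp
      rw [hc] at hD
      have hq := sqrt_le_one_add hE0
      set g := nW w1 w
      set E := nW (xW w1) w
      have hX : 72 * π * α * √g * √E ≤ 72 * π * α * √g * (1 + E) := by gcongr
      have hY : (2 * F + 72 * π * α) * √g * E ≤ 4 * π ^ 2 * ν * E := by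
        refine mul_le_mul_of_nonneg_right ?_ hE0
        have := min_le_right ε (4 * π ^ 2 * ν); linarith
      have hZ : 0 ≤ F * √g * E := by positivity
      have := min_le_left ε (4 * π ^ 2 * ν)
      change ‖br (tst w1 w) (FF ν (u a))‖ ≤ √g * F at hR
      nlinarith) hz
  have := LZ.join wt_w1 this.1 (by positivity) this.2
  convert this using 4
  simp [bW, w1]

lemma sqrt_add_le' {x y : ℝ} (hx : 0 ≤ x) (hy : 0 ≤ y) : √(x + y) ≤ √x + √y := by
  apply Real.sqrt_le_iff.2 ⟨by positivity, ?_⟩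
  have : 0 ≤ √x * √y := by positivity
  nlinarith [Real.sq_sqrt hx, Real.sq_sqrt hy]

lemma ladder {T ν : ℝ} {u : ℝ → VF} {a b : ℝ} (P : Gap T ν u a b) {W : E3 → ℝ} (hW : Wt W) {c c' : ℝ} (hc0 : 0 ≤ c) (hc : ∀ ξ, W ξ ≤ c * bW 6 ξ)
    (hc'0 : 0 ≤ c') (hs : ∀ ξ η, W ξ ≤ c' * (W η + W (ξ - η)))
    (hA : ∀ δ > 0, ∃ A, 0 ≤ A ∧ ∀ f : SC, A1 f ^ 2 ≤ A * n1 W f + δ * n1 (xW W) f)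
    (hz : LZ (fun s => nW W (u s - u a)) a) : LZ (fun s => nW (fun ξ => W ξ * (1 + ‖ξ‖ ^ 2)) (u s - u a)) a := by
  have hν := P.hν
  set F := √(nW W (FF ν (u a)))
  set α := SA (u a)
  set N := nW W (u a)
  have hα : 0 ≤ α := SA_nonneg _
  have hF : 0 ≤ F := Real.sqrt_nonneg _
  have hN : 0 ≤ N := nW_nonneg hW _
  set K1 := 8 * c' + 16 * c' * N with hK1
  have hK10 : 0 ≤ K1 := by positivity
  set δ := (π * ν / 9) ^ 2 / (K1 + 1) with hδd
  have hδ : 0 < δ := by positivity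
  obtain ⟨A, hA0, hA⟩ := hA δ hδ
  set K3 := K1 * A + 16 * c' * α ^ 2 with hK3
  have hK30 : 0 ≤ K3 := by positivity
  have hK1δ : √(K1 * δ) ≤ π * ν / 9 := by
    apply Real.sqrt_le_iff.2 ⟨by positivity, ?_⟩
    rw [hδd, mul_div_assoc', div_le_iff₀ (by positivity)]
    nlinarith [sq_nonneg (π * ν / 9)]
  have hk : 0 < 2 * π ^ 2 * ν := by positivity
  have := ode1 (d := fun s => 2 * π ^ 2 * ν * nW (xW W) (u s - u a)) P.hab
    (fun t ht => P.deriv hW hc0 hc (P.S.rv a) (P.S.div a P.ma) ht) (fun s _ => nW_nonneg hW _)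
    (fun s _ => mul_nonneg (by positivity) (nW_nonneg (wt_xW hW) _)) (fun ε hε => by
      obtain ⟨δ1, hδ1, hδ11, hsm1⟩ := small1 (2 * F + 36 * π * √K3) 0 (lt_min hε hk)
      refine ⟨δ1, hδ1, fun s hs' hg1 => ?_⟩
      have hw := P.rw s
      rw [FF_dec2 ν (u s) (u a)]
      set w := u s - u a with hwdef
      have hg0 : 0 ≤ nW W w := nW_nonneg hW _
      have hE0 : 0 ≤ nW (xW W) w := nW_nonneg (wt_xW hW) _
      have h1 := hsm1 _ hg1 hg0
      have hR := br_self_le hW (FF ν (u a)) hw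
      have hgle := n1_le_nW hW w
      have hEle := n1_le_nW (wt_xW hW) w
      have hg00 := fun j => n1_nonneg hW (w j)
      set g := nW W w
      set E := nW (xW W) w
      set Y := A * g + δ * E with hY
      have hY0 : 0 ≤ Y := by positivity
      have hYj : ∀ j, A1 (w j) ^ 2 ≤ Y := fun j => (hA (w j)).trans (by rw [hY]; have := hgle j; have := hEle j; gcongr)
      have haj : ∀ j, A1 (u a j) ^ 2 ≤ α ^ 2 := fun j => pow_le_pow_left₀ (A1_nonneg _) (A1_le_SA _ j) 2
      have hNj : ∀ j, n1 W (u a j) ≤ N := n1_le_nW hW (u a)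
      have hN0 := fun j => n1_nonneg hW (u a j)
      have p1 : ∀ k j, n1 W (prodS (w k) (w j)) ≤ 2 * c' * (2 * (g * Y)) := fun k j => by
        refine (prod_est hW hc'0 hs _ _).trans ?_
        gcongr
        have := mul_le_mul (hgle k) (hYj j) (by positivity) hg0
        have := mul_le_mul (hgle j) (hYj k) (by positivity) hg0
        linarith
      have p2 : ∀ k j, n1 W (prodS (w k) (u a j)) ≤ 2 * c' * (g * α ^ 2 + N * Y) := fun k j => by
        refine (prod_est hW hc'0 hs _ _).trans ?_
        gcongr
        · exact hgle k
        · exact A1_nonneg _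
        · exact A1_le_SA _ j
        · exact hNj j
        · exact hYj k
      have hD := br_dv_le (tst W w) (fun k j => prodS (w k) (w j) + (prodS (w k) (u a j) + prodS (u a k) (w j)))
        (X := 2 * π * (√E * (√(K1 * δ) * √E + √K3 * √g))) (fun j k => by
          refine (flux1 hW hw j k _).trans ?_
          gcongr
          have e : n1 W (prodS (w k) (w j) + (prodS (w k) (u a j) + prodS (u a k) (w j))) ≤ K1 * δ * E + K3 * g := by
            refine (n1_add_le hW _ _).trans ?_
            have h3 := n1_add_le hW (prodS (w k) (u a j)) (prodS (u a k) (w j))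
            have h4 := p1 k j
            have h5 := p2 k j
            have h6 := p2 j k
            rw [prodS_comm (w j)] at h6
            have h7 : 8 * c' * (g * Y) ≤ 8 * c' * (1 * Y) := by gcongr; linarith
            have h8 : K1 * δ * E + K3 * g = K1 * Y + 16 * c' * α ^ 2 * g := by rw [hK3, hY]; ring
            rw [h8, hK1]
            nlinarith
          refine (Real.sqrt_le_sqrt e).trans ?_
          rw [← Real.sqrt_mul (by positivity), ← Real.sqrt_mul (by positivity)]
          exact sqrt_add_le' (by positivity) (by positivity))
      have hm := (abs_le.1 (br_est hW (ν := ν) hw (FF ν (u a)) (dv (fun k j => prodS (w k) (w j) + (prodS (w k) (u a j) + prodS (u a k) (w j)))))).2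
      have hq := sqrt_le_one_add hE0
      have hee : √E * (√(K1 * δ) * √E + √K3 * √g) = √(K1 * δ) * E + √K3 * √g * √E := by
        linear_combination √(K1 * δ) * Real.mul_self_sqrt hE0
      rw [hee] at hD
      have hX : 36 * π * (√K3 * √g * √E) ≤ 36 * π * (√K3 * √g * (1 + E)) := by gcongr
      have hV : 36 * π * (√(K1 * δ) * E) ≤ 36 * π * (π * ν / 9 * E) := by gcongr
      have hY : (2 * F + 36 * π * √K3) * √g * E ≤ 2 * π ^ 2 * ν * E := by
        refine mul_le_mul_of_nonneg_right ?_ hE0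
        have := min_le_right ε (2 * π ^ 2 * ν); linarith
      have hZ : 0 ≤ F * √g * E := by positivity
      have hZ2 : 0 ≤ π ^ 2 * ν * E := by positivity
      have := min_le_left ε (2 * π ^ 2 * ν)
      change ‖br (tst W w) (FF ν (u a))‖ ≤ √g * F at hR
      change _ + 4 * π ^ 2 * ν * E ≤ _ at hm
      clear_value g E F α N δ K1 K3 Y
      clear hA hYj p1 p2 haj hNj
      linarith) hz
  exact LZ.join hW this.1 (by positivity) this.2

/-! regularised weights -/
noncomputable def kW (m : ℕ) (R : ℝ) (ξ : E3) : ℝ := bW m ξ * ((1 + R ^ 2 * ‖ξ‖ ^ 2)⁻¹ * (1 + R ^ 2 * ‖ξ‖ ^ 2)⁻¹)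
lemma wt_kW (m R) : Wt (kW m R) := ⟨(wt_bW m).tg.mul ((tg_resolvent R).mul (tg_resolvent R)), fun ξ => by
  unfold kW; have := (wt_bW m).nn ξ; positivity⟩
lemma kW_le_bW (m R ξ) : kW m R ξ ≤ bW m ξ := by
  unfold kW
  apply mul_le_of_le_one_right ((wt_bW m).nn ξ)
  have h : (1 + R ^ 2 * ‖ξ‖ ^ 2)⁻¹ ≤ 1 := inv_le_one_of_one_le₀ (le_add_of_nonneg_right (by positivity))
  exact mul_le_one₀ h (by positivity) h
lemma kW_low (m : ℕ) {R : ℝ} (hR : 0 < R) (hR1 : R ≤ 1) (ξ) : bW m ξ ≤ kW (m + 2) R ξ := by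
  unfold kW bW
  have hx : R ^ 2 * ‖ξ‖ ^ 2 ≤ 1 * ‖ξ‖ ^ 2 := by gcongr; exact pow_le_one₀ hR.le hR1
  have h : (1 + ‖ξ‖ ^ 2)⁻¹ ≤ (1 + R ^ 2 * ‖ξ‖ ^ 2)⁻¹ := by gcongr; linarith
  have h0 : 0 < (1 + ‖ξ‖ ^ 2)⁻¹ := by positivity
  calc (1 + ‖ξ‖ ^ 2) ^ m = (1 + ‖ξ‖ ^ 2) ^ (m + 2) * ((1 + ‖ξ‖ ^ 2)⁻¹ * (1 + ‖ξ‖ ^ 2)⁻¹) := by rw [pow_add]; field_simp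
    _ ≤ _ := by gcongr
lemma kW_up (m : ℕ) {R : ℝ} (hR : 0 < R) (hR1 : R ≤ 1) (ξ) : kW (m + 2) R ξ ≤ (R ^ 2)⁻¹ ^ 2 * bW m ξ := by
  unfold kW bW
  have hr : R ^ 2 ≤ 1 := pow_le_one₀ hR.le hR1
  have h : (1 + R ^ 2 * ‖ξ‖ ^ 2)⁻¹ ≤ (R ^ 2)⁻¹ * (1 + ‖ξ‖ ^ 2)⁻¹ := by
    rw [← mul_inv]; gcongr; nlinarith
  calc _ ≤ (1 + ‖ξ‖ ^ 2) ^ (m + 2) * (((R ^ 2)⁻¹ * (1 + ‖ξ‖ ^ 2)⁻¹) * ((R ^ 2)⁻¹ * (1 + ‖ξ‖ ^ 2)⁻¹)) := by gcongr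
    _ = _ := by rw [pow_add]; field_simp
lemma kW_sub (m : ℕ) {R : ℝ} (hR : 0 < R) (hR1 : R ≤ 1) (ξ η : E3) :
    kW (m + 2) R ξ ≤ 4 ^ (m + 2) * (kW (m + 2) R η + kW (m + 2) R (ξ - η)) := by
  have hr : R ^ 2 ≤ 1 := pow_le_one₀ hR.le hR1
  have key : ∀ x y : E3, ‖x‖ ^ 2 ≤ 4 * ‖y‖ ^ 2 → kW (m + 2) R x ≤ 4 ^ (m + 2) * kW (m + 2) R y := by
    intro x y hxy
    have e : ∀ z : E3, kW (m + 2) R z = (1 + ‖z‖ ^ 2) ^ m * ((1 + ‖z‖ ^ 2) * (1 + R ^ 2 * ‖z‖ ^ 2)⁻¹) ^ 2 := fun z => by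
      unfold kW bW; ring
    have h1 : 1 + ‖x‖ ^ 2 ≤ 4 * (1 + ‖y‖ ^ 2) := by linarith
    have h2 : (1 + ‖x‖ ^ 2) * (1 + R ^ 2 * ‖x‖ ^ 2)⁻¹ ≤ 4 * ((1 + ‖y‖ ^ 2) * (1 + R ^ 2 * ‖y‖ ^ 2)⁻¹) := by
      rw [← div_eq_mul_inv, ← div_eq_mul_inv, mul_div_assoc', div_le_div_iff₀ (by positivity) (by positivity)]
      have a1 : 0 ≤ ‖x‖ ^ 2 := by positivity
      have a2 : 0 ≤ ‖y‖ ^ 2 := by positivity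
      generalize ‖x‖ ^ 2 = X at *
      generalize ‖y‖ ^ 2 = Z at *
      have a3 : 0 < R ^ 2 := by positivity
      generalize R ^ 2 = r at *
      nlinarith [mul_nonneg a1 a2, mul_nonneg (mul_nonneg a3.le a1) a2, mul_nonneg a3.le a2, mul_nonneg a3.le a1, mul_nonneg (sub_nonneg.2 hr) a2, mul_nonneg (sub_nonneg.2 hr) (sub_nonneg.2 hxy)]
    rw [e x, e y]
    calc _ ≤ (4 * (1 + ‖y‖ ^ 2)) ^ m * (4 * ((1 + ‖y‖ ^ 2) * (1 + R ^ 2 * ‖y‖ ^ 2)⁻¹)) ^ 2 := by gcongr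
      _ = _ := by rw [mul_pow 4 (1 + ‖y‖ ^ 2) m, pow_add]; ring
  have n0 := (wt_kW (m + 2) R).nn
  have tri : ‖ξ‖ ≤ ‖η‖ + ‖ξ - η‖ := by simpa using norm_add_le η (ξ - η)
  rcases le_total ‖η‖ ‖ξ - η‖ with h | h
  · refine (key ξ (ξ - η) ?_).trans ?_
    · have := norm_nonneg ξ; nlinarith
    · gcongr; linarith [n0 η]
  · refine (key ξ η ?_).trans ?_
    · have := norm_nonneg ξ; nlinarith
    · gcongr; linarith [n0 (ξ - η)]

lemma hA_of {W : E3 → ℝ} (hW : Wt W) (h : ∀ ξ, bW 2 ξ ≤ W ξ) :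
    ∀ δ > 0, ∃ A, 0 ≤ A ∧ ∀ f : SC, A1 f ^ 2 ≤ A * n1 W f + δ * n1 (xW W) f := by
  intro δ hδ
  obtain ⟨C, hC, hs⟩ := sup_bound
  refine ⟨C, hC, fun f => (hs f).trans ?_⟩
  have h1 : n1 (bW 2) f ≤ 1 * n1 W f := n1_mono (wt_bW 2) hW (fun ξ => by rw [one_mul]; exact h ξ) f
  have h2 := n1_nonneg (wt_xW hW) f
  have h3 : C * n1 (bW 2) f ≤ C * n1 W f := by gcongr; linarith
  have : 0 ≤ δ * n1 (xW W) f := by positivity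
  linarith

lemma hA_1 : ∀ δ > 0, ∃ A, 0 ≤ A ∧ ∀ f : SC, A1 f ^ 2 ≤ A * n1 (bW 1) f + δ * n1 (xW (bW 1)) f := by
  intro δ hδ
  obtain ⟨A, hA, hs⟩ := agmon δ hδ
  refine ⟨A + δ, by positivity, fun f => (hs f).trans ?_⟩
  have h1 := q_mono (show 0 ≤ 1 by norm_num) f
  have h2 : n1 (bW 2) f = n1 (bW 1) f + n1 (xW (bW 1)) f := by
    unfold n1
    rw [← integral_add (int_sq _ _ (wt_bW 1).tg) (int_sq _ _ (wt_xW (wt_bW 1)).tg)]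
    congr 1; funext ξ; simp only [bW, xW]; ring
  rw [h2]
  have : A * n1 (bW 0) f ≤ A * n1 (bW 1) f := by gcongr
  linarith

lemma climb {T ν : ℝ} {u : ℝ → VF} {a b : ℝ} (P : Gap T ν u a b) (hz : LZ (fun s => nW (bW 1) (u s - u a)) a) {R : ℝ} (hR : 0 < R) (hR1 : R ≤ 1) :
    LZ (fun s => nW (kW 8 R) (u s - u a)) a := by
  have bs : ∀ m : ℕ, (fun ξ => bW m ξ * (1 + ‖ξ‖ ^ 2)) = bW (m + 1) := fun m => by funext ξ; simp only [bW]; ring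
  have b6 : ∀ m ≤ 6, ∀ ξ, bW m ξ ≤ 1 * bW 6 ξ := fun m hm ξ => by rw [one_mul]; exact bW_mono hm ξ
  have h2 := ladder P (wt_bW 1) zero_le_one (b6 1 (by norm_num)) (by positivity) (bW_sub 1) hA_1 hz
  rw [bs] at h2
  have step : ∀ m, 2 ≤ m → m ≤ 6 → LZ (fun s => nW (bW m) (u s - u a)) a → LZ (fun s => nW (bW (m + 1)) (u s - u a)) a := by
    intro m h2 h6 h
    have := ladder P (wt_bW m) zero_le_one (b6 m h6) (by positivity) (bW_sub m) (hA_of (wt_bW m) (bW_mono h2)) h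
    rwa [bs] at this
  have h7 := step 6 (by norm_num) (by norm_num) (step 5 (by norm_num) (by norm_num) (step 4 (by norm_num) (by norm_num)
    (step 3 (by norm_num) (by norm_num) (step 2 (by norm_num) (by norm_num) h2))))
  have h7' : LZ (fun s => nW (kW 7 R) (u s - u a)) a := by
    intro ε hε
    refine (h7 ε hε).mono fun s hs => lt_of_le_of_lt ?_ hs
    have := nW_mono (wt_kW 7 R) (wt_bW 7) (c := 1) (fun ξ => by rw [one_mul]; exact kW_le_bW 7 R ξ) (u s - u a)
    simpa using this
  have h8 := ladder P (wt_kW 7 R) (c := (R ^ 2)⁻¹ ^ 2) (by positivity) (fun ξ => (kW_up 5 hR hR1 ξ).trans (by gcongr; exact bW_mono (by norm_num) ξ))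
    (by positivity) (kW_sub 5 hR hR1) (hA_of (wt_kW 7 R) fun ξ => (bW_mono (by norm_num) ξ).trans (kW_low 5 hR hR1 ξ)) h7'
  convert h8 using 4
  simp only [kW, bW]; ring

end NSE


namespace NSE
open SchwartzMap LineDeriv FourierTransform
open scoped SchwartzMap ENNReal NNReal ContDiff
open Filter Topology

lemma FF_dec0 (ν : ℝ) (u : VF) : FF ν u = lap ν u + 0 - dv (fun k j => prodS (u k) (u j)) := by
  funext j
  simp only [FF, lap, dv, Pi.add_apply, Pi.sub_apply, Pi.zero_apply, add_zero]

lemma br_zero (θ : VF) : br θ 0 = 0 := by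
  have := br_sub θ 0 0; simpa using this

lemma rv_zero : RV 0 := fun j x => by simp
lemma dF_zero : dF 0 := by unfold dF; simp [DD_zero]

lemma br_est0 {W : E3 → ℝ} (hW : Wt W) {ν : ℝ} {f : VF} (hf : RV f) {X : ℝ}
    (h : ∀ j k, ‖∫ ξ, tst W f j ξ * ft (DD k (prodS (f k) (f j))) ξ‖ ≤ X) :
    |(br (tst W f) (FF ν f)).re + 4 * π ^ 2 * ν * nW (xW W) f| ≤ 9 * X := by
  rw [FF_dec0]
  refine (br_est hW hf _ _).trans ?_
  rw [br_zero, norm_zero, zero_add]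
  exact br_dv_le _ _ h

lemma nW_add_le {W : E3 → ℝ} (hW : Wt W) (f g : VF) : nW W (f + g) ≤ 2 * nW W f + 2 * nW W g := by
  simp only [nW, Finset.mul_sum, ← Finset.sum_add_distrib]
  exact Finset.sum_le_sum fun j _ => n1_add_le hW _ _

lemma nW_le' {W W' : E3 → ℝ} (hW : Wt W) (hW' : Wt W') (h : ∀ ξ, W ξ ≤ W' ξ) (f : VF) : nW W f ≤ nW W' f := by
  have := nW_mono hW hW' (c := 1) (fun ξ => by rw [one_mul]; exact h ξ) f
  simpa using this

lemma n3_of : ∃ C : ℝ, 0 < C ∧ ∀ (f : VF) (B : ℝ), nW (xW w1) f ≤ B → ∀ k, n3 (f k) ^ 2 ≤ C * √B * √(nW w1 f) := by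
  obtain ⟨C, hC, h⟩ := n3_interp
  refine ⟨C, hC, fun f B hB k => (h _).trans ?_⟩
  have h1 := n1_le_nW wt_w1 f k
  have h2 := (n1_le_nW (wt_xW wt_w1) f k).trans hB
  calc _ ≤ C * (√(nW w1 f) * √B) := by gcongr
    _ = _ := by ring

lemma dyn0 (ν B : ℝ) (hν : 0 < ν) (hB : 0 ≤ B) : ∃ CL, 0 ≤ CL ∧ ∀ f, RV f → nW (xW w1) f ≤ B →
    |2 * (br (tst w1 f) (FF ν f)).re| ≤ CL * (1 + nW w1 f) := by
  obtain ⟨C, hC, h⟩ := tri0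
  obtain ⟨C2, hC2, h2⟩ := n3_of
  refine ⟨8 * π ^ 2 * ν * B + 18 * (C * (1 + C2 * √B) * B), by positivity, fun f hf hE => ?_⟩
  have hg := nW_nonneg wt_w1 f
  have hE0 := nW_nonneg (wt_xW wt_w1) f
  have hs := sqrt_le_one_add hg
  have hN : ∀ k, n3 (f k) ≤ (1 + C2 * √B) * (1 + nW w1 f) := fun k => by
    have a := h2 f B hE k
    have b : C2 * √B * √(nW w1 f) ≤ C2 * √B * (1 + nW w1 f) := by gcongr
    have c := n3_nonneg (f k)
    nlinarith [sq_nonneg (n3 (f k) - 1)]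
  have e := br_est0 wt_w1 (ν := ν) hf (h f hf _ hN)
  have e1 : C * ((1 + C2 * √B) * (1 + nW w1 f)) * nW (xW w1) f ≤ C * ((1 + C2 * √B) * (1 + nW w1 f)) * B := by gcongr
  have e2 : 4 * π ^ 2 * ν * nW (xW w1) f ≤ 4 * π ^ 2 * ν * B := by gcongr
  have e3 : 4 * π ^ 2 * ν * B * 1 ≤ 4 * π ^ 2 * ν * B * (1 + nW w1 f) := by gcongr; linarith
  have e4 : 0 ≤ 4 * π ^ 2 * ν * nW (xW w1) f := by positivity
  rw [abs_le] at e ⊢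
  constructor <;> linarith [e.1, e.2]

lemma prod_ff {W : E3 → ℝ} (hW : Wt W) {c' : ℝ} (hc'0 : 0 ≤ c') (hs : ∀ ξ η, W ξ ≤ c' * (W η + W (ξ - η))) {f : VF} {Y : ℝ}
    (hY : ∀ j, A1 (f j) ^ 2 ≤ Y) (k j) : n1 W (prodS (f k) (f j)) ≤ 4 * c' * Y * nW W f := by
  refine (prod_est hW hc'0 hs _ _).trans ?_
  have h1 := mul_le_mul (n1_le_nW hW f k) (hY j) (by positivity) (nW_nonneg hW f)
  have h2 := mul_le_mul (n1_le_nW hW f j) (hY k) (by positivity) (nW_nonneg hW f)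
  have : 2 * c' * (n1 W (f k) * A1 (f j) ^ 2 + n1 W (f j) * A1 (f k) ^ 2) ≤ 2 * c' * (2 * (nW W f * Y)) := by gcongr; linarith
  linarith

lemma dyn8 (ν c' Y : ℝ) (hν : 0 < ν) (hc' : 0 ≤ c') (hY0 : 0 ≤ Y) : ∃ C, 0 ≤ C ∧ ∀ W, Wt W → (∀ ξ η, W ξ ≤ c' * (W η + W (ξ - η))) →
    ∀ f, RV f → (∀ j, A1 (f j) ^ 2 ≤ Y) → 2 * (br (tst W f) (FF ν f)).re ≤ C * nW W f := by
  refine ⟨(18 * π) ^ 2 * (4 * c' * Y) / (8 * π ^ 2 * ν), by positivity, fun W hW hs f hf hY => ?_⟩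
  have hd := nW_nonneg (wt_xW hW) f
  have hg := nW_nonneg hW f
  have e := (abs_le.1 (br_est0 hW (ν := ν) hf (X := 2 * π * (√(nW (xW W) f) * √(4 * c' * Y * nW W f))) (fun j k => by
    refine (flux1 hW hf j k _).trans ?_
    have := prod_ff hW hc' hs hY k j
    gcongr))).2
  have hp : 0 ≤ 4 * c' * Y * nW W f := by positivity
  have q1 := Real.sq_sqrt hd
  have q2 := Real.sq_sqrt hp
  set x := √(nW (xW W) f)
  set y := √(4 * c' * Y * nW W f)
  rw [div_mul_eq_mul_div, mul_assoc, ← q2, le_div_iff₀ (by positivity)]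
  rw [← q1] at e
  have h3 : (br (tst W f) (FF ν f)).re ≤ 18 * π * x * y - 4 * π ^ 2 * ν * x ^ 2 := by linarith
  have hp2 : 0 < 8 * π ^ 2 * ν := by positivity
  have h4 : 2 * (br (tst W f) (FF ν f)).re * (8 * π ^ 2 * ν) ≤ 2 * (18 * π * x * y - 4 * π ^ 2 * ν * x ^ 2) * (8 * π ^ 2 * ν) := by gcongr
  refine h4.trans ?_
  nlinarith [sq_nonneg (18 * π * y - 8 * π ^ 2 * ν * x)]

lemma n1_bW0 (f : SC) : n1 (bW 0) f = n1 w1 f := by simp [n1, bW, w1]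

lemma dyn2 (ν M0 B : ℝ) (hν : 0 < ν) (hM0 : 0 ≤ M0) (hB : 0 ≤ B) : ∃ C, 0 ≤ C ∧ ∀ f, RV f → nW w1 f ≤ M0 → nW (xW w1) f ≤ B → 
    2 * (br (tst (bW 2) f) (FF ν f)).re ≤ C * nW (bW 2) f := by
  set c' : ℝ := 4 ^ 2 with hc'
  have hc'0 : 0 < c' := by positivity
  set M1 := M0 + B with hM1
  have hM10 : 0 ≤ M1 := by positivity
  set ε := (π * ν / 9) ^ 2 / (4 * c' * (M1 + 1)) with hε
  have hε0 : 0 < ε := by positivity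
  obtain ⟨A, hA0, hA⟩ := agmon ε hε0
  set X := 18 * π * √(4 * c' * (A * M0)) + 2 * π ^ 2 * ν with hX
  have hX0 : 0 ≤ X := by positivity
  refine ⟨X ^ 2 / (2 * π ^ 2 * ν), by positivity, fun f hf hL hE => ?_⟩
  have hW := wt_bW 2
  have hd := nW_nonneg (wt_xW hW) f
  have hg := nW_nonneg hW f
  have hY : ∀ j, A1 (f j) ^ 2 ≤ A * M0 + ε * nW (bW 2) f := fun j => by
    refine (hA _).trans ?_
    have h1 := (n1_le_nW wt_w1 f j).trans hL
    have h2 := n1_le_nW hW f j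
    rw [n1_bW0]; gcongr
  have h13 : nW (bW 2) f ≤ √M1 * (√(nW (bW 2) f) + √(nW (xW (bW 2)) f)) := by
    have h := pair_le hW (wt_bW 1) (wt_bW 3) (fun ξ => le_of_eq (by simp only [bW]; ring)) f hf
    rw [br_tst_self hW hf, Complex.norm_real, Real.norm_eq_abs, abs_of_nonneg hg] at h
    have e1 : nW (bW 1) f ≤ M1 := by
      have : bW 1 = fun ξ => w1 ξ + xW w1 ξ := by funext ξ; simp [bW, w1, xW]
      rw [this, nW_addW wt_w1 (wt_xW wt_w1)]; linarith
    have e3 : nW (bW 3) f = nW (bW 2) f + nW (xW (bW 2)) f := by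
      rw [← nW_addW hW (wt_xW hW)]; congr 1; funext ξ; simp only [bW, xW]; ring
    rw [e3] at h
    refine h.trans ?_
    gcongr
    exact sqrt_add_le' hg hd
  have e := (abs_le.1 (br_est0 hW (ν := ν) hf (X := 2 * π * (√(nW (xW (bW 2)) f) * √(4 * c' * (A * M0 + ε * nW (bW 2) f) * nW (bW 2) f))) (fun j k => by
    refine (flux1 hW hf j k _).trans ?_
    have := prod_ff hW hc'0.le (bW_sub 2) hY k j
    gcongr))).2
  set g := nW (bW 2) f
  set d := nW (xW (bW 2)) f
  have q1 := Real.sq_sqrt hd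
  have q2 := Real.sq_sqrt hg
  have s1 : √(4 * c' * (A * M0 + ε * g) * g) ≤ √(4 * c' * (A * M0)) * √g + √(4 * c' * ε) * g := by
    rw [show 4 * c' * (A * M0 + ε * g) * g = 4 * c' * (A * M0) * g + 4 * c' * ε * g ^ 2 by ring]
    refine (sqrt_add_le' (by positivity) (by positivity)).trans ?_
    rw [Real.sqrt_mul (by positivity) g, Real.sqrt_mul (by positivity) (g ^ 2), Real.sqrt_sq hg]
  have s2 : √(4 * c' * ε) * √M1 ≤ π * ν / 9 := by
    rw [← Real.sqrt_mul (by positivity)]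
    apply Real.sqrt_le_iff.2 ⟨by positivity, ?_⟩
    have : 4 * c' * ε * (M1 + 1) = (π * ν / 9) ^ 2 := by rw [hε]; field_simp
    have : 0 < 4 * c' * ε := by positivity
    nlinarith
  have s3 : √(4 * c' * ε) * g ≤ π * ν / 9 * (√g + √d) := by
    calc _ ≤ √(4 * c' * ε) * (√M1 * (√g + √d)) := by gcongr
      _ = √(4 * c' * ε) * √M1 * (√g + √d) := by ring
      _ ≤ _ := by gcongr
  have s4 : √d * √(4 * c' * (A * M0 + ε * g) * g) ≤ √d * (√(4 * c' * (A * M0)) * √g + π * ν / 9 * (√g + √d)) := by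
    exact mul_le_mul_of_nonneg_left (s1.trans (add_le_add le_rfl s3)) (Real.sqrt_nonneg _)
  have h3 : (br (tst (bW 2) f) (FF ν f)).re ≤ X * √d * √g - 2 * π ^ 2 * ν * √d ^ 2 := by
    have : 18 * π * (√d * √(4 * c' * (A * M0 + ε * g) * g)) ≤ 18 * π * (√d * (√(4 * c' * (A * M0)) * √g + π * ν / 9 * (√g + √d))) := by gcongr
    have hdd : √d * √d = d := Real.mul_self_sqrt hd
    have e5 : 18 * π * (√d * (√(4 * c' * (A * M0)) * √g + π * ν / 9 * (√g + √d))) = 18 * π * √(4 * c' * (A * M0)) * √d * √g + 2 * π ^ 2 * ν * √d * √g + 2 * π ^ 2 * ν * (√d * √d) := by ring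
    rw [e5, hdd] at this
    rw [hX, q1]
    linarith
  rw [← q2, div_mul_eq_mul_div, le_div_iff₀ (by positivity)]
  have hp2 : 0 < 2 * π ^ 2 * ν := by positivity
  have h4 : 2 * (br (tst (bW 2) f) (FF ν f)).re * (2 * π ^ 2 * ν) ≤ 2 * (X * √d * √g - 2 * π ^ 2 * ν * √d ^ 2) * (2 * π ^ 2 * ν) := by gcongr
  refine h4.trans ?_
  generalize √d = x
  generalize √g = y
  generalize 2 * π ^ 2 * ν = p
  nlinarith [sq_nonneg (X * y - p * x), sq_nonneg (p * x)]

section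

lemma Gap.deriv0 {T ν : ℝ} {u : ℝ → VF} {a b : ℝ} (P : Gap T ν u a b) {W : E3 → ℝ} (hW : Wt W) {c : ℝ} (hc : 0 ≤ c) (hWc : ∀ ξ, W ξ ≤ c * bW 6 ξ)
    {t : ℝ} (ht : t ∈ Set.Ioo a b) :
    HasDerivAt (fun s => nW W (u s)) (2 * (br (tst W (u t)) (FF ν (u t))).re) t := by
  have := P.deriv hW hc hWc rv_zero dF_zero ht
  simpa only [sub_zero] using this

lemma Gap.cont0 {T ν : ℝ} {u : ℝ → VF} {a b : ℝ} (P : Gap T ν u a b) {W : E3 → ℝ} (hW : Wt W) {c : ℝ} (hc : 0 ≤ c) (hWc : ∀ ξ, W ξ ≤ c * bW 6 ξ)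
    {s1 : ℝ} (h1 : a < s1) (h2 : s1 < b) :
    ContinuousOn (fun s => nW W (u s)) (Set.Icc s1 b) := by
  have := P.cont hW hc hWc rv_zero dF_zero h1 h2
  simpa only [sub_zero] using this

lemma Gap.grow {T ν : ℝ} {u : ℝ → VF} {a b : ℝ} (P : Gap T ν u a b) {W : E3 → ℝ} (hW : Wt W) {c : ℝ} (hc : 0 ≤ c) (hWc : ∀ ξ, W ξ ≤ c * bW 6 ξ)
    {s1 : ℝ} (h1 : a < s1) (h2 : s1 < b) {C K : ℝ} (hC : 0 ≤ C) (hK : 0 ≤ K)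
    (h : ∀ t ∈ Set.Ioo s1 b, 2 * (br (tst W (u t)) (FF ν (u t))).re ≤ C * (K + nW W (u t))) {t : ℝ} (ht : t ∈ Set.Icc s1 b) :
    K + nW W (u t) ≤ exp (C * T) * (K + nW W (u s1)) := by
  have := gron_fwd (g := fun s => nW W (u s)) (C := C) (K := K) ht.1
    ((P.cont0 hW hc hWc h1 h2).mono (Set.Icc_subset_Icc_right ht.2))
    (fun r hr => P.deriv0 hW hc hWc ⟨h1.trans hr.1, hr.2.trans_le ht.2⟩) (fun r hr => h r ⟨hr.1, hr.2.trans_le ht.2⟩)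
  refine this.trans ?_
  have := nW_nonneg hW (u s1)
  have : t - s1 ≤ T := by linarith [P.h0, P.hbT, ht.2]
  gcongr

/-- qualitative regularity at the left end of a gap under an enstrophy bound -/
lemma Gap.reg {T ν : ℝ} {u : ℝ → VF} {a b : ℝ} (P : Gap T ν u a b) {B : ℝ} (hB0 : 0 ≤ B) (hB : ∀ s ∈ Set.Icc a b, nW (xW w1) (u s) ≤ B) {R : ℝ} (hR : 0 < R) (hR1 : R ≤ 1) :
    LZ (fun s => nW (kW 8 R) (u s - u a)) a := by
  have hν := P.hν
  obtain ⟨CL, hCL, hL⟩ := dyn0 ν B P.hν hB0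
  have c6 : ∀ ξ, w1 ξ ≤ 1 * bW 6 ξ := fun ξ => by rw [one_mul]; exact le_bW 6 ξ
  obtain ⟨C2, hC2, h2⟩ := n3_of
  have hbd : ∀ s ∈ Set.Ioo a b, nW w1 (u s) ≤ exp (CL * (b - a)) * (1 + nW w1 (u b)) := by
    intro s hs
    have := gron_bwd (g := fun s => nW w1 (u s)) (C := CL) (K := 1) hs.2.le (P.cont0 wt_w1 zero_le_one c6 hs.1 hs.2)
      (fun t ht => P.deriv0 wt_w1 zero_le_one c6 ⟨hs.1.trans ht.1, ht.2⟩) (fun t ht =>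
        (abs_le.1 (hL _ (P.S.rv t) (hB t ⟨(hs.1.trans ht.1).le, ht.2.le⟩))).1)
    have h2 : exp (CL * (b - s)) * (1 + nW w1 (u b)) ≤ exp (CL * (b - a)) * (1 + nW w1 (u b)) := by
      have := nW_nonneg wt_w1 (u b)
      have := hs.1.le
      gcongr
    linarith
  set M := exp (CL * (b - a)) * (1 + nW w1 (u b))
  have hz := P.low (K := 1 + C2 * √B * √M) (fun s hs k => by
    have h3 := h2 (u s) B (hB s ⟨hs.1.le, hs.2.le⟩) k
    have h4 : C2 * √B * √(nW w1 (u s)) ≤ C2 * √B * √M := by have := hbd s hs; gcongr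
    nlinarith [sq_nonneg (n3 (u s k) - 1)])
  obtain ⟨c0, hc0, hl⟩ := lvl0
  refine climb P (hl P ⟨((c0 * ν) ^ 2 / (C2 * √(4 * B) + 1)) ^ 2, by positivity, fun s hs hg k => ?_⟩ hz) hR hR1
  have hE : nW (xW w1) (u s - u a) ≤ 4 * B := by
    refine (nW_sub_le (wt_xW wt_w1) _ _).trans ?_
    have := hB s ⟨hs.1.le, hs.2.le⟩
    have := hB a ⟨le_rfl, P.hab.le⟩
    linarith
  have h3 := h2 _ _ hE k
  have h4 : √(nW w1 (u s - u a)) ≤ (c0 * ν) ^ 2 / (C2 * √(4 * B) + 1) := Real.sqrt_le_iff.2 ⟨by positivity, hg.le⟩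
  refine (sq_le_sq₀ (n3_nonneg _) (by positivity)).1 (h3.trans ?_)
  have h5 : C2 * √(4 * B) * √(nW w1 (u s - u a)) ≤ (C2 * √(4 * B) + 1) * ((c0 * ν) ^ 2 / (C2 * √(4 * B) + 1)) := by gcongr; linarith
  refine h5.trans (le_of_eq ?_)
  field_simp
end

/-- uniform bound in a gap -/
lemma unif (T ν B : ℝ) (hT : 0 < T) (hν : 0 < ν) (hB0 : 0 ≤ B) (n : ℕ) : ∃ M : ℝ, (n : ℝ) ≤ M ∧ ∀ (u : ℝ → VF) (a b : ℝ), Gap T ν u a b →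
    (∀ s ∈ Set.Icc a b, nW (xW w1) (u s) ≤ B) → nW (bW 8) (u a) ≤ n → nW (bW 8) (u b) ≤ M := by
  obtain ⟨CL, hCL, hL⟩ := dyn0 ν B hν hB0
  set M0 := exp (CL * T) * (1 + (2 + 2 * n)) with hM0
  have hM00 : 0 ≤ M0 := by positivity
  obtain ⟨Ca, hCa, h2⟩ := dyn2 ν M0 B hν hM00 hB0
  set M2 := exp (Ca * T) * (2 + 2 * n) with hM2
  have hM20 : 0 ≤ M2 := by positivity
  obtain ⟨Cs, hCs, hs⟩ := sup_bound
  obtain ⟨C8, hC8, h8⟩ := dyn8 ν (4 ^ 8) (Cs * M2) hν (by positivity) (by positivity)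
  refine ⟨exp (C8 * T) * (2 + 2 * n), ?_, fun u a b P hB hn => ?_⟩
  · have : 1 ≤ exp (C8 * T) := Real.one_le_exp (by positivity)
    have hn0 : (0:ℝ) ≤ n := by positivity
    nlinarith
  set Rn : ℕ → ℝ := fun m => 1 / ((m : ℝ) + 1)
  have hR0 : ∀ m, 0 < Rn m := fun m => by positivity
  have hR1 : ∀ m, Rn m ≤ 1 := fun m => by
    simp only [Rn]; rw [div_le_one (by positivity)]; have : (0:ℝ) ≤ m := by positivity
    linarith
  refine nW_lim (X := fun m => kW 8 (Rn m)) (fun m => wt_kW 8 _) (wt_bW 8) (fun m ξ => kW_le_bW 8 _ ξ) (fun ξ => ?_) fun m => ?_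
  · have hl : Tendsto Rn atTop (𝓝 0) := tendsto_one_div_add_atTop_nhds_zero_nat
    have hc : ContinuousAt (fun R : ℝ => kW 8 R ξ) 0 := by
      unfold kW
      have : ContinuousAt (fun R : ℝ => (1 + R ^ 2 * ‖ξ‖ ^ 2)⁻¹) 0 := by
        apply ContinuousAt.inv₀ (by fun_prop) (by simp)
      exact continuousAt_const.mul (this.mul this)
    have := hc.tendsto.comp hl
    simpa [kW, Function.comp_def] using this
  set R := Rn m
  have hRp : 0 < R := hR0 m
  have hRl : R ≤ 1 := hR1 m
  have wk := wt_kW 8 R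
  obtain ⟨s0, hs1, hs2, hs3⟩ := (P.reg hB0 hB hRp hRl).exists one_pos P.hab
  have k8 : nW (kW 8 R) (u s0) ≤ 2 + 2 * n := by
    have e := nW_add_le wk (u s0 - u a) (u a)
    rw [sub_add_cancel] at e
    have := nW_le' wk (wt_bW 8) (kW_le_bW 8 R) (u a)
    linarith
  have k2 : nW (bW 2) (u s0) ≤ 2 + 2 * n := (nW_le' (wt_bW 2) wk (fun ξ => (bW_mono (by norm_num) ξ).trans (kW_low 6 hRp hRl ξ)) _).trans k8
  have k0 : nW w1 (u s0) ≤ 2 + 2 * n := (nW_le' wt_w1 (wt_bW 2) (fun ξ => le_bW 2 ξ) _).trans k2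
  have b0 : ∀ t ∈ Set.Icc s0 b, nW w1 (u t) ≤ M0 := fun t ht => by
    have := P.grow wt_w1 zero_le_one (fun ξ => by rw [one_mul]; exact le_bW 6 ξ) hs1 hs2 hCL zero_le_one (fun r hr =>
      (abs_le.1 (hL _ (P.S.rv r) (hB r ⟨(hs1.trans hr.1).le, hr.2.le⟩))).2) ht
    have h3 : exp (CL * T) * (1 + nW w1 (u s0)) ≤ M0 := by rw [hM0]; gcongr
    linarith
  have b2 : ∀ t ∈ Set.Icc s0 b, nW (bW 2) (u t) ≤ M2 := fun t ht => by
    have := P.grow (wt_bW 2) zero_le_one (fun ξ => by rw [one_mul]; exact bW_mono (by norm_num) ξ) hs1 hs2 hCa le_rfl (fun r hr => by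
      rw [zero_add]; exact h2 _ (P.S.rv r) (b0 r ⟨hr.1.le, hr.2.le⟩) (hB r ⟨(hs1.trans hr.1).le, hr.2.le⟩)) ht
    rw [zero_add, zero_add] at this
    refine this.trans ?_
    rw [hM2]; gcongr
  have := P.grow wk (c := (R ^ 2)⁻¹ ^ 2) (by positivity) (fun ξ => kW_up 6 hRp hRl ξ) hs1 hs2 hC8 le_rfl (fun r hr => by
      rw [zero_add]
      refine h8 _ wk (kW_sub 6 hRp hRl) _ (P.S.rv r) fun j => (hs _).trans ?_
      have := (n1_le_nW (wt_bW 2) (u r) j).trans (b2 r ⟨hr.1.le, hr.2.le⟩)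
      gcongr) (t := b) ⟨hs2.le, le_rfl⟩
  rw [zero_add, zero_add] at this
  refine this.trans ?_
  gcongr

lemma Sol.closed {T ν : ℝ} {u : ℝ → VF} (S : Sol T ν u) {α β : ℝ} {p : ℕ} (hp : 2 ≤ p) {B : ℝ}
    (hB : ∀ s ∈ Set.Icc α β, ∀ j, ∫ x, ‖u s j x‖ ^ p ≤ B) (n : ℕ) : IsClosed {s | s ∈ Set.Icc α β ∧ nW (bW 8) (u s) ≤ n} := by
  apply isClosed_of_closure_subset
  intro s hs
  have hI : s ∈ Set.Icc α β := isClosed_Icc.closure_subset_iff.2 (fun _ h => h.1) hs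
  refine ⟨hI, ?_⟩
  set C := {s | s ∈ Set.Icc α β ∧ nW (bW 8) (u s) ≤ n}
  haveI : (𝓝[C] s).NeBot := mem_closure_iff_nhdsWithin_neBot.1 hs
  have hW := wt_bW 8
  have hg := nW_nonneg hW (u s)
  have ht := S.br_tendsto (l := 𝓝[C] s) nhdsWithin_le_nhds hp (B := B) (by
    filter_upwards [self_mem_nhdsWithin] with r hr using hB r hr.1) (tst (bW 8) (u s))
  have hle := le_of_tendsto ht.norm (b := √(nW (bW 8) (u s)) * √n) (by
    filter_upwards [self_mem_nhdsWithin] with r hr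
    refine (br_self_le hW (u r) (S.rv s)).trans ?_
    have := hr.2
    gcongr)
  rw [br_tst_self hW (S.rv s), Complex.norm_real, Real.norm_eq_abs, abs_of_nonneg hg] at hle
  set g := nW (bW 8) (u s)
  have e1 := Real.mul_self_sqrt hg
  have e2 := Real.mul_self_sqrt (show (0:ℝ) ≤ n by positivity)
  have e3 : √g ≤ √n := by
    by_contra h
    push Not at h
    nlinarith [Real.sqrt_nonneg g, Real.sqrt_nonneg (n:ℝ)]
  nlinarith [Real.sqrt_nonneg g, Real.sqrt_nonneg (n:ℝ)]

theorem thmN {T ν : ℝ} {u : ℝ → VF} (S : Sol T ν u) (hν : 0 < ν) {α β : ℝ} (hα : 0 ≤ α) (hβ : β < T) {B : ℝ}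
    (hB : ∀ s ∈ Set.Icc α β, nW (xW w1) (u s) ≤ B) : QB u (Set.Icc α β) := by
  rcases lt_or_ge β α with h | hαβ
  · exact ⟨0, fun s hs => absurd (hs.1.trans hs.2) (not_le.2 h)⟩
  have hB0 : 0 ≤ B := (nW_nonneg (wt_xW wt_w1) _).trans (hB α ⟨le_rfl, hαβ⟩)
  have hT : 0 < T := by linarith
  obtain ⟨C6, hC6, h6⟩ := sobolev6
  have := skeleton (q := fun s => nW (bW 8) (u s)) (α := α) (β := β) (Cn := fun n => {s | s ∈ Set.Icc α β ∧ nW (bW 8) (u s) ≤ n})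
    (fun n => S.closed (p := 6) (by norm_num) (B := C6 * (4 * π ^ 2 * B) ^ 3) (fun s hs j => by
      refine (h6 (u s j)).trans ?_
      rw [n1_xw1]
      have h1 := (n1_le_nW (wt_xW wt_w1) (u s) j).trans (hB s hs)
      have h2 := n1_nonneg (wt_xW wt_w1) (u s j)
      gcongr) n)
    (fun m n hmn s hs => ⟨hs.1, hs.2.trans (by exact_mod_cast hmn)⟩)
    (fun s hs => by
      obtain ⟨n, hn⟩ := exists_nat_ge (nW (bW 8) (u s))
      exact Set.mem_iUnion.2 ⟨n, hs, hn⟩)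
    (fun n => by
      obtain ⟨M, hM1, hM⟩ := unif T ν B hT hν hB0 n
      refine ⟨M, fun s hs _ => hs.2.trans hM1, fun a s ha hαa has hsβ hloc => ?_⟩
      refine hM u a s ⟨S, hν, hα.trans hαa, has, hsβ.trans_lt hβ, fun s1 h1 h2 => ?_⟩ (fun r hr => hB r ⟨hαa.trans hr.1, hr.2.trans hsβ⟩) ha.2
      obtain ⟨M', hM'⟩ := hloc s1 h1 h2
      exact ⟨M', fun r hr j => (n1_le_nW (wt_bW 8) _ j).trans (hM' r hr)⟩)
  obtain ⟨M, hM⟩ := this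
  exact ⟨M, fun s hs j => (n1_le_nW (wt_bW 8) _ j).trans (hM s hs)⟩

end NSE


namespace NSE
open SchwartzMap LineDeriv FourierTransform
open scoped SchwartzMap ENNReal NNReal ContDiff
open Filter Topology

/-! the enstrophy inequality -/
lemma enst : ∃ C1 : ℝ, 0 < C1 ∧ ∀ (ν : ℝ) (f : VF), RV f → ∀ N : ℝ, (∀ k, n3 (f k) ≤ N) →
    (br (tst (xW w1) f) (FF ν f)).re + 4 * π ^ 2 * ν * nW (xW (xW w1)) f ≤ C1 * N * nW (xW (xW w1)) f := by
  obtain ⟨C0, hC0, htri⟩ := tri236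
  refine ⟨36 * π * C0, by positivity, fun ν f hf N hN => ?_⟩
  have hW := wt_xW wt_w1
  have hWW := wt_xW hW
  have hN0 : 0 ≤ N := (n3_nonneg _).trans (hN 0)
  set Q := nW (xW (xW w1)) f with hQ
  have hQ0 : 0 ≤ Q := nW_nonneg hWW f
  have hT : ∀ (j l k m : Fin 3), ∫ x, ‖psi (xW w1) (f j) x‖ * (‖f l x‖ * ‖DD k (f m) x‖) ≤ C0 * N * (2 * π) * Q := by
    intro j l k m
    refine (htri _ _ _).trans ?_
    have h1 : √(n1 w1 (psi (xW w1) (f j))) ≤ √Q := by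
      rw [n1_psi hW (fun ξ => rfl) (hf j)]
      refine Real.sqrt_le_sqrt ?_
      have : (fun ξ => w1 ξ * xW w1 ξ ^ 2) = xW (xW w1) := by funext ξ; simp [w1, xW]; ring
      rw [this]; exact n1_le_nW hWW f j
    have h2 : √(n1 (xW w1) (DD k (f m))) ≤ 2 * π * √Q := by
      have e : 2 * π * √Q = √(4 * π ^ 2 * Q) := by
        rw [Real.sqrt_mul (by positivity), show 4 * π ^ 2 = (2 * π) ^ 2 by ring, Real.sqrt_sq (by positivity)]
      rw [e]
      refine Real.sqrt_le_sqrt ((n1_DD_xw1 k (f m)).trans ?_)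
      have := n1_le_nW hWW f m
      gcongr
    have h3 := n3_nonneg (f l)
    calc C0 * √(n1 w1 (psi (xW w1) (f j))) * n3 (f l) * √(n1 (xW w1) (DD k (f m)))
        ≤ C0 * √Q * N * (2 * π * √Q) := by
          have := hN l
          gcongr
      _ = C0 * N * (2 * π) * (√Q * √Q) := by ring
      _ = _ := by rw [Real.mul_self_sqrt hQ0]
  have e := (abs_le.1 (br_est0 hW (ν := ν) hf (X := 4 * π * C0 * N * Q) (fun j k => by
    have e1 : ∫ ξ, tst (xW w1) f j ξ * ft (DD k (prodS (f k) (f j))) ξ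
        = ∫ x, psi (xW w1) (f j) x * DD k (prodS (f k) (f j)) x := (int_ft_mul _ _).symm
    rw [e1]
    refine (norm_integral_le_integral_norm _).trans ?_
    have i1 := int3 (psi (xW w1) (f j)) (f j) (DD k (f k))
    have i2 := int3 (psi (xW w1) (f j)) (f k) (DD k (f j))
    calc ∫ x, ‖psi (xW w1) (f j) x * DD k (prodS (f k) (f j)) x‖
        ≤ ∫ x, (‖psi (xW w1) (f j) x‖ * (‖f j x‖ * ‖DD k (f k) x‖) + ‖psi (xW w1) (f j) x‖ * (‖f k x‖ * ‖DD k (f j) x‖)) := by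
          refine integral_mono (int_mul _ _).norm (i1.add i2) fun x => ?_
          show ‖_‖ ≤ _
          rw [norm_mul, DD_prodS]
          show _ * ‖DD k (f k) x * f j x + f k x * DD k (f j) x‖ ≤ _
          rw [← mul_add]
          refine mul_le_mul_of_nonneg_left ((norm_add_le _ _).trans ?_) (norm_nonneg _)
          rw [norm_mul, norm_mul]; linarith
      _ ≤ _ := by
          rw [integral_add i1 i2]
          have := hT j j k k
          have := hT j k k j
          linarith))).2
  linarith

lemma xw1_le : ∀ ξ, xW w1 ξ ≤ 1 * bW 6 ξ := by
  intro ξ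
  have h1 : (1 + ‖ξ‖ ^ 2) ^ 1 ≤ (1 + ‖ξ‖ ^ 2) ^ 6 := pow_le_pow_right₀ (by nlinarith [sq_nonneg ‖ξ‖]) (by norm_num)
  simp only [xW, w1, bW]; linarith

/-- derivative of the enstrophy -/
lemma Sol.ederiv {T ν : ℝ} {u : ℝ → VF} (S : Sol T ν u) (hν : 0 < ν) {α β : ℝ} (hα : 0 ≤ α) (hβ : β < T) {B : ℝ}
    (hB : ∀ s ∈ Set.Icc α β, nW (xW w1) (u s) ≤ B) {t : ℝ} (ht : t ∈ Set.Icc α β) :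
    HasDerivWithinAt (fun s => nW (xW w1) (u s)) (2 * (br (tst (xW w1) (u t)) (FF ν (u t))).re) (Set.Icc α β) t := by
  have hQ := thmN S hν hα hβ hB
  have := S.energy (fun s hs => ⟨hα.trans hs.1, hs.2.trans_lt hβ⟩) hQ (wt_xW wt_w1) zero_le_one xw1_le rv_zero dF_zero ht
  simpa only [sub_zero] using this

lemma Sol.part1 {T ν : ℝ} {u : ℝ → VF} (S : Sol T ν u) (hν : 0 < ν) {t : ℝ} (ht : t ∈ Set.Ico 0 T) {D : ℝ}
    (hD : HasDerivAt (fun s => nW (xW w1) (u s)) D t) : D = 2 * (br (tst (xW w1) (u t)) (FF ν (u t))).re := by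
  have hc := hD.continuousAt.eventually_lt (continuousAt_const (y := nW (xW w1) (u t) + 1)) (by linarith)
  obtain ⟨δ, hδ, hb⟩ := Metric.eventually_nhds_iff.1 hc
  set d := min (δ / 2) ((T - t) / 2) with hd
  have hT := ht.2
  have hd0 : 0 < d := by rw [hd]; apply lt_min <;> linarith
  have hd1 : d ≤ δ / 2 := min_le_left _ _
  have hd2 : d ≤ (T - t) / 2 := min_le_right _ _
  have h := S.ederiv hν ht.1 (β := t + d) (by linarith) (B := nW (xW w1) (u t) + 1) (fun s hs => (hb (by
    rw [Real.dist_eq, abs_lt]; constructor <;> linarith [hs.1, hs.2])).le) (t := t) ⟨le_rfl, by linarith⟩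
  exact (uniqueDiffOn_Icc (by linarith) t ⟨le_rfl, by linarith⟩).eq_deriv _ hD.hasDerivWithinAt h

lemma n3_sub {f g : SC} {N : ℝ} (hf : n3 f ≤ N) (hg : n3 g ≤ N) : n3 (f - g) ≤ 2 * N := by
  have hN := (n3_nonneg f).trans hf
  have i := fun f : SC => int_pow f 3 (by norm_num)
  have h : n3 (f - g) ^ 3 ≤ (2 * N) ^ 3 := by
    rw [n3_cube]
    calc ∫ x, ‖(f - g) x‖ ^ 3 ≤ ∫ x, (4 * ‖f x‖ ^ 3 + 4 * ‖g x‖ ^ 3) := by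
          refine integral_mono (i _) (((i f).const_mul 4).add ((i g).const_mul 4)) fun x => ?_
          show ‖f x - g x‖ ^ 3 ≤ 4 * ‖f x‖ ^ 3 + 4 * ‖g x‖ ^ 3
          have h1 : ‖f x - g x‖ ^ 3 ≤ (‖f x‖ + ‖g x‖) ^ 3 := by gcongr; exact norm_sub_le _ _
          have := norm_nonneg (f x)
          have := norm_nonneg (g x)
          nlinarith [mul_nonneg (add_nonneg (norm_nonneg (f x)) (norm_nonneg (g x))) (sq_nonneg (‖f x‖ - ‖g x‖))]
      _ = 4 * n3 f ^ 3 + 4 * n3 g ^ 3 := by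
          rw [integral_add ((i f).const_mul 4) ((i g).const_mul 4), integral_const_mul, integral_const_mul, n3_cube, n3_cube]
      _ ≤ 4 * N ^ 3 + 4 * N ^ 3 := by
          have := n3_nonneg f
          have := n3_nonneg g
          gcongr
      _ = _ := by ring
  exact le_of_pow_le_pow_left₀ (by norm_num) (by positivity) h

lemma Sol.anti {T ν : ℝ} {u : ℝ → VF} (S : Sol T ν u) (hν : 0 < ν) {α β : ℝ} (hα : 0 ≤ α) (hβ : β < T) {B : ℝ}
    (hB : ∀ s ∈ Set.Icc α β, nW (xW w1) (u s) ≤ B)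
    (hn : ∀ s ∈ Set.Icc α β, (br (tst (xW w1) (u s)) (FF ν (u s))).re ≤ 0) :
    AntitoneOn (fun s => nW (xW w1) (u s)) (Set.Icc α β) := by
  refine antitoneOn_of_deriv_nonpos (convex_Icc _ _) (fun t ht => (S.ederiv hν hα hβ hB ht).continuousWithinAt) ?_ ?_
  · intro t ht
    rw [interior_Icc] at ht
    exact ((S.ederiv hν hα hβ hB ⟨ht.1.le, ht.2.le⟩).hasDerivAt (Icc_mem_nhds ht.1 ht.2)).differentiableAt.differentiableWithinAt
  · intro t ht
    rw [interior_Icc] at ht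
    rw [((S.ederiv hν hα hβ hB ⟨ht.1.le, ht.2.le⟩).hasDerivAt (Icc_mem_nhds ht.1 ht.2)).deriv]
    linarith [hn t ⟨ht.1.le, ht.2.le⟩]

lemma part2 : ∃ c1 : ℝ, 0 < c1 ∧ ∀ {T ν : ℝ} {u : ℝ → VF} (_ : Sol T ν u) (_ : 0 < ν),
    (∀ s ∈ Set.Ico 0 T, ∀ k, n3 (u s k) ≤ c1 * ν) → AntitoneOn (fun s => nW (xW w1) (u s)) (Set.Ico 0 T) := by
  obtain ⟨C1, hC1, hen⟩ := enst
  obtain ⟨c0, hc0, hl0⟩ := lvl0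
  refine ⟨min (c0 / 2) (4 * π ^ 2 / C1), by positivity, fun {T ν u} S hν hN => ?_⟩
  set c1 := min (c0 / 2) (4 * π ^ 2 / C1) with hc1
  have hca : c1 ≤ c0 / 2 := min_le_left _ _
  have hcb : C1 * c1 ≤ 4 * π ^ 2 := by
    have := (le_div_iff₀ hC1).1 (min_le_right (c0 / 2) (4 * π ^ 2 / C1))
    linarith
  have hneg : ∀ s ∈ Set.Ico 0 T, (br (tst (xW w1) (u s)) (FF ν (u s))).re ≤ 0 := by
    intro s hs
    have h := hen ν (u s) (S.rv s) _ (hN s hs)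
    have hQ := nW_nonneg (wt_xW (wt_xW wt_w1)) (u s)
    have : C1 * c1 * (ν * nW (xW (xW w1)) (u s)) ≤ 4 * π ^ 2 * (ν * nW (xW (xW w1)) (u s)) :=
      mul_le_mul_of_nonneg_right hcb (by positivity)
    linarith
  intro α hα β hβ hαβ
  have hsub : ∀ s ∈ Set.Icc α β, s ∈ Set.Ico 0 T := fun s hs => ⟨hα.1.trans hs.1, hs.2.trans_lt hβ.2⟩
  have hbd : ∃ M, ∀ s ∈ Set.Icc α β, nW (xW w1) (u s) ≤ M := by
    refine skeleton (q := fun s => nW (xW w1) (u s)) (Cn := fun n => {s | s ∈ Set.Icc α β ∧ nW (bW 8) (u s) ≤ n})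
      (fun n => S.closed (p := 3) (by norm_num) (B := (c1 * ν) ^ 3) (fun s hs j => by
        rw [← n3_cube]
        have := n3_nonneg (u s j)
        have := hN s (hsub s hs) j
        gcongr) n)
      (fun m n hmn s hs => ⟨hs.1, hs.2.trans (by exact_mod_cast hmn)⟩)
      (fun s hs => by
        obtain ⟨n, hn⟩ := exists_nat_ge (nW (bW 8) (u s))
        exact Set.mem_iUnion.2 ⟨n, hs, hn⟩) (fun n => ?_)
    have hx8 : ∀ ξ, xW w1 ξ ≤ 1 * bW 8 ξ := fun ξ => by
      have h1 : (1 + ‖ξ‖ ^ 2) ^ 1 ≤ (1 + ‖ξ‖ ^ 2) ^ 8 := pow_le_pow_right₀ (by nlinarith [sq_nonneg ‖ξ‖]) (by norm_num)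
      simp only [xW, w1, bW]; linarith
    have hx1 : ∀ ξ, xW w1 ξ ≤ 1 * bW 1 ξ := fun ξ => by
      simp only [xW, w1, bW]; linarith
    have hn8 : ∀ s, nW (bW 8) (u s) ≤ n → nW (xW w1) (u s) ≤ n := fun s hs =>
      (nW_mono (wt_xW wt_w1) (wt_bW 8) hx8 _).trans (by rw [one_mul]; exact hs)
    refine ⟨2 * 1 + 2 * n, fun s hs _ => (hn8 s hs.2).trans (by
      have : (0:ℝ) ≤ n := Nat.cast_nonneg n
      linarith), fun a s ha hαa has hsβ hloc => ?_⟩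
    have h0a : 0 ≤ a := hα.1.trans hαa
    have hsT : s < T := hsβ.trans_lt hβ.2
    have G : Gap T ν u a s := ⟨S, hν, h0a, has, hsT, fun s1 h1 h2 => by
      obtain ⟨M', hM'⟩ := hloc s1 h1 h2
      exact thmN S hν (h0a.trans h1.le) hsT hM'⟩
    have hz := G.low (K := c1 * ν) (fun r hr k => hN r ⟨h0a.trans hr.1.le, hr.2.trans hsT⟩ k)
    have hz1 := hl0 G ⟨1, one_pos, fun r hr _ k => by
      have h := n3_sub (hN r ⟨h0a.trans hr.1.le, hr.2.trans hsT⟩ k) (hN a ⟨h0a, has.trans hsT⟩ k)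
      refine h.trans ?_
      have : c1 * ν ≤ c0 / 2 * ν := by gcongr
      linarith⟩ hz
    obtain ⟨s0, h1, h2, h3⟩ := hz1.exists (ε := 1) one_pos has
    obtain ⟨M', hM'⟩ := hloc s0 h1 h2
    have hanti := S.anti hν (h0a.trans h1.le) hsT hM' (fun r hr => hneg r ⟨(h0a.trans h1.le).trans hr.1, hr.2.trans_lt hsT⟩)
      ⟨le_rfl, h2.le⟩ ⟨h2.le, le_rfl⟩ h2.le
    have h4 : nW (xW w1) (u s0 - u a) ≤ 1 := (nW_mono (wt_xW wt_w1) (wt_bW 1) hx1 _).trans (by rw [one_mul]; exact h3.le)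
    have h5 := nW_add_le (wt_xW wt_w1) (u s0 - u a) (u a)
    rw [sub_add_cancel] at h5
    have h6 := hn8 a ha.2
    refine hanti.trans ?_
    show nW (xW w1) (u s0) ≤ _
    linarith
  obtain ⟨B, hB⟩ := hbd
  exact S.anti hν hα.1 hβ.2 hB (fun s hs => hneg s (hsub s hs)) ⟨le_rfl, hαβ⟩ ⟨hαβ, le_rfl⟩ hαβ

end NSE

namespace NSE
open SchwartzMap LineDeriv FourierTransform
open scoped SchwartzMap ENNReal NNReal ContDiff
open Filter Topology

/-! translation between the real vector field and its complexified components -/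
noncomputable def cx (j : Fin 3) : E3 →L[ℝ] ℂ := Complex.ofRealCLM ∘L (EuclideanSpace.proj j : E3 →L[ℝ] ℝ)

noncomputable def toU (v : SchwartzMap E3 E3) : VF := fun j => postcompCLM (cx j) v

lemma toU_apply (v : SchwartzMap E3 E3) (j : Fin 3) (x : E3) : toU v j x = ((v x j : ℝ) : ℂ) := rfl

lemma pd_DD {f : E3 → ℝ} {F : SC} (h : ∀ x, F x = ((f x : ℝ) : ℂ)) (i : Fin 3) (x : E3) :
    DD i F x = ((pd i f x : ℝ) : ℂ) := by
  have hf : f = fun x => (F x).re := by funext x; rw [h, Complex.ofReal_re]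
  have h1 : DifferentiableAt ℝ f x := by
    rw [hf]
    exact (Complex.reCLM.differentiableAt.comp x F.differentiableAt)
  have h2 : (F : E3 → ℂ) = fun x => ((f x : ℝ) : ℂ) := funext h
  have h3 : HasFDerivAt (F : E3 → ℂ) (Complex.ofRealCLM.comp (fderiv ℝ f x)) x := by
    rw [h2]
    exact Complex.ofRealCLM.hasFDerivAt.comp x h1.hasFDerivAt
  rw [DD_apply, h3.fderiv]
  rfl

lemma DD_toU (v : SchwartzMap E3 E3) (i j : Fin 3) (x : E3) :
    DD i (toU v j) x = ((pd i (fun y => v y j) x : ℝ) : ℂ) := pd_DD (toU_apply v j) i x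

lemma DDD_toU (v : SchwartzMap E3 E3) (i j : Fin 3) (x : E3) :
    DD i (DD i (toU v j)) x = ((pd i (fun y => pd i (fun z => v z j) y) x : ℝ) : ℂ) := pd_DD (DD_toU v i j) i x

lemma enst_eq (v : SchwartzMap E3 E3) :
    ∫ x, ∑ i : Fin 3, ∑ j : Fin 3, (pd i (fun y => v y j) x) ^ 2 = 4 * π ^ 2 * nW (xW w1) (toU v) := by
  rw [nW, Finset.mul_sum, Finset.sum_congr rfl fun j _ => (n1_xw1 (toU v j)).symm,
    ← integral_finsetSum _ fun j _ => integrable_finsetSum _ fun i _ => int_pow (DD i (toU v j)) 2 (by norm_num)]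
  congr 1; funext x
  rw [Finset.sum_comm]
  refine Finset.sum_congr rfl fun j _ => Finset.sum_congr rfl fun i _ => ?_
  rw [DD_toU, Complex.norm_real, Real.norm_eq_abs, sq_abs]

lemma lap_eq (v : SchwartzMap E3 E3) :
    ∫ x, ∑ j : Fin 3, (∑ i : Fin 3, pd i (fun y => pd i (fun z => v z j) y) x) ^ 2
      = (4 * π ^ 2) ^ 2 * nW (xW (xW w1)) (toU v) := by
  have h := nW_lap w1 1 (toU v)
  rw [mul_one] at h
  rw [← h, nW, Finset.sum_congr rfl fun j _ => n1_w1 _,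
    ← integral_finsetSum _ fun j _ => int_pow (lap 1 (toU v) j) 2 (by norm_num)]
  congr 1; funext x
  refine Finset.sum_congr rfl fun j _ => ?_
  have : lap 1 (toU v) j x = ((∑ i : Fin 3, pd i (fun y => pd i (fun z => v z j) y) x : ℝ) : ℂ) := by
    simp only [lap, Complex.ofReal_one, one_smul, sum_apply', DDD_toU, Complex.ofReal_sum]
  rw [this, Complex.norm_real, Real.norm_eq_abs, sq_abs]

lemma n3_toU (v : SchwartzMap E3 E3) (k : Fin 3) : n3 (toU v k) ≤ (∫ x, ‖v x‖ ^ 3) ^ ((1 : ℝ) / 3) := by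
  refine Real.rpow_le_rpow (integral_nonneg fun x => by positivity) ?_ (by norm_num)
  have hi : Integrable (fun x => ‖v x‖ ^ 3) := by
    have := (v.memLp 3 volume).integrable_norm_pow (by norm_num)
    simpa using this
  refine integral_mono (int_pow _ 3 (by norm_num)) hi fun x => ?_
  show ‖toU v k x‖ ^ 3 ≤ ‖v x‖ ^ 3
  rw [toU_apply, Complex.norm_real]
  gcongr
  exact PiLp.norm_apply_le _ _

lemma mkSol {T ν ρ₀ : ℝ} {v : ℝ → SchwartzMap E3 E3} {P : ℝ → E3 → ℝ}
    (hP : ∀ t, ContDiff ℝ (⊤ : ℕ∞) (P t)) (hv : ∀ x, ContDiff ℝ (⊤ : ℕ∞) (fun t => v t x))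
    (hd : ∀ t ∈ Set.Ico (0 : ℝ) T, ∀ x, ∑ i : Fin 3, pd i (fun y => v t y i) x = 0)
    (hn : ∀ t ∈ Set.Ico (0 : ℝ) T, ∀ x, ∀ i : Fin 3,
          deriv (fun s => v s x i) t
            + ∑ j : Fin 3, v t x j * pd j (fun y => v t y i) x
          = -(1 / ρ₀) * pd i (P t) x
            + ν * ∑ j : Fin 3, pd j (fun y => pd j (fun z => v t z i) y) x) :
    Sol T ν (fun s => toU (v s)) := by
  have hv1 : ∀ x, ContDiff ℝ 1 (fun t => v t x) := fun x => (hv x).of_le (by exact_mod_cast le_top)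
  refine ⟨fun s j x => by rw [toU_apply, Complex.conj_ofReal], fun j x => (cx j).contDiff.comp (hv1 x), ?_, ?_⟩
  · intro s hs
    ext x
    rw [sum_apply']
    simp only [DD_toU]
    rw [← Complex.ofReal_sum, hd s hs x]; rfl
  · intro s hs
    have hPd : ∀ x, DifferentiableAt ℝ (P s) x := fun x => (hP s).contDiffAt.differentiableAt (by simp)
    refine ⟨fun x => (((1 / ρ₀) * P s x : ℝ) : ℂ), ?_, fun j x => ?_⟩
    · exact Complex.ofRealCLM.contDiff.comp (contDiff_const.mul ((hP s).of_le (by exact_mod_cast le_top)))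
    have e1 : deriv (fun r => toU (v r) j x) s = ((deriv (fun r => v r x j) s : ℝ) : ℂ) := by
      have hdv : DifferentiableAt ℝ (fun r => v r x j) s :=
        ((EuclideanSpace.proj j : E3 →L[ℝ] ℝ).contDiff.comp (hv1 x)).contDiffAt.differentiableAt one_ne_zero
      exact hdv.hasDerivAt.ofReal_comp.deriv
    have e2 : fderiv ℝ (fun x => (((1 / ρ₀) * P s x : ℝ) : ℂ)) x (ee j) = (((1 / ρ₀) * pd j (P s) x : ℝ) : ℂ) := by
      have h3 : HasFDerivAt (fun x => (((1 / ρ₀) * P s x : ℝ) : ℂ)) (Complex.ofRealCLM.comp ((1 / ρ₀) • fderiv ℝ (P s) x)) x :=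
        Complex.ofRealCLM.hasFDerivAt.comp x ((hPd x).hasFDerivAt.const_mul _)
      rw [h3.fderiv]
      rfl
    have e3 : FF ν (toU (v s)) j x = ((ν * ∑ k : Fin 3, pd k (fun y => pd k (fun z => v s z j) y) x
        - ∑ k : Fin 3, v s x k * pd k (fun y => v s y j) x : ℝ) : ℂ) := by
      simp only [FF, sub_apply, smul_apply, sum_apply', DDD_toU, DD_prodS, add_apply, prodS_apply, DD_toU, toU_apply, smul_eq_mul]
      have h0 := hd s hs x
      have : ∑ k, (((pd k (fun y => v s y k) x : ℝ) : ℂ) * ((v s x j : ℝ) : ℂ) + ((v s x k : ℝ) : ℂ) * ((pd k (fun y => v s y j) x : ℝ) : ℂ))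
         = ∑ k, ((v s x k : ℝ) : ℂ) * ((pd k (fun y => v s y j) x : ℝ) : ℂ) := by
        rw [Finset.sum_add_distrib, ← Finset.sum_mul, ← Complex.ofReal_sum, h0]; simp
      rw [this]; push_cast; rfl
    rw [e1, e2, e3, ← Complex.ofReal_sub]
    congr 1
    have := hn s hs x j
    linarith

end NSE

/-- there is a constant `C > 0`, independent of the solution, with
`(1/2) d/dt ‖∇v‖²_{L²} + ν ‖Δv‖²_{L²} ≤ C ‖v‖_{L³} ‖Δv‖²_{L²}`; hence if
`‖v(·,t)‖_{L³} ≤ ν/C` on an interval, the enstrophy is nonincreasing there. -/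
theorem enstrophy_bound_small_L3 :
    ∃ C : ℝ, 0 < C ∧
      ∀ (T : ℝ), 0 < T →
      ∀ (v : ℝ → SchwartzMap (EuclideanSpace ℝ (Fin 3)) (EuclideanSpace ℝ (Fin 3)))
        (P : ℝ → EuclideanSpace ℝ (Fin 3) → ℝ) (ρ₀ ν : ℝ), 0 < ρ₀ → 0 < ν →
        (∀ t, ContDiff ℝ (⊤ : ℕ∞) (P t)) →
        (∀ x, ContDiff ℝ (⊤ : ℕ∞) (fun t => v t x)) →
        (∀ t ∈ Set.Ico (0 : ℝ) T, ∀ x,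
          ∑ i : Fin 3, pd i (fun y => v t y i) x = 0) →
        (∀ t ∈ Set.Ico (0 : ℝ) T, ∀ x, ∀ i : Fin 3,
          deriv (fun s => v s x i) t
            + ∑ j : Fin 3, v t x j * pd j (fun y => v t y i) x
          = -(1 / ρ₀) * pd i (P t) x
            + ν * ∑ j : Fin 3, pd j (fun y => pd j (fun z => v t z i) y) x) →
        ((∀ t ∈ Set.Ico (0 : ℝ) T, ∀ D : ℝ,
            HasDerivAt
              (fun s => (1 / 2) * ∫ x, ∑ i : Fin 3, ∑ j : Fin 3,
                (pd i (fun y => v s y j) x) ^ 2) D t →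
            D + ν * ∫ x, ∑ j : Fin 3,
                  (∑ i : Fin 3, pd i (fun y => pd i (fun z => v t z j) y) x) ^ 2
              ≤ C * (∫ x, ‖v t x‖ ^ 3) ^ ((1 : ℝ) / 3)
                  * ∫ x, ∑ j : Fin 3,
                      (∑ i : Fin 3, pd i (fun y => pd i (fun z => v t z j) y) x) ^ 2)
          ∧ ((∀ t ∈ Set.Ico (0 : ℝ) T,
                (∫ x, ‖v t x‖ ^ 3) ^ ((1 : ℝ) / 3) ≤ ν / C) →
              AntitoneOn
                (fun t => ∫ x, ∑ i : Fin 3, ∑ j : Fin 3,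
                  (pd i (fun y => v t y j) x) ^ 2) (Set.Ico 0 T))) := by
  obtain ⟨C1, hC1, hen⟩ := NSE.enst
  obtain ⟨c1, hc1, hp2⟩ := NSE.part2
  refine ⟨C1 / (4 * π ^ 2) + 1 / c1, by positivity, fun T hT v P ρ₀ ν hρ hν hP hv hd hn => ?_⟩
  have S := NSE.mkSol hP hv hd hn
  refine ⟨fun t ht D hD => ?_, fun hN => ?_⟩
  · simp only [NSE.enst_eq] at hD
    have hD1 := hD.const_mul (1 / (2 * π ^ 2))
    have hD2 : HasDerivAt (fun s => NSE.nW (NSE.xW NSE.w1) (NSE.toU (v s))) (1 / (2 * π ^ 2) * D) t := by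
      refine hD1.congr_of_eventuallyEq (Filter.Eventually.of_forall fun s => ?_)
      field_simp; ring
    have h1 := S.part1 hν ht hD2
    have h2 := hen ν (NSE.toU (v t)) (S.rv t) _ (NSE.n3_toU (v t))
    rw [NSE.lap_eq]
    set N := (∫ x, ‖v t x‖ ^ 3) ^ ((1 : ℝ) / 3)
    have hN0 : 0 ≤ N := (NSE.n3_nonneg _).trans (NSE.n3_toU (v t) 0)
    set Q := NSE.nW (NSE.xW (NSE.xW NSE.w1)) (NSE.toU (v t))
    have hQ0 : 0 ≤ Q := NSE.nW_nonneg (NSE.wt_xW (NSE.wt_xW NSE.wt_w1)) _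
    have h3 : D = 4 * π ^ 2 * (NSE.br (NSE.tst (NSE.xW NSE.w1) (NSE.toU (v t))) (NSE.FF ν (NSE.toU (v t)))).re := by
      field_simp at h1
      linarith
    have h4 := mul_le_mul_of_nonneg_left h2 (show 0 ≤ 4 * π ^ 2 by positivity)
    have h5 : (C1 / (4 * π ^ 2) + 1 / c1) * N * ((4 * π ^ 2) ^ 2 * Q) = 4 * π ^ 2 * (C1 * N * Q) + 1 / c1 * N * ((4 * π ^ 2) ^ 2 * Q) := by
      field_simp
    have h6 : 0 ≤ 1 / c1 * N * ((4 * π ^ 2) ^ 2 * Q) := by positivity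
    rw [h5, h3]
    linarith
  · have h := hp2 S hν (fun s hs k => by
      refine ((NSE.n3_toU (v s) k).trans (hN s hs)).trans ?_
      rw [div_le_iff₀ (by positivity)]
      have : c1 * ν * (C1 / (4 * π ^ 2) + 1 / c1) = c1 * ν * (C1 / (4 * π ^ 2)) + ν := by
        field_simp
      have : 0 ≤ c1 * ν * (C1 / (4 * π ^ 2)) := by positivity
      linarith)
    intro s hs t ht hst
    simp only [NSE.enst_eq]
    exact mul_le_mul_of_nonneg_left (h hs ht hst) (by positivity)
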